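/- arXiv:2008.09888 — 2 statements merged into one kernel-verified Lean document; each statement's English description precedes it below -/
import Mathlib

section
/- For every orientation K of the complete graph K₄ (i.e., every tournament on 4 vertices), mader_χ⃗(K) = 4; that is, every digraph with dichromatic number at least 4 contains a subdivision of K, and there is a digraph with dichromatic number 3 containing no subdivision of K. -/
/-- A digraph on a vertex type `V`: a set of arcs given by an adjacency relation. -/
structure Digraph' (V : Type) where
  Adj : V → V → Prop

namespace Digraph'

variable {V : Type}

/-- A digraph is loopless if it has no arc from a vertex to itself. -/
def Loopless (D : Digraph' V) : Prop := ∀ v, ¬ D.Adj v v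

/-- A set `S` of vertices is acyclic in `D` if the subdigraph induced by `S`
contains no directed cycle (equivalently, no vertex can reach itself by a
nontrivial directed walk staying inside `S`). -/
def AcyclicOn (D : Digraph' V) (S : Set V) : Prop :=
  ∀ v, ¬ Relation.TransGen (fun x y => x ∈ S ∧ y ∈ S ∧ D.Adj x y) v v

/-- An acyclic coloring of `D` with `k` colors: every color class induces an
acyclic subdigraph. -/
def IsAcyclicColoring (D : Digraph' V) {k : ℕ} (c : V → Fin k) : Prop :=
  ∀ i : Fin k, D.AcyclicOn {v | c v = i}

/-- The dichromatic number of `D`: the least `k` such that `D` admits an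
acyclic coloring with `k` colors. -/
noncomputable def dichromaticNumber (D : Digraph' V) : ℕ :=
  sInf {k : ℕ | ∃ c : V → Fin k, D.IsAcyclicColoring c}

/-- `D.IsDipath u l v`: the list `u :: l ++ [v]` is a directed path in `D`
from `u` to `v`, with (pairwise distinct) internal vertices `l`. -/
def IsDipath (D : Digraph' V) (u : V) (l : List V) (v : V) : Prop :=
  (u :: l ++ [v]).Chain' D.Adj ∧ (u :: l ++ [v]).Nodup

/-- `D.ContainsSubdivision F`: some subdigraph of `D` is a subdivision of `F`.
Concretely, there is an injective map `β` of the vertices of `F` into `D`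
(the branch vertices), and for every arc `(a,b)` of `F` a directed path in
`D` from `β a` to `β b`, such that the internal vertices of these paths avoid
all branch vertices and the paths of distinct arcs are internally disjoint. -/
def ContainsSubdivision {α : Type} (D : Digraph' V) (F : Digraph' α) : Prop :=
  ∃ (β : α → V) (p : ∀ a b, F.Adj a b → List V),
    Function.Injective β ∧
    (∀ a b (h : F.Adj a b), D.IsDipath (β a) (p a b h) (β b)) ∧
    (∀ a b (h : F.Adj a b) (x : V), x ∈ p a b h → x ∉ Set.range β) ∧
    (∀ a b (h : F.Adj a b) (a' b' : α) (h' : F.Adj a' b'),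
      (a, b) ≠ (a', b') → ∀ x, x ∈ p a b h → x ∉ p a' b' h')

/-- `MaderBound F k`: every (finite, loopless) digraph with dichromatic number
at least `k` contains a subdivision of `F`. -/
def MaderBound {α : Type} (F : Digraph' α) (k : ℕ) : Prop :=
  ∀ (n : ℕ) (D : Digraph' (Fin n)), D.Loopless →
    k ≤ D.dichromaticNumber → D.ContainsSubdivision F

/-- The dichromatic Mader number of `F`: the smallest integer `k ≥ 1` such that
every digraph with dichromatic number at least `k` contains a subdivision of `F`. -/
noncomputable def mader {α : Type} (F : Digraph' α) : ℕ :=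
  sInf {k : ℕ | 1 ≤ k ∧ MaderBound F k}

/-- A digraph is strongly connected if every vertex can reach every other
vertex by a directed path. -/
def StronglyConnected (D : Digraph' V) : Prop :=
  ∀ x y : V, Relation.ReflTransGen D.Adj x y

/-- The subdigraph of `D` induced by a set `S` of vertices. -/
def induce (D : Digraph' V) (S : Set V) : Digraph' S :=
  ⟨fun a b => D.Adj a.1 b.1⟩

end Digraph'

/-- `D` is an orientation of the undirected simple graph `G`: the arcs of `D`
are obtained by choosing exactly one direction for each edge of `G`. -/
def IsOrientationOf {γ : Type} (D : Digraph' γ) (G : SimpleGraph γ) : Prop :=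
  (∀ a b, D.Adj a b → G.Adj a b) ∧
  (∀ a b, G.Adj a b → ((D.Adj a b ∨ D.Adj b a) ∧ ¬ (D.Adj a b ∧ D.Adj b a)))


namespace Digraph'

/-- There is a directed walk from `u` to `v` of length at least one all of whose interior
vertices lie in `I`. -/
inductive Link {V : Type} (D : Digraph' V) (I : Set V) : V → V → Prop
  | one {u v : V} : D.Adj u v → Link D I u v
  | cons {u w v : V} : D.Adj u w → w ∈ I → Link D I w v → Link D I u v

theorem Link.mono {V : Type} {D : Digraph' V} {I J : Set V} (h : I ⊆ J) {u v : V}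
    (hl : Link D I u v) : Link D J u v := by
  induction hl with
  | one h1 => exact Link.one h1
  | cons h1 h2 _ ih => exact Link.cons h1 (h h2) ih

theorem Link.trans {V : Type} {D : Digraph' V} {I : Set V} {u w v : V}
    (hl : Link D I u w) (hw : w ∈ I) (hr : Link D I w v) : Link D I u v := by
  induction hl with
  | one h1 => exact Link.cons h1 hw hr
  | cons h1 h2 _ ih => exact Link.cons h1 h2 (ih hw hr)

/-- The list form of a link: a directed path with interior in `I`. -/
theorem Link.exists_path {V : Type} {D : Digraph' V} {I : Set V} {u v : V}
    (hl : Link D I u v) (huv : u ≠ v) (hv : v ∉ I) :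
    ∃ l : List V, (∀ y ∈ l, y ∈ I) ∧ D.IsDipath u l v := by
  classical
  induction hl with
  | one h1 =>
    refine ⟨[], by simp, ?_, ?_⟩
    · simpa [List.Chain'] using h1
    · simpa using huv
  | @cons u w v h1 h2 _ ih =>
    obtain ⟨l, hlI, hch, hnd⟩ := ih (fun h => hv (h ▸ h2)) hv
    by_cases hu : u ∈ w :: l
    · obtain ⟨l1, l2, hl⟩ := List.append_of_mem hu
      refine ⟨l2, ?_, ?_, ?_⟩
      · intro y hy
        have : y ∈ w :: l := by rw [hl]; simp [hy]
        rcases List.mem_cons.1 this with h | h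
        · exact h ▸ h2
        · exact hlI y h
      · rw [hl, List.append_assoc] at hch
        exact (List.isChain_append.1 hch).2.1
      · rw [hl, List.append_assoc] at hnd
        exact (List.nodup_append.1 hnd).2.1
    · refine ⟨w :: l, ?_, ?_, ?_⟩
      · intro y hy
        rcases List.mem_cons.1 hy with h | h
        · exact h ▸ h2
        · exact hlI y h
      · exact List.IsChain.cons_cons h1 hch
      · simp only [List.cons_append] at hnd ⊢
        refine List.nodup_cons.2 ⟨?_, hnd⟩
        intro h
        rw [← List.cons_append, List.mem_append] at h
        rcases h with h | h
        · exact hu h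
        · exact huv (by simpa using h)

theorem link_of_path {V : Type} {D : Digraph' V} {I : Set V} {v : V} (l : List V) :
    ∀ {u : V}, (u :: l ++ [v]).Chain' D.Adj → (∀ y ∈ l, y ∈ I) → Link D I u v := by
  induction l with
  | nil => intro u h _; exact Link.one (by simpa [List.Chain'] using h)
  | cons w l ih =>
    intro u h hI
    have h' : D.Adj u w ∧ (w :: l ++ [v]).Chain' D.Adj := by
      simpa [List.Chain'] using h
    exact Link.cons h'.1 (hI w (by simp)) (ih h'.2 (fun y hy => hI y (by simp [hy])))

/-- Building a subdivision from links with pairwise disjoint interiors. -/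
theorem containsSubdivision_of_links {V α : Type} {D : Digraph' V} (F : Digraph' α)
    (β : α → V) (I : α → α → Set V) (hβ : Function.Injective β)
    (hF : F.Loopless)
    (hl : ∀ a b, F.Adj a b → Link D (I a b) (β a) (β b))
    (hav : ∀ a b, F.Adj a b → ∀ c, β c ∉ I a b)
    (hdis : ∀ a b a' b', F.Adj a b → F.Adj a' b' → (a, b) ≠ (a', b') →
      ∀ y, y ∈ I a b → y ∉ I a' b') : D.ContainsSubdivision F := by
  have h : ∀ a b (h : F.Adj a b), ∃ l : List V, (∀ y ∈ l, y ∈ I a b) ∧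
      D.IsDipath (β a) l (β b) := by
    intro a b h
    refine (hl a b h).exists_path ?_ (hav a b h b)
    intro hab
    have := hβ hab
    subst this
    exact hF _ h
  choose p hp using h
  refine ⟨β, p, hβ, fun a b h => (hp a b h).2, ?_, ?_⟩
  · rintro a b h y hy ⟨c, rfl⟩
    exact hav a b h c ((hp a b h).1 _ hy)
  · intro a b h a' b' h' hne y hy hy'
    exact hdis a b a' b' h h' hne y ((hp a b h).1 _ hy) ((hp a' b' h').1 _ hy')

theorem ContainsSubdivision.of_hom {V α γ : Type} {D : Digraph' V} {F : Digraph' α}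
    {K : Digraph' γ} (h : D.ContainsSubdivision F) (e : γ → α) (he : Function.Injective e)
    (hh : ∀ a b, K.Adj a b → F.Adj (e a) (e b)) : D.ContainsSubdivision K := by
  obtain ⟨β, p, h1, h2, h3, h4⟩ := h
  refine ⟨β ∘ e, fun a b h => p (e a) (e b) (hh a b h), h1.comp he, fun a b h => h2 _ _ _,
    ?_, ?_⟩
  · rintro a b h x hx ⟨c, rfl⟩
    exact h3 _ _ _ _ hx ⟨e c, rfl⟩
  · intro a b h a' b' h' hne x hx
    refine h4 _ _ _ _ _ _ ?_ x hx
    intro heq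
    exact hne (Prod.ext (he (congrArg Prod.fst heq)) (he (congrArg Prod.snd heq)))

/-- The reversed digraph. -/
def rev {V : Type} (D : Digraph' V) : Digraph' V := ⟨fun a b => D.Adj b a⟩

theorem isDipath_rev {V : Type} {D : Digraph' V} {u v : V} {l : List V}
    (h : D.rev.IsDipath u l v) : D.IsDipath v l.reverse u := by
  obtain ⟨h1, h2⟩ := h
  have e : v :: l.reverse ++ [u] = (u :: l ++ [v]).reverse := by simp
  refine ⟨?_, ?_⟩
  · rw [e]
    exact List.isChain_reverse.2 h1
  · rw [e]
    exact List.nodup_reverse.2 h2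

theorem ContainsSubdivision.of_rev {V α : Type} {D : Digraph' V} {F : Digraph' α}
    (h : D.rev.ContainsSubdivision F) : D.ContainsSubdivision F.rev := by
  obtain ⟨β, p, h1, h2, h3, h4⟩ := h
  refine ⟨β, fun a b h => (p b a h).reverse, h1, fun a b h => isDipath_rev (h2 b a h), ?_, ?_⟩
  · intro a b h x hx
    exact h3 _ _ h x (by simpa using hx)
  · intro a b h a' b' h' hne x hx hx'
    refine h4 b a h b' a' h' ?_ x (by simpa using hx) (by simpa using hx')
    intro heq
    exact hne (Prod.ext (congrArg Prod.snd heq) (congrArg Prod.fst heq))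

theorem acyclicOn_rev {V : Type} {D : Digraph' V} {S : Set V} (h : D.rev.AcyclicOn S) :
    D.AcyclicOn S := by
  intro v hv
  apply h v
  rw [← Relation.transGen_swap] at hv
  refine Relation.TransGen.mono ?_ _ _ hv
  rintro a b ⟨h1, h2, h3⟩
  exact ⟨h2, h1, h3⟩

end Digraph'
namespace Digraph'

/-- A depth first search forest of the subdigraph induced by `S`, with all roots in `N`. -/
structure IsDFS {V : Type} (D : Digraph' V) (S N : Set V) (le : V → V → Prop) (f : V → ℕ) :
    Prop where
  left_mem : ∀ u v, le u v → u ∈ S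
  right_mem : ∀ u v, le u v → v ∈ S
  refl : ∀ u ∈ S, le u u
  trans : ∀ u v w, le u v → le v w → le u w
  antisymm : ∀ u v, le u v → le v u → u = v
  chain : ∀ u v w, le u w → le v w → le u v ∨ le v u
  path : ∀ u v, le u v → u ≠ v → Link D {w | le u w ∧ le w v ∧ w ≠ u ∧ w ≠ v} u v
  rank : ∀ u ∈ S, ∀ v ∈ S, D.Adj u v → u ≠ v → ¬ le v u → f v < f u
  root : ∀ v ∈ S, ∃ ρ ∈ N, ∀ w, le w v → le ρ w

theorem exists_isDFS {V : Type} [Finite V] (D : Digraph' V) (n : ℕ) :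
    ∀ (S N : Set V), S.ncard = n → N ⊆ S →
      (∀ v ∈ S, v ∈ N ∨ ∃ u ∈ N, Link D S u v) →
      ∃ le f, IsDFS D S N le f := by
  classical
  induction n using Nat.strong_induction_on with
  | _ n ih =>
  intro S N hS hN hreach
  rcases S.eq_empty_or_nonempty with rfl | ⟨v0, hv0⟩
  · exact ⟨fun _ _ => False, fun _ => 0, by constructor <;> simp⟩
  obtain ⟨r, hr⟩ : ∃ r, r ∈ N := by
    rcases hreach v0 hv0 with h | ⟨u, hu, _⟩
    · exact ⟨_, h⟩
    · exact ⟨_, hu⟩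
  have hrS := hN hr
  -- the set of vertices reached from the root
  let A : Set V := {v | v ∈ S ∧ (v = r ∨ Link D S r v)}
  have hrA : r ∈ A := ⟨hrS, Or.inl rfl⟩
  have hAS : A ⊆ S := fun v hv => hv.1
  have hAcl : ∀ u v, u ∈ A → v ∈ S → D.Adj u v → v ∈ A := by
    rintro u v ⟨hu, rfl | hu'⟩ hv huv
    · exact ⟨hv, Or.inr (Link.one huv)⟩
    · exact ⟨hv, Or.inr (hu'.trans hu (Link.one huv))⟩
  -- the part below the root
  have key1 : ∀ {u v : V}, Link D S u v → u ∈ A → v ∈ S → v ≠ r →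
      (∃ w, D.Adj r w ∧ w ∈ A ∧ w ≠ r ∧ (w = v ∨ Link D (A \ {r}) w v)) ∨
      (u ≠ r ∧ Link D (A \ {r}) u v) := by
    intro u v h
    induction h with
    | @one u v h =>
      intro hu hv hvr
      by_cases hur : u = r
      · subst hur
        exact Or.inl ⟨v, h, hAcl _ _ hu hv h, hvr, Or.inl rfl⟩
      · exact Or.inr ⟨hur, Link.one h⟩
    | @cons u w v h1 h2 h3 ih3 =>
      intro hu hv hvr
      have hw : w ∈ A := hAcl _ _ hu h2 h1
      rcases ih3 hw hv hvr with h | ⟨hwr, h⟩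
      · exact Or.inl h
      · by_cases hur : u = r
        · subst hur
          exact Or.inl ⟨w, h1, hw, hwr, Or.inr h⟩
        · exact Or.inr ⟨hur, Link.cons h1 ⟨hw, hwr⟩ h⟩
  obtain ⟨le1, f1, H1⟩ := ih (A \ {r}).ncard (by
      rw [← hS]
      exact Set.ncard_lt_ncard ⟨fun v hv => hAS hv.1, fun h => (h hrS).2 rfl⟩)
    (A \ {r}) {w | w ∈ A ∧ w ≠ r ∧ D.Adj r w} rfl (fun w hw => ⟨hw.1, hw.2.1⟩) (by
      rintro v ⟨hvA, hvr⟩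
      have hvr : v ≠ r := hvr
      have hl : Link D S r v := by
        rcases hvA.2 with h | h
        · exact absurd h hvr
        · exact h
      rcases key1 hl hrA hvA.1 hvr with ⟨w, h1, h2, h3, h4⟩ | ⟨h, _⟩
      · rcases h4 with rfl | h4
        · exact Or.inl ⟨h2, h3, h1⟩
        · exact Or.inr ⟨w, ⟨h2, h3, h1⟩, h4⟩
      · exact absurd rfl h)
  -- the rest
  have key2 : ∀ {u v : V}, Link D S u v → u ∈ S → v ∈ S → v ∉ A →
      u ∉ A ∧ Link D (S \ A) u v := by
    intro u v h
    induction h with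
    | @one u v h =>
      intro hu hv hvA
      exact ⟨fun hu' => hvA (hAcl _ _ hu' hv h), Link.one h⟩
    | @cons u w v h1 h2 h3 ih3 =>
      intro hu hv hvA
      obtain ⟨hw, h⟩ := ih3 h2 hv hvA
      exact ⟨fun hu' => hw (hAcl _ _ hu' h2 h1), Link.cons h1 ⟨h2, hw⟩ h⟩
  obtain ⟨le2, f2, H2⟩ := ih (S \ A).ncard (by
      rw [← hS]
      exact Set.ncard_lt_ncard ⟨fun v hv => hv.1, fun h => (h hrS).2 hrA⟩)
    (S \ A) (N \ A) rfl (fun w hw => ⟨hN hw.1, hw.2⟩) (by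
      rintro v ⟨hvS, hvA⟩
      rcases hreach v hvS with h | ⟨u, hu, h⟩
      · exact Or.inl ⟨h, hvA⟩
      · obtain ⟨h1, h2⟩ := key2 h (hN hu) hvS hvA
        exact Or.inr ⟨u, ⟨hu, h1⟩, h2⟩)
  obtain ⟨M, hM⟩ : ∃ M, ∀ v, f1 v < M := by
    obtain ⟨M, hM⟩ := (Set.finite_range f1).bddAbove
    exact ⟨M + 1, fun v => Nat.lt_succ_of_le (hM ⟨v, rfl⟩)⟩
  refine ⟨fun u v => le1 u v ∨ (u = r ∧ v ∈ A) ∨ le2 u v,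
    fun v => if v = r then M else if v ∈ A then f1 v else M + 1 + f2 v, ?_⟩
  have l1 := H1.left_mem
  have r1 := H1.right_mem
  have l2 := H2.left_mem
  have r2 := H2.right_mem
  have nr1 : ∀ u, ¬ le1 u r := fun u h => (r1 _ _ h).2 rfl
  have nr2 : ∀ u, ¬ le2 u r := fun u h => (r2 _ _ h).2 hrA
  have nr2' : ∀ u, ¬ le2 r u := fun u h => (l2 _ _ h).2 hrA
  have e12 : ∀ u v w, le1 u v → le2 v w → False := fun u v w h1 h2 => (l2 _ _ h2).2 (r1 _ _ h1).1
  have e21 : ∀ u v w, le2 u v → le1 v w → False := fun u v w h1 h2 => (r2 _ _ h1).2 (l1 _ _ h2).1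
  have e12' : ∀ u v w, le1 u w → le2 v w → False := fun u v w h1 h2 => (r2 _ _ h2).2 (r1 _ _ h1).1
  constructor
  · rintro u v (h | ⟨rfl, h⟩ | h)
    · exact hAS (l1 _ _ h).1
    · exact hrS
    · exact (l2 _ _ h).1
  · rintro u v (h | ⟨rfl, h⟩ | h)
    · exact hAS (r1 _ _ h).1
    · exact hAS h
    · exact (r2 _ _ h).1
  · intro u hu
    by_cases hur : u = r
    · exact Or.inr (Or.inl ⟨hur, hur ▸ hrA⟩)
    · by_cases huA : u ∈ A
      · exact Or.inl (H1.refl u ⟨huA, hur⟩)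
      · exact Or.inr (Or.inr (H2.refl u ⟨hu, huA⟩))
  · rintro u v w (h | ⟨rfl, h⟩ | h) (h' | ⟨rfl, h'⟩ | h')
    · exact Or.inl (H1.trans _ _ _ h h')
    · exact absurd h (nr1 _)
    · exact (e12 _ _ _ h h').elim
    · exact Or.inr (Or.inl ⟨rfl, (r1 _ _ h').1⟩)
    · exact Or.inr (Or.inl ⟨rfl, h'⟩)
    · exact absurd h (l2 _ _ h').2
    · exact (e21 _ _ _ h h').elim
    · exact absurd h (nr2 _)
    · exact Or.inr (Or.inr (H2.trans _ _ _ h h'))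
  · rintro u v (h | ⟨rfl, h⟩ | h) (h' | ⟨hh, h'⟩ | h')
    · exact H1.antisymm _ _ h h'
    · subst hh
      exact absurd h (nr1 _)
    · exact (e12 _ _ _ h h').elim
    · exact absurd h' (nr1 _)
    · exact hh.symm
    · exact absurd h' (nr2 _)
    · exact (e21 _ _ _ h h').elim
    · subst hh
      exact absurd h (nr2 _)
    · exact H2.antisymm _ _ h h'
  · rintro u v w (h | ⟨rfl, h⟩ | h) (h' | ⟨hh, h'⟩ | h')
    · exact (H1.chain _ _ _ h h').imp Or.inl Or.inl
    · exact Or.inr (Or.inr (Or.inl ⟨hh, (l1 _ _ h).1⟩))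
    · exact (e12' _ _ _ h h').elim
    · exact Or.inl (Or.inr (Or.inl ⟨rfl, (l1 _ _ h').1⟩))
    · exact Or.inl (Or.inr (Or.inl ⟨rfl, hh ▸ hrA⟩))
    · exact absurd h (r2 _ _ h').2
    · exact (e12' _ _ _ h' h).elim
    · exact absurd h' (r2 _ _ h).2
    · exact (H2.chain _ _ _ h h').imp (fun h => Or.inr (Or.inr h)) (fun h => Or.inr (Or.inr h))
  · rintro u v (h | ⟨rfl, h⟩ | h) hne
    · refine (H1.path _ _ h hne).mono ?_
      rintro w ⟨h1, h2, h3⟩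
      exact ⟨Or.inl h1, Or.inl h2, h3⟩
    · have hv : v ∈ A \ {u} := ⟨h, fun h => hne h.symm⟩
      obtain ⟨ρ, ⟨hρA, hρr, hadj⟩, hρ⟩ := H1.root v hv
      by_cases hρv : ρ = v
      · subst hρv
        exact Link.one hadj
      · have hle := hρ v (H1.refl v hv)
        refine Link.cons hadj ⟨Or.inr (Or.inl ⟨rfl, hρA⟩), Or.inl hle, hρr, hρv⟩ ?_
        refine (H1.path _ _ hle hρv).mono ?_
        rintro w ⟨h1, h2, h3, h4⟩
        exact ⟨Or.inr (Or.inl ⟨rfl, (r1 _ _ h1).1⟩), Or.inl h2, (r1 _ _ h1).2, h4⟩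
    · refine (H2.path _ _ h hne).mono ?_
      rintro w ⟨h1, h2, h3⟩
      exact ⟨Or.inr (Or.inr h1), Or.inr (Or.inr h2), h3⟩
  · intro u hu v hv huv hne hle
    have hvr : ¬ (v = r ∧ u ∈ A) := fun h => hle (Or.inr (Or.inl h))
    by_cases hur : u = r
    · subst hur
      have hvA := hAcl _ _ hrA hv huv
      simp only [if_neg (Ne.symm hne), if_true, hvA]
      exact hM v
    · by_cases huA : u ∈ A
      · have hvA := hAcl _ _ huA hv huv
        have hvr' : v ≠ r := fun h => hvr ⟨h, huA⟩
        simp only [if_neg hur, if_neg hvr', huA, hvA, if_true]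
        exact H1.rank u ⟨huA, hur⟩ v ⟨hvA, hvr'⟩ huv hne (fun h => hle (Or.inl h))
      · by_cases hvr' : v = r
        · simp only [if_neg hur, if_pos hvr', if_neg huA]
          omega
        · by_cases hvA : v ∈ A
          · simp only [if_neg hur, if_neg hvr', if_neg huA, if_pos hvA]
            have := hM v
            omega
          · simp only [if_neg hur, if_neg hvr', if_neg huA, if_neg hvA]
            have := H2.rank u ⟨hu, huA⟩ v ⟨hv, hvA⟩ huv hne (fun h => hle (Or.inr (Or.inr h)))
            omega
  · intro v hv
    by_cases hvA : v ∈ A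
    · refine ⟨r, hr, ?_⟩
      rintro w (h | ⟨rfl, h⟩ | h)
      · exact Or.inr (Or.inl ⟨rfl, (l1 _ _ h).1⟩)
      · exact Or.inr (Or.inl ⟨rfl, hrA⟩)
      · exact absurd hvA (r2 _ _ h).2
    · obtain ⟨ρ, hρ, h⟩ := H2.root v ⟨hv, hvA⟩
      refine ⟨ρ, hρ.1, ?_⟩
      rintro w (h' | ⟨rfl, h'⟩ | h')
      · exact absurd (r1 _ _ h').1 hvA
      · exact absurd h' hvA
      · exact Or.inr (Or.inr (h w h'))

/-- A depth first search order on the whole digraph, as a partial order. -/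
theorem exists_dfs_order {V : Type} [Finite V] (D : Digraph' V) :
    ∃ (_ : PartialOrder V) (f : V → ℕ),
      (∀ u v w : V, u ≤ w → v ≤ w → u ≤ v ∨ v ≤ u) ∧
      (∀ u v : V, u < v → Link D (Set.Ioo u v) u v) ∧
      (∀ u v : V, D.Adj u v → u ≠ v → ¬ v < u → f v < f u) := by
  obtain ⟨le, f, H⟩ := exists_isDFS D _ Set.univ Set.univ rfl (fun _ h => h)
    (fun v hv => Or.inl hv)
  let P : PartialOrder V :=
    { le := le
      le_refl := fun u => H.refl u trivial
      le_trans := H.trans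
      le_antisymm := H.antisymm }
  refine ⟨P, f, H.chain, ?_, ?_⟩
  · intro u v huv
    refine (H.path u v huv.le huv.ne).mono ?_
    rintro w ⟨h1, h2, h3, h4⟩
    exact ⟨lt_of_le_of_ne h1 (Ne.symm h3), lt_of_le_of_ne h2 h4⟩
  · intro u v huv hne h
    refine H.rank u trivial v trivial huv hne ?_
    intro hle
    exact h (lt_of_le_of_ne hle (Ne.symm hne))

end Digraph'

namespace Digraph'

section crit
variable {V : Type} [PartialOrder V]

/-- Back arcs with respect to the tree order. -/
def Bk (D : Digraph' V) (u v : V) : Prop := D.Adj u v ∧ v < u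

/-- The back arcs inside `U` are properly 3-colorable. -/
def Col (D : Digraph' V) (U : Set V) : Prop :=
  ∃ c : V → Fin 3, ∀ u ∈ U, ∀ v ∈ U, D.Bk u v → c u ≠ c v

/-- The working context extracted from a critical set. -/
structure Ctx (D : Digraph' V) (U : Set V) (x : V) : Prop where
  chain : ∀ u v w : V, u ≤ w → v ≤ w → u ≤ v ∨ v ≤ u
  path : ∀ u v : V, u < v → Link D (Set.Ioo u v) u v
  xU : x ∈ U
  xmax : ∀ u ∈ U, x ≤ u → u = x
  sep : ∀ s ∈ U, (s = x ∨ D.Bk x s) → ∀ Z : Set V, Z ⊆ U → x ∉ Z → s ∉ Z → Z.Nonempty →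
    (∃ w ∈ U, w ∉ Z ∧ w ≠ x ∧ w ≠ s) →
    (∀ u ∈ U, ∀ v ∈ U, D.Bk u v → u ∈ Z → v ∉ Z → v = x ∨ v = s) →
    (∀ u ∈ U, ∀ v ∈ U, D.Bk u v → u ∉ Z → v ∈ Z → u = x ∨ u = s) → False

theorem perm3 : ∀ a b a' b' : Fin 3, (a = b ↔ a' = b') →
    ∃ σ : Equiv.Perm (Fin 3), σ a = a' ∧ σ b = b' := by decide

theorem exists_ctx [Finite V] (D : Digraph' V)
    (chain : ∀ u v w : V, u ≤ w → v ≤ w → u ≤ v ∨ v ≤ u)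
    (path : ∀ u v : V, u < v → Link D (Set.Ioo u v) u v)
    (h : ¬ D.Col Set.univ) :
    ∃ (U : Set V) (x : V) (b : Fin 3 → V), D.Ctx U x ∧ Function.Injective b ∧
      (∀ i, b i ∈ U) ∧ ∀ i, D.Bk x (b i) := by
  classical
  obtain ⟨U, hU, hmin⟩ := (wellFounded_lt (α := Set V)).has_min {U | ¬ D.Col U} ⟨_, h⟩
  have hmin' : ∀ W : Set V, W ⊆ U → (∃ w ∈ U, w ∉ W) → D.Col W := by
    intro W h1 ⟨w, h2, h3⟩
    by_contra hc
    exact hmin W hc ⟨h1, fun h4 => h3 (h4 h2)⟩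
  have hne : U.Nonempty := by
    by_contra hc
    rw [Set.not_nonempty_iff_eq_empty] at hc
    subst hc
    exact hU ⟨fun _ => 0, by simp⟩
  obtain ⟨x, hx⟩ := (Set.toFinite U).exists_maximal hne
  have xmax : ∀ u ∈ U, x ≤ u → u = x := fun u hu h => le_antisymm (hx.2 hu h) h
  have hxU : x ∈ U := hx.1
  obtain ⟨c, hc⟩ := hmin' (U \ {x}) Set.diff_subset ⟨x, hxU, by simp⟩
  have hb : ∀ i : Fin 3, ∃ b, b ∈ U ∧ D.Bk x b ∧ c b = i := by
    intro i
    by_contra hcon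
    push Not at hcon
    apply hU
    refine ⟨Function.update c x i, ?_⟩
    intro u hu v hv huv
    by_cases h1 : u = x
    · subst h1
      have h2 : v ≠ u := huv.2.ne
      rw [Function.update_self, Function.update_of_ne h2]
      exact (hcon v hv huv).symm
    · by_cases h2 : v = x
      · subst h2
        exact absurd (xmax u hu huv.2.le) h1
      · rw [Function.update_of_ne h1, Function.update_of_ne h2]
        exact hc u ⟨hu, h1⟩ v ⟨hv, h2⟩ huv
  choose b hb1 hb2 hb3 using hb
  refine ⟨U, x, b, ⟨chain, path, hxU, xmax, ?_⟩, ?_, hb1, hb2⟩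
  · intro s hs hsx Z hZ hxZ hsZ hZn ⟨w, hw1, hw2, hw3, hw4⟩ hout hin
    obtain ⟨z, hz⟩ := hZn
    obtain ⟨c1, hc1⟩ := hmin' (Z ∪ {x, s}) (by
      intro y hy
      rcases hy with hy | rfl | rfl
      · exact hZ hy
      · exact hxU
      · exact hs) ⟨w, hw1, by simp [hw2, hw3, hw4]⟩
    obtain ⟨c2, hc2⟩ := hmin' (U \ Z) Set.diff_subset ⟨z, hZ hz, by simp [hz]⟩
    have hiff : c1 x = c1 s ↔ c2 x = c2 s := by
      rcases hsx with rfl | hsx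
      · simp
      · have e1 := hc1 x (by simp) s (by simp) hsx
        have e2 := hc2 x ⟨hxU, hxZ⟩ s ⟨hs, hsZ⟩ hsx
        simp [e1, e2]
    obtain ⟨σ, h1, h2⟩ := perm3 _ _ _ _ hiff
    have hag : ∀ y, y = x ∨ y = s → σ (c1 y) = c2 y := by
      rintro y (rfl | rfl) <;> assumption
    apply hU
    refine ⟨fun y => if y ∈ Z then σ (c1 y) else c2 y, ?_⟩
    intro u hu v hv huv
    by_cases h3 : u ∈ Z <;> by_cases h4 : v ∈ Z
    · simp only [h3, h4, if_true]
      exact fun h => hc1 u (Or.inl h3) v (Or.inl h4) huv (σ.injective h)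
    · simp only [h3, h4, if_true, if_false]
      have h5 := hout u hu v hv huv h3 h4
      rw [← hag v h5]
      exact fun h => hc1 u (Or.inl h3) v (Or.inr h5) huv (σ.injective h)
    · simp only [h3, h4, if_true, if_false]
      have h5 := hin u hu v hv huv h3 h4
      rw [← hag u h5]
      exact fun h => hc1 u (Or.inr h5) v (Or.inl h4) huv (σ.injective h)
    · simp only [h3, h4, if_false]
      exact hc2 u ⟨hu, h3⟩ v ⟨hv, h4⟩ huv
  · intro i j hij
    rw [← hb3 i, ← hb3 j, hij]

theorem exists_sorted {D : Digraph' V} {U : Set V} {x : V} (hC : D.Ctx U x) (b : Fin 3 → V)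
    (hb : Function.Injective b) (hx : ∀ i, D.Bk x (b i)) :
    ∃ i j k, b i < b j ∧ b j < b k := by
  have cmp : ∀ i j, i ≠ j → b i < b j ∨ b j < b i := by
    intro i j hij
    have h1 : b i ≠ b j := fun h => hij (hb h)
    rcases hC.chain (b i) (b j) x (hx i).2.le (hx j).2.le with h | h
    · exact Or.inl (lt_of_le_of_ne h h1)
    · exact Or.inr (lt_of_le_of_ne h h1.symm)
  rcases cmp 0 1 (by decide) with h1 | h1 <;> rcases cmp 1 2 (by decide) with h2 | h2 <;>
    rcases cmp 0 2 (by decide) with h3 | h3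
  · exact ⟨_, _, _, h1, h2⟩
  · exact ⟨_, _, _, h1, h2⟩
  · exact ⟨_, _, _, h3, h2⟩
  · exact ⟨_, _, _, h3, h1⟩
  · exact ⟨_, _, _, h1, h3⟩
  · exact ⟨_, _, _, h2, h3⟩
  · exact ⟨_, _, _, h2, h1⟩
  · exact ⟨_, _, _, h2, h1⟩

end crit

theorem dichromatic_le_of_col {V : Type} [PartialOrder V] (D : Digraph' V) (hD : D.Loopless)
    (f : V → ℕ) (hf : ∀ u v, D.Adj u v → u ≠ v → ¬ v < u → f v < f u)
    (h : D.Col Set.univ) : D.dichromaticNumber ≤ 3 := by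
  obtain ⟨c, hc⟩ := h
  apply Nat.sInf_le
  refine ⟨c, ?_⟩
  intro i v hv
  have : ∀ w, Relation.TransGen (fun x y => x ∈ {v | c v = i} ∧ y ∈ {v | c v = i} ∧ D.Adj x y) v w
      → f w < f v := by
    intro w hw
    have step : ∀ a b, (a ∈ {v | c v = i} ∧ b ∈ {v | c v = i} ∧ D.Adj a b) → f b < f a := by
      rintro a b ⟨h1, h2, h3⟩
      refine hf a b h3 (fun e => hD b (e ▸ h3)) (fun h4 => ?_)
      exact hc a trivial b trivial ⟨h3, h4⟩ (by rw [h1, h2])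
    induction hw with
    | single h => exact step _ _ h
    | tail _ h ih => exact (step _ _ h).trans ih
  exact lt_irrefl _ (this v hv)

end Digraph'

namespace Digraph'

/-- The digraph on four vertices with prescribed six arcs. -/
def six (e : Fin 6 → Fin 4 × Fin 4) : Digraph' (Fin 4) := ⟨fun a b => ∃ k, e k = (a, b)⟩

def TT4 : Digraph' (Fin 4) := six ![(0,1), (0,2), (0,3), (1,2), (1,3), (2,3)]
def S4 : Digraph' (Fin 4) := six ![(0,1), (1,2), (2,3), (3,0), (2,0), (3,1)]
def Wp : Digraph' (Fin 4) := six ![(0,1), (0,2), (0,3), (1,2), (2,3), (3,1)]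

theorem cs_six {V : Type} {D : Digraph' V} (e : Fin 6 → Fin 4 × Fin 4)
    (he : ∀ k, (e k).1 ≠ (e k).2) {p q r s : V}
    (J0 J1 J2 J3 J4 J5 : Set V)
    (hl : ∀ k, Link D (![J0, J1, J2, J3, J4, J5] k) (![p, q, r, s] (e k).1) (![p, q, r, s] (e k).2))
    (hnd : p ≠ q ∧ p ≠ r ∧ p ≠ s ∧ q ≠ r ∧ q ≠ s ∧ r ≠ s)
    (hav : ∀ y, y = p ∨ y = q ∨ y = r ∨ y = s →
      y ∉ J0 ∧ y ∉ J1 ∧ y ∉ J2 ∧ y ∉ J3 ∧ y ∉ J4 ∧ y ∉ J5)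
    (hd : ∀ y, (y ∈ J0 → y ∉ J1 ∧ y ∉ J2 ∧ y ∉ J3 ∧ y ∉ J4 ∧ y ∉ J5) ∧
      (y ∈ J1 → y ∉ J2 ∧ y ∉ J3 ∧ y ∉ J4 ∧ y ∉ J5) ∧
      (y ∈ J2 → y ∉ J3 ∧ y ∉ J4 ∧ y ∉ J5) ∧ (y ∈ J3 → y ∉ J4 ∧ y ∉ J5) ∧
      (y ∈ J4 → y ∉ J5)) : D.ContainsSubdivision (six e) := by
  classical
  have hav' : ∀ (k : Fin 6) (c : Fin 4), ![p, q, r, s] c ∉ ![J0, J1, J2, J3, J4, J5] k := by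
    intro k c
    have := hav (![p, q, r, s] c) (by fin_cases c <;> simp)
    obtain ⟨h0, h1, h2, h3, h4, h5⟩ := this
    fin_cases k <;> assumption
  have hd0 : ∀ (k l : Fin 6), k < l → ∀ y, y ∈ ![J0, J1, J2, J3, J4, J5] k →
      y ∉ ![J0, J1, J2, J3, J4, J5] l := by
    intro k l hkl y
    obtain ⟨h0, h1, h2, h3, h4⟩ := hd y
    fin_cases k <;> fin_cases l <;> first
      | exact absurd hkl (by decide)
      | exact fun a => (h0 a).1
      | exact fun a => (h0 a).2.1
      | exact fun a => (h0 a).2.2.1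
      | exact fun a => (h0 a).2.2.2.1
      | exact fun a => (h0 a).2.2.2.2
      | exact fun a => (h1 a).1
      | exact fun a => (h1 a).2.1
      | exact fun a => (h1 a).2.2.1
      | exact fun a => (h1 a).2.2.2
      | exact fun a => (h2 a).1
      | exact fun a => (h2 a).2.1
      | exact fun a => (h2 a).2.2
      | exact fun a => (h3 a).1
      | exact fun a => (h3 a).2
      | exact fun a => h4 a
  have hd' : ∀ (k l : Fin 6), k ≠ l → ∀ y, y ∈ ![J0, J1, J2, J3, J4, J5] k →
      y ∉ ![J0, J1, J2, J3, J4, J5] l := by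
    intro k l hkl y h1 h2
    rcases lt_or_gt_of_ne hkl with h | h
    · exact hd0 _ _ h y h1 h2
    · exact hd0 _ _ h y h2 h1
  let K : Fin 4 → Fin 4 → Fin 6 := fun a b => if h : ∃ k, e k = (a, b) then h.choose else 0
  have hK : ∀ a b, (six e).Adj a b → e (K a b) = (a, b) := by
    intro a b h
    have h' : ∃ k, e k = (a, b) := h
    simp only [K, dif_pos h']
    exact h'.choose_spec
  refine containsSubdivision_of_links (six e) ![p, q, r, s]
    (fun a b => ![J0, J1, J2, J3, J4, J5] (K a b)) ?_ ?_ ?_ ?_ ?_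
  · intro a b hab
    obtain ⟨h1, h2, h3, h4, h5, h6⟩ := hnd
    fin_cases a <;> fin_cases b <;> first | rfl | (simp at hab; grind)
  · rintro a ⟨k, hk⟩
    exact he k (by rw [hk])
  · intro a b h
    have := hl (K a b)
    rw [hK a b h] at this
    exact this
  · intro a b h c
    exact hav' _ _
  · intro a b a' b' h h' hne y
    refine hd' _ _ (fun hk => hne ?_) y
    rw [← hK a b h, ← hK a' b' h', hk]

theorem cs_S4 {V : Type} {D : Digraph' V} {p q r s : V} (J0 J1 J2 J3 J4 J5 : Set V)
    (h0 : Link D J0 p q) (h1 : Link D J1 q r) (h2 : Link D J2 r s) (h3 : Link D J3 s p)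
    (h4 : Link D J4 r p) (h5 : Link D J5 s q)
    (hnd : p ≠ q ∧ p ≠ r ∧ p ≠ s ∧ q ≠ r ∧ q ≠ s ∧ r ≠ s)
    (hav : ∀ y, y = p ∨ y = q ∨ y = r ∨ y = s →
      y ∉ J0 ∧ y ∉ J1 ∧ y ∉ J2 ∧ y ∉ J3 ∧ y ∉ J4 ∧ y ∉ J5)
    (hd : ∀ y, (y ∈ J0 → y ∉ J1 ∧ y ∉ J2 ∧ y ∉ J3 ∧ y ∉ J4 ∧ y ∉ J5) ∧
      (y ∈ J1 → y ∉ J2 ∧ y ∉ J3 ∧ y ∉ J4 ∧ y ∉ J5) ∧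
      (y ∈ J2 → y ∉ J3 ∧ y ∉ J4 ∧ y ∉ J5) ∧ (y ∈ J3 → y ∉ J4 ∧ y ∉ J5) ∧
      (y ∈ J4 → y ∉ J5)) : D.ContainsSubdivision S4 := by
  refine cs_six _ (by decide) J0 J1 J2 J3 J4 J5 ?_ hnd hav hd
  intro k
  fin_cases k <;> assumption

theorem cs_Wp {V : Type} {D : Digraph' V} {p q r s : V} (J0 J1 J2 J3 J4 J5 : Set V)
    (h0 : Link D J0 p q) (h1 : Link D J1 p r) (h2 : Link D J2 p s) (h3 : Link D J3 q r)
    (h4 : Link D J4 r s) (h5 : Link D J5 s q)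
    (hnd : p ≠ q ∧ p ≠ r ∧ p ≠ s ∧ q ≠ r ∧ q ≠ s ∧ r ≠ s)
    (hav : ∀ y, y = p ∨ y = q ∨ y = r ∨ y = s →
      y ∉ J0 ∧ y ∉ J1 ∧ y ∉ J2 ∧ y ∉ J3 ∧ y ∉ J4 ∧ y ∉ J5)
    (hd : ∀ y, (y ∈ J0 → y ∉ J1 ∧ y ∉ J2 ∧ y ∉ J3 ∧ y ∉ J4 ∧ y ∉ J5) ∧
      (y ∈ J1 → y ∉ J2 ∧ y ∉ J3 ∧ y ∉ J4 ∧ y ∉ J5) ∧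
      (y ∈ J2 → y ∉ J3 ∧ y ∉ J4 ∧ y ∉ J5) ∧ (y ∈ J3 → y ∉ J4 ∧ y ∉ J5) ∧
      (y ∈ J4 → y ∉ J5)) : D.ContainsSubdivision Wp := by
  refine cs_six _ (by decide) J0 J1 J2 J3 J4 J5 ?_ hnd hav hd
  intro k
  fin_cases k <;> assumption

theorem cs_TT4 {V : Type} {D : Digraph' V} {p q r s : V} (J0 J1 J2 J3 J4 J5 : Set V)
    (h0 : Link D J0 p q) (h1 : Link D J1 p r) (h2 : Link D J2 p s) (h3 : Link D J3 q r)
    (h4 : Link D J4 q s) (h5 : Link D J5 r s)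
    (hnd : p ≠ q ∧ p ≠ r ∧ p ≠ s ∧ q ≠ r ∧ q ≠ s ∧ r ≠ s)
    (hav : ∀ y, y = p ∨ y = q ∨ y = r ∨ y = s →
      y ∉ J0 ∧ y ∉ J1 ∧ y ∉ J2 ∧ y ∉ J3 ∧ y ∉ J4 ∧ y ∉ J5)
    (hd : ∀ y, (y ∈ J0 → y ∉ J1 ∧ y ∉ J2 ∧ y ∉ J3 ∧ y ∉ J4 ∧ y ∉ J5) ∧
      (y ∈ J1 → y ∉ J2 ∧ y ∉ J3 ∧ y ∉ J4 ∧ y ∉ J5) ∧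
      (y ∈ J2 → y ∉ J3 ∧ y ∉ J4 ∧ y ∉ J5) ∧ (y ∈ J3 → y ∉ J4 ∧ y ∉ J5) ∧
      (y ∈ J4 → y ∉ J5)) : D.ContainsSubdivision TT4 := by
  refine cs_six _ (by decide) J0 J1 J2 J3 J4 J5 ?_ hnd hav hd
  intro k
  fin_cases k <;> assumption

end Digraph'

namespace Digraph'

section s4
variable {V : Type} [PartialOrder V] {D : Digraph' V} {U : Set V} {x : V}

theorem Ctx.suf (hC : D.Ctx U x) {y a m : V} (h : D.Adj y a) (ha : a ≤ m) :
    Link D {v | a ≤ v ∧ v < m} y m := by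
  rcases ha.eq_or_lt with rfl | h1
  · exact Link.one h
  · have h2 : Link D {v | a ≤ v ∧ v < m} a m :=
      (hC.path a m h1).mono (by intro v hv; exact ⟨hv.1.le, hv.2⟩)
    exact Link.cons h (show a ∈ {v | a ≤ v ∧ v < m} from ⟨le_rfl, h1⟩) h2

theorem Ctx.back (hC : D.Ctx U x) {w y a m : V} (hw : w ≤ y) (h : D.Adj y a) (ha : a ≤ m) :
    Link D {v | (w < v ∧ v ≤ y) ∨ (a ≤ v ∧ v < m)} w m := by
  have h1 : Link D {v | (w < v ∧ v ≤ y) ∨ (a ≤ v ∧ v < m)} y m :=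
    (hC.suf h ha).mono (fun v hv => Or.inr hv)
  rcases hw.eq_or_lt with rfl | h2
  · exact h1
  · exact ((hC.path w y h2).mono (fun v hv => Or.inl ⟨hv.1, hv.2.le⟩)).trans
      (Or.inl ⟨h2, le_rfl⟩) h1

theorem Ctx.meet [Finite V] (hC : D.Ctx U x) {b y : V} (h1 : b ≤ x) (h2 : b ≤ y) :
    ∃ w, w ≤ x ∧ w ≤ y ∧ ∀ v, v ≤ x → v ≤ y → v ≤ w := by
  obtain ⟨w, hw⟩ := (Set.toFinite {v | v ≤ x ∧ v ≤ y}).exists_maximal ⟨b, h1, h2⟩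
  refine ⟨w, hw.1.1, hw.1.2, fun v h3 h4 => ?_⟩
  rcases hC.chain v w x h3 hw.1.1 with h | h
  · exact h
  · exact hw.2 ⟨h3, h4⟩ h

theorem Ctx.contains_S4 [Finite V] (hC : D.Ctx U x) {b1 b2 b3 : V}
    (hU1 : b1 ∈ U) (hU2 : b2 ∈ U) (hU3 : b3 ∈ U)
    (h1 : D.Bk x b1) (h2 : D.Bk x b2) (h3 : D.Bk x b3) (h12 : b1 < b2) (h23 : b2 < b3) :
    D.ContainsSubdivision S4 := by
  by_cases hex : ∃ y ∈ U, y ≠ x ∧ (∃ v, b2 < v ∧ v ≤ x ∧ v ≤ y) ∧ ∃ a, D.Bk y a ∧ a < b2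
  · obtain ⟨y, hyU, hyx, ⟨v0, hv1, hv2, hv3⟩, a, hya, hab⟩ := hex
    obtain ⟨w, hwx, hwy, hw⟩ := hC.meet hv2 hv3
    have hb2w : b2 < w := lt_of_lt_of_le hv1 (hw v0 hv2 hv3)
    have hwx' : w < x := lt_of_le_of_ne hwx (fun h => hyx (hC.xmax y hyU (h ▸ hwy)))
    obtain ⟨m, ham, hbm, hmb, hm⟩ : ∃ m, a ≤ m ∧ b1 ≤ m ∧ m < b2 ∧ (m = a ∨ m = b1) := by
      rcases hC.chain a b1 b2 hab.le h12.le with h | h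
      · exact ⟨b1, h, le_rfl, h12, Or.inr rfl⟩
      · exact ⟨a, le_rfl, h, hab, Or.inl rfl⟩
    refine cs_S4 (p := m) (q := b2) (r := w) (s := x) (Set.Ioo m b2) (Set.Ioo b2 w) (Set.Ioo w x)
      {v | b1 ≤ v ∧ v < m} {v | (w < v ∧ v ≤ y) ∨ (a ≤ v ∧ v < m)} ∅
      (hC.path _ _ hmb) (hC.path _ _ hb2w) (hC.path _ _ hwx') (hC.suf h1.1 hbm)
      (hC.back hwy hya.1 ham) (Link.one h2.1) ?_ ?_ ?_
    · grind
    · have hxy : ¬ x ≤ y := fun h => hyx (hC.xmax y hyU h)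
      simp only [Set.mem_Ioo, Set.mem_ofPred_eq, Set.mem_empty_iff_false]
      all_goals grind (splits := 20)
    · simp only [Set.mem_Ioo, Set.mem_ofPred_eq, Set.mem_empty_iff_false]
      intro v
      have := hw v
      refine ⟨?_, ?_, ?_, ?_, ?_⟩
      all_goals grind (splits := 20)
  · exfalso
    push Not at hex
    refine hC.sep b2 hU2 (Or.inr h2) {w | w ∈ U ∧ w ≠ x ∧ ∃ v, b2 < v ∧ v ≤ x ∧ v ≤ w}
      (fun w hw => hw.1) (by simp) ?_ ⟨b3, hU3, h3.2.ne, b3, h23, h3.2.le, le_rfl⟩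
      ⟨b1, hU1, ?_, h1.2.ne, h12.ne⟩ ?_ ?_
    · rintro ⟨_, _, v, h4, _, h6⟩
      exact absurd h6 (not_le_of_gt h4)
    · rintro ⟨_, _, v, h4, _, h6⟩
      exact absurd (h12.trans h4) (not_lt_of_ge h6)
    · rintro u hu v hv huv ⟨_, hux, v0, h4, h5, h6⟩ hvZ
      by_contra hc
      push Not at hc
      rcases hC.chain v v0 u huv.2.le h6 with h | h
      · rcases hC.chain v b2 v0 h h4.le with h7 | h7
        · exact hex u hu hux ⟨v0, h4, h5, h6⟩ v huv (lt_of_le_of_ne h7 hc.2)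
        · exact hvZ ⟨hv, hc.1, v, lt_of_le_of_ne h7 hc.2.symm, h.trans h5, le_rfl⟩
      · exact hvZ ⟨hv, hc.1, v0, h4, h5, h⟩
    · rintro u hu v hv huv huZ ⟨_, hux, v0, h4, h5, h6⟩
      by_contra hc
      push Not at hc
      exact huZ ⟨hu, hc.1, v0, h4, h5, h6.trans huv.2.le⟩

end s4
end Digraph'

namespace Digraph'

theorem Link.first_hit {V : Type} {D : Digraph' V} {I C : Set V} {u y : V} (h : Link D I u y)
    (hy : y ∈ C) : ∃ w ∈ C, (w ∈ I ∨ w = y) ∧ Link D (I \ C) u w := by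
  induction h with
  | one h1 => exact ⟨_, hy, Or.inr rfl, Link.one h1⟩
  | @cons u w v h1 h2 _ ih =>
    by_cases hw : w ∈ C
    · exact ⟨w, hw, Or.inl h2, Link.one h1⟩
    · obtain ⟨w', h3, h4, h5⟩ := ih hy
      exact ⟨w', h3, h4, Link.cons h1 ⟨h2, hw⟩ h5⟩

section wp
variable {V : Type} [PartialOrder V] {D : Digraph' V} {U : Set V} {x : V}

theorem Ctx.contains_Wp (hC : D.Ctx U x) {b1 b2 b3 : V}
    (hU1 : b1 ∈ U) (hU2 : b2 ∈ U) (hU3 : b3 ∈ U)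
    (h1 : D.Bk x b1) (h2 : D.Bk x b2) (h3 : D.Bk x b3) (h12 : b1 < b2) (h23 : b2 < b3) :
    D.ContainsSubdivision Wp := by
  obtain ⟨S, hS⟩ : ∃ S : Set V, ∀ w, w ∈ S ↔ (∃ v, b2 < v ∧ v ≤ x ∧ v ≤ w) ∧ ¬ x ≤ w :=
    ⟨{w | (∃ v, b2 < v ∧ v ≤ x ∧ v ≤ w) ∧ ¬ x ≤ w}, fun w => Iff.rfl⟩
  have hS2 : ∀ w ∈ S, b2 < w ∧ ¬ x ≤ w := by
    intro w hw
    obtain ⟨⟨v, h4, _, h6⟩, h7⟩ := (hS w).1 hw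
    exact ⟨lt_of_lt_of_le h4 h6, h7⟩
  have hb3S : b3 ∈ S := (hS b3).2 ⟨⟨b3, h23, h3.2.le, le_rfl⟩, not_le_of_gt h3.2⟩
  by_cases hex : ∃ y ∈ U, y ∈ S ∧ (y = b3 ∨ Link D S b3 y) ∧ ∃ a, D.Bk y a ∧ a < b2
  · obtain ⟨y, hyU, hyS, hyl, a, hya, hab⟩ := hex
    obtain ⟨hby, hxy⟩ := hS2 y hyS
    obtain ⟨m, ham, hbm, hmb, hm⟩ : ∃ m, a ≤ m ∧ b1 ≤ m ∧ m < b2 ∧ (m = a ∨ m = b1) := by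
      rcases hC.chain a b1 b2 hab.le h12.le with h | h
      · exact ⟨b1, h, le_rfl, h12, Or.inr rfl⟩
      · exact ⟨a, le_rfl, h, hab, Or.inl rfl⟩
    obtain ⟨C, hCm⟩ : ∃ C : Set V, ∀ v, v ∈ C ↔ b2 < v ∧ v ≤ y :=
      ⟨{v | b2 < v ∧ v ≤ y}, fun v => Iff.rfl⟩
    obtain ⟨w, hwC, hwl⟩ : ∃ w ∈ C, Link D (S \ C) x w := by
      by_cases hb3 : b3 ∈ C
      · exact ⟨b3, hb3, Link.one h3.1⟩
      · rcases hyl with rfl | hyl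
        · exact absurd ((hCm y).2 ⟨hby, le_rfl⟩) hb3
        · obtain ⟨w, h4, _, h6⟩ := hyl.first_hit ((hCm y).2 ⟨hby, le_rfl⟩)
          exact ⟨w, h4, Link.cons h3.1 ⟨hb3S, hb3⟩ h6⟩
    obtain ⟨hbw, hwy⟩ := (hCm w).1 hwC
    have hbx := h2.2
    refine cs_Wp (p := x) (q := m) (r := b2) (s := w) {v | b1 ≤ v ∧ v < m} ∅ (S \ C)
      (Set.Ioo m b2) (Set.Ioo b2 w) {v | (w < v ∧ v ≤ y) ∨ (a ≤ v ∧ v < m)}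
      (hC.suf h1.1 hbm) (Link.one h2.1) hwl (hC.path _ _ hmb) (hC.path _ _ hbw)
      (hC.back hwy hya.1 ham) ?_ ?_ ?_
    · grind
    · simp only [Set.mem_Ioo, Set.mem_ofPred_eq, Set.mem_empty_iff_false, Set.mem_sdiff]
      intro z hz
      have e1 := hS2 z
      have e2 := hCm z
      refine ⟨?_, ?_, ?_, ?_, ?_, ?_⟩
      all_goals grind (splits := 20)
    · simp only [Set.mem_Ioo, Set.mem_ofPred_eq, Set.mem_empty_iff_false, Set.mem_sdiff]
      intro z
      have e1 := hS2 z
      have e2 := hCm z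
      refine ⟨?_, ?_, ?_, ?_, ?_⟩
      all_goals grind (splits := 20)
  · exfalso
    push Not at hex
    refine hC.sep b2 hU2 (Or.inr h2) {w | w ∈ U ∧ w ∈ S ∧ (w = b3 ∨ Link D S b3 w)}
      (fun w hw => hw.1) (fun h => (hS2 x h.2.1).2 le_rfl)
      (fun h => lt_irrefl _ (hS2 b2 h.2.1).1) ⟨b3, hU3, hb3S, Or.inl rfl⟩
      ⟨b1, hU1, fun h => lt_asymm h12 (hS2 b1 h.2.1).1, h1.2.ne, h12.ne⟩ ?_ ?_
    · rintro u hu v hv huv ⟨_, huS, hul⟩ hvZ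
      by_contra hc
      push Not at hc
      have hnx : ¬ x ≤ v := fun h => (hS2 u huS).2 (h.trans huv.2.le)
      obtain ⟨⟨v0, h4, h5, h6⟩, _⟩ := (hS u).1 huS
      have hvl : v = b3 ∨ Link D S b3 v := by
        rcases hul with rfl | hul
        · exact Or.inr (Link.one huv.1)
        · exact Or.inr (hul.trans huS (Link.one huv.1))
      rcases hC.chain v v0 u huv.2.le h6 with h | h
      · rcases hC.chain v b2 v0 h h4.le with h7 | h7
        · exact hex u hu huS hul v huv (lt_of_le_of_ne h7 hc.2)
        · exact hvZ ⟨hv, (hS v).2 ⟨⟨v, lt_of_le_of_ne h7 hc.2.symm, h.trans h5, le_rfl⟩, hnx⟩, hvl⟩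
      · exact hvZ ⟨hv, (hS v).2 ⟨⟨v0, h4, h5, h⟩, hnx⟩, hvl⟩
    · rintro u hu v hv huv huZ ⟨_, hvS, hvl⟩
      by_contra hc
      push Not at hc
      have hnx : ¬ x ≤ u := fun h => hc.1 (hC.xmax u hu h)
      obtain ⟨⟨v0, h4, h5, h6⟩, _⟩ := (hS v).1 hvS
      have hl : Link D S v u := (hC.path v u huv.2).mono (by
        intro z hz
        exact (hS z).2 ⟨⟨v0, h4, h5, h6.trans hz.1.le⟩, fun h => hnx (h.trans hz.2.le)⟩)
      refine huZ ⟨hu, (hS u).2 ⟨⟨v0, h4, h5, h6.trans huv.2.le⟩, hnx⟩, Or.inr ?_⟩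
      rcases hvl with rfl | hvl
      · exact hl
      · exact hvl.trans hvS hl

end wp
end Digraph'

namespace Digraph'

section conn
variable {V : Type} {D : Digraph' V}

theorem tt4_core2 {s t a b : V} {L1 L2 L3 : List V}
    (h1 : (s :: L1 ++ [t]).IsChain D.Adj) (h2 : (s :: L2 ++ [t]).IsChain D.Adj)
    (h3 : (s :: L3 ++ [t]).IsChain D.Adj) (n1 : L1.Nodup) (n2 : L2.Nodup)
    (hst : s ≠ t) (hn : ∀ y, y = s ∨ y = t → y ∉ L1 ∧ y ∉ L2 ∧ y ∉ L3)
    (hd : ∀ y, (y ∈ L1 → y ∉ L2 ∧ y ∉ L3) ∧ (y ∈ L2 → y ∉ L3))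
    (ha : a ∈ L1) (hb : b ∈ L2)
    (hc : Link D {y | (y ≠ s ∧ y ≠ t) ∧ y ∉ L1 ∧ y ∉ L2 ∧ y ∉ L3} a b) :
    D.ContainsSubdivision TT4 := by
  obtain ⟨A, B, rfl⟩ := List.append_of_mem ha
  obtain ⟨A', B', rfl⟩ := List.append_of_mem hb
  have e1 : Link D {y | y ∈ A} s a := by
    refine link_of_path A (h1.infix ⟨[], B ++ [t], by simp⟩) (fun y hy => hy)
  have e2 : Link D {y | y ∈ B} a t := by
    refine link_of_path B (h1.infix ⟨s :: A, [], by simp⟩) (fun y hy => hy)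
  have e3 : Link D {y | y ∈ A'} s b := by
    refine link_of_path A' (h2.infix ⟨[], B' ++ [t], by simp⟩) (fun y hy => hy)
  have e4 : Link D {y | y ∈ B'} b t := by
    refine link_of_path B' (h2.infix ⟨s :: A', [], by simp⟩) (fun y hy => hy)
  have e5 : Link D {y | y ∈ L3} s t := link_of_path L3 h3 (fun y hy => hy)
  have ns := hn s (Or.inl rfl)
  have nt := hn t (Or.inr rfl)
  have da := hd a
  have db := hd b
  simp only [List.mem_append, List.mem_cons] at ns nt da db hd
  simp only [List.nodup_append, List.nodup_cons, List.mem_cons] at n1 n2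
  obtain ⟨_, ⟨n3, _⟩, n4⟩ := n1
  obtain ⟨_, ⟨n5, _⟩, n6⟩ := n2
  have n7 : a ∉ A := fun h => n4 a h a (Or.inl rfl) rfl
  have n8 : b ∉ A' := fun h => n6 b h b (Or.inl rfl) rfl
  refine cs_TT4 (p := s) (q := a) (r := b) (s := t) {y | y ∈ A} {y | y ∈ A'} {y | y ∈ L3} _
    {y | y ∈ B} {y | y ∈ B'} e1 e3 e5 hc e2 e4 ?_ ?_ ?_
  · refine ⟨?_, ?_, hst, ?_, ?_, ?_⟩ <;> rintro rfl <;> simp_all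
  · rintro y (rfl | rfl | rfl | rfl) <;>
      simp only [Set.mem_ofPred_eq, List.mem_append, List.mem_cons] <;> refine ⟨?_, ?_, ?_, ?_, ?_, ?_⟩ <;>
      grind (splits := 20)
  · intro y
    have dy := hd y
    have m1 : y ∈ A → y ∉ B := fun h h' => n4 y h y (Or.inr h') rfl
    have m2 : y ∈ A' → y ∉ B' := fun h h' => n6 y h y (Or.inr h') rfl
    simp only [Set.mem_ofPred_eq, List.mem_append, List.mem_cons]
    refine ⟨?_, ?_, ?_, ?_, ?_⟩ <;> intro hy <;> grind (splits := 20)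

theorem tt4_core {s t v1 v2 : V} {L1 L2 L3 : List V}
    (h1 : (s :: L1 ++ [t]).IsChain D.Adj) (h2 : (s :: L2 ++ [t]).IsChain D.Adj)
    (h3 : (s :: L3 ++ [t]).IsChain D.Adj) (n1 : L1.Nodup) (n2 : L2.Nodup) (n3 : L3.Nodup)
    (hst : s ≠ t) (hn : ∀ y, y = s ∨ y = t → y ∉ L1 ∧ y ∉ L2 ∧ y ∉ L3)
    (hd : ∀ y, (y ∈ L1 → y ∉ L2 ∧ y ∉ L3) ∧ (y ∈ L2 → y ∉ L3))
    (ha : v1 ∈ L1) (hb : v2 ∈ L2) (hc : Link D {y | y ≠ s ∧ y ≠ t} v1 v2) :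
    D.ContainsSubdivision TT4 := by
  have key : ∀ u b, Link D {y | y ≠ s ∧ y ≠ t} u b → b ∈ L2 → D.ContainsSubdivision TT4 ∨
      ∃ b' ∈ L2, Link D {y | (y ≠ s ∧ y ≠ t) ∧ y ∉ L1 ∧ y ∉ L2 ∧ y ∉ L3} u b' := by
    intro u b h
    induction h with
    | one h => exact fun hb => Or.inr ⟨_, hb, Link.one h⟩
    | @cons u w v h4 h5 _ ih =>
      intro hb
      rcases ih hb with h | ⟨b', hb', hl⟩
      · exact Or.inl h
      · by_cases w2 : w ∈ L2
        · exact Or.inr ⟨w, w2, Link.one h4⟩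
        · by_cases w1 : w ∈ L1
          · exact Or.inl (tt4_core2 h1 h2 h3 n1 n2 hst hn hd w1 hb' hl)
          · by_cases w3 : w ∈ L3
            · refine Or.inl (tt4_core2 h3 h2 h1 n3 n2 hst ?_ ?_ w3 hb' (hl.mono ?_))
              · intro y hy; have := hn y hy; tauto
              · intro y; have := hd y; tauto
              · rintro y ⟨h6, h7, h8, h9⟩; exact ⟨h6, h9, h8, h7⟩
            · exact Or.inr ⟨b', hb', Link.cons h4 ⟨h5, w1, w2, w3⟩ hl⟩
  rcases key v1 v2 hc hb with h | ⟨b', hb', hl⟩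
  · exact h
  · exact tt4_core2 h1 h2 h3 n1 n2 hst hn hd ha hb' hl

theorem two_paths {s v t : V} {A B : Set V} (h1 : Link D A s v) (h2 : Link D B v t)
    (hsv : s ≠ v) (hvt : v ≠ t) (hvA : v ∉ A) (hvB : v ∉ B) (htB : t ∉ B)
    (hd : ∀ y, y ∈ A → y ∉ B) :
    ∃ L : List V, (s :: L ++ [t]).IsChain D.Adj ∧ L.Nodup ∧ v ∈ L ∧
      ∀ y ∈ L, y ∈ A ∨ y = v ∨ y ∈ B := by
  obtain ⟨l, hl, hc, hn⟩ := h1.exists_path hsv hvA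
  obtain ⟨l', hl', hc', hn'⟩ := h2.exists_path hvt htB
  refine ⟨l ++ v :: l', ?_, ?_, by simp, ?_⟩
  · have e : s :: (l ++ v :: l') ++ [t] = (s :: l) ++ ([v] ++ (l' ++ [t])) := by simp
    rw [e, ← List.append_assoc]
    refine List.IsChain.append_overlap (l₂ := [v]) hc hc' (by simp)
  · rw [List.nodup_append]
    simp only [List.nodup_cons, List.cons_append, List.nodup_append] at hn hn'
    refine ⟨hn.2.1, List.nodup_cons.2 ⟨fun h => hvB (hl' v h), hn'.2.1⟩, ?_⟩
    rintro a ha b hb rfl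
    rcases List.mem_cons.1 hb with rfl | hb
    · exact hvA (hl _ ha)
    · exact hd a (hl a ha) (hl' a hb)
  · intro y hy
    rcases List.mem_append.1 hy with hy | hy
    · exact Or.inl (hl y hy)
    · rcases List.mem_cons.1 hy with rfl | hy
      · exact Or.inr (Or.inl rfl)
      · exact Or.inr (Or.inr (hl' y hy))

theorem tt4_conn {s t v1 v2 : V} (A1 B1 A2 B2 C : Set V)
    (a1 : Link D A1 s v1) (b1 : Link D B1 v1 t) (a2 : Link D A2 s v2) (b2 : Link D B2 v2 t)
    (c : Link D C s t) (hst : s ≠ t)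
    (hn : ∀ y, y = s ∨ y = t → y ∉ A1 ∧ y ∉ B1 ∧ y ∉ A2 ∧ y ∉ B2 ∧ y ∉ C ∧ y ≠ v1 ∧ y ≠ v2)
    (hv : ∀ y, y = v1 ∨ y = v2 → y ∉ A1 ∧ y ∉ B1 ∧ y ∉ A2 ∧ y ∉ B2 ∧ y ∉ C) (h12 : v1 ≠ v2)
    (hd : ∀ y, (y ∈ A1 → y ∉ B1 ∧ y ∉ A2 ∧ y ∉ B2 ∧ y ∉ C) ∧ (y ∈ B1 → y ∉ A2 ∧ y ∉ B2 ∧ y ∉ C) ∧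
      (y ∈ A2 → y ∉ B2 ∧ y ∉ C) ∧ (y ∈ B2 → y ∉ C))
    (hc : Link D {y | y ≠ s ∧ y ≠ t} v1 v2) : D.ContainsSubdivision TT4 := by
  have ns := hn s (Or.inl rfl)
  have nt := hn t (Or.inr rfl)
  have d1 := hv v1 (Or.inl rfl)
  have d2 := hv v2 (Or.inr rfl)
  obtain ⟨L1, p1, p2, p3, p4⟩ := two_paths a1 b1 ns.2.2.2.2.2.1 nt.2.2.2.2.2.1.symm d1.1 d1.2.1
    nt.2.1 (fun y hy => ((hd y).1 hy).1)
  obtain ⟨L2, q1, q2, q3, q4⟩ := two_paths a2 b2 ns.2.2.2.2.2.2 nt.2.2.2.2.2.2.symm d2.2.2.1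
    d2.2.2.2.1 nt.2.2.2.1 (fun y hy => ((hd y).2.2.1 hy).1)
  obtain ⟨L3, r1, r2, r3⟩ := c.exists_path hst nt.2.2.2.2.1
  have r4 : L3.Nodup := by
    simp only [List.nodup_cons, List.cons_append, List.nodup_append] at r3
    exact r3.2.1
  refine tt4_core p1 q1 r2 p2 q2 r4 hst ?_ ?_ p3 q3 hc
  · intro y hy
    have := hn y hy
    have x1 := p4 y
    have x2 := q4 y
    have x3 := r1 y
    grind (splits := 20)
  · intro y
    have := hd y
    have x1 := p4 y
    have x2 := q4 y
    have x3 := r1 y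
    refine ⟨fun hy => ⟨fun hy2 => ?_, fun hy2 => ?_⟩, fun hy hy2 => ?_⟩
    · rcases x1 hy with h | rfl | h <;> rcases x2 hy2 with h' | h' | h' <;> grind
    · rcases x1 hy with h | rfl | h <;> grind
    · rcases x2 hy with h | rfl | h <;> grind

end conn
end Digraph'

namespace Digraph'

theorem Link.avoid {V : Type} {D : Digraph' V} {I : Set V} {u v : V} (h : Link D I u v) :
    Link D (I \ {u}) u v := by
  have key : ∀ w, Link D I w v → Link D (I \ {u}) w v ∨ Link D (I \ {u}) u v := by
    intro w hw
    induction hw with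
    | one h1 => exact Or.inl (Link.one h1)
    | @cons a c v' h1 h2 _ ih =>
      rcases ih h with h3 | h3
      · by_cases hc : c = u
        · subst hc
          exact Or.inr h3
        · exact Or.inl (Link.cons h1 ⟨h2, hc⟩ h3)
      · exact Or.inr h3
  rcases key u h with h | h <;> exact h

theorem tt4_conn_or {V : Type} {D : Digraph' V} {s t v1 v2 : V} (A1 B1 A2 B2 C : Set V)
    (a1 : Link D A1 s v1) (b1 : Link D B1 v1 t) (a2 : Link D A2 s v2) (b2 : Link D B2 v2 t)
    (c : Link D C s t) (hst : s ≠ t)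
    (hn : ∀ y, y = s ∨ y = t → y ∉ A1 ∧ y ∉ B1 ∧ y ∉ A2 ∧ y ∉ B2 ∧ y ∉ C ∧ y ≠ v1 ∧ y ≠ v2)
    (hv : ∀ y, y = v1 ∨ y = v2 → y ∉ A1 ∧ y ∉ B1 ∧ y ∉ A2 ∧ y ∉ B2 ∧ y ∉ C) (h12 : v1 ≠ v2)
    (hd : ∀ y, (y ∈ A1 → y ∉ B1 ∧ y ∉ A2 ∧ y ∉ B2 ∧ y ∉ C) ∧ (y ∈ B1 → y ∉ A2 ∧ y ∉ B2 ∧ y ∉ C) ∧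
      (y ∈ A2 → y ∉ B2 ∧ y ∉ C) ∧ (y ∈ B2 → y ∉ C))
    (hc : Link D {y | y ≠ s ∧ y ≠ t} v1 v2 ∨ Link D {y | y ≠ s ∧ y ≠ t} v2 v1) :
    D.ContainsSubdivision TT4 := by
  rcases hc with hc | hc
  · exact tt4_conn A1 B1 A2 B2 C a1 b1 a2 b2 c hst hn hv h12 hd hc
  · refine tt4_conn A2 B2 A1 B1 C a2 b2 a1 b1 c hst ?_ ?_ h12.symm ?_ hc
    · intro y hy
      obtain ⟨h1, h2, h3, h4, h5, h6, h7⟩ := hn y hy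
      exact ⟨h3, h4, h1, h2, h5, h7, h6⟩
    · intro y hy
      obtain ⟨h1, h2, h3, h4, h5⟩ := hv y hy.symm
      exact ⟨h3, h4, h1, h2, h5⟩
    · intro y
      obtain ⟨h1, h2, h3, h4⟩ := hd y
      refine ⟨?_, ?_, ?_, ?_⟩
      all_goals grind (splits := 20)

section climb
variable {V : Type} [PartialOrder V] {D : Digraph' V} {U : Set V} {x : V}

theorem Ctx.conn (hC : D.Ctx U x) {p q t : V} (hp : p < x) (hq : q < x) (hpq : p ≠ q)
    (htp : t < p) (htq : t < q) :
    Link D {y | y ≠ x ∧ y ≠ t} p q ∨ Link D {y | y ≠ x ∧ y ≠ t} q p := by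
  rcases hC.chain p q x hp.le hq.le with h | h
  · left
    refine (hC.path p q (lt_of_le_of_ne h hpq)).mono ?_
    intro y hy
    exact ⟨(hy.2.trans hq).ne, (htp.trans hy.1).ne'⟩
  · right
    refine (hC.path q p (lt_of_le_of_ne h hpq.symm)).mono ?_
    intro y hy
    exact ⟨(hy.2.trans hp).ne, (htq.trans hy.1).ne'⟩

/-- The final argument: a stream `N` not hitting `s`. -/
theorem Ctx.tt4_D (hC : D.Ctx U x) {s p q : V} {I1 I2 N : Set V}
    (hpU : p ∈ U) (hqU : q ∈ U) (hp : D.Bk x p) (hq : D.Bk x q) (hsp : s < p)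
    (h1 : Link D I1 x s) (h2 : Link D I2 p s)
    (hI1 : ∀ y ∈ I1, s < y ∧ ¬ x ≤ y ∧ y ≠ p) (hI2 : ∀ y ∈ I2, s < y ∧ ¬ x ≤ y ∧ y ≠ p)
    (hN : ∀ y ∈ N, s < y ∧ ¬ x ≤ y ∧ y ≠ p) (h12 : ∀ y ∈ I1, y ∉ I2)
    (h1N : ∀ y ∈ I1, y ∉ N) (h2N : ∀ y ∈ I2, y ∉ N) (hqN : q ∈ N)
    (hreach : ∀ w ∈ N, w = q ∨ Link D N q w)
    (hout : ∀ u ∈ U, ∀ v ∈ U, D.Bk u v → u ∈ N → v ∈ N ∨ v < s)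
    (hin : ∀ u ∈ U, ∀ v ∈ U, D.Bk u v → v ∈ N → u ∈ N ∨ u = x) :
    D.ContainsSubdivision TT4 := by
  have hxN : x ∉ N := fun h => (hN x h).2.1 le_rfl
  have hpN : p ∉ N := fun h => (hN p h).2.2 rfl
  by_cases hex : ∃ u ∈ U, u ∈ N ∧ ∃ h, D.Bk u h ∧ h < s
  · obtain ⟨u, _, huN, h, huh, hhs⟩ := hex
    have e1 : Link D (N ∪ {v | h ≤ v ∧ v < s}) q s := by
      have e2 : Link D (N ∪ {v | h ≤ v ∧ v < s}) u s :=
        (hC.suf huh.1 hhs.le).mono Set.subset_union_right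
      rcases hreach u huN with rfl | h3
      · exact e2
      · exact (h3.mono Set.subset_union_left).trans (Or.inl huN) e2
    have e3 := e1.avoid
    have hpq : p ≠ q := fun e => hpN (e ▸ hqN)
    have hsq := (hN q hqN).1
    have hpx := hp.2
    have hqx := hq.2
    refine tt4_conn_or (s := x) (t := s) (v1 := p) (v2 := q) ∅ I2 ∅ _ I1 (Link.one hp.1) h2
      (Link.one hq.1) e3 h1 (hsp.trans hpx).ne' ?_ ?_ hpq ?_ (hC.conn hpx hqx hpq hsp hsq)
    · intro y hy
      have i1 := hI1 y
      have i2 := hI2 y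
      have i3 := hN y
      simp only [Set.mem_union, Set.mem_ofPred_eq, Set.mem_empty_iff_false, Set.mem_sdiff,
        Set.mem_singleton_iff]
      refine ⟨?_, ?_, ?_, ?_, ?_, ?_, ?_⟩
      all_goals grind (splits := 20)
    · intro y hy
      have i1 := hI1 y
      have i2 := hI2 y
      have i3 := hN y
      have i4 := h1N y
      have i5 := h2N y
      simp only [Set.mem_union, Set.mem_ofPred_eq, Set.mem_empty_iff_false, Set.mem_sdiff,
        Set.mem_singleton_iff]
      refine ⟨?_, ?_, ?_, ?_, ?_⟩
      all_goals grind (splits := 20)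
    · intro y
      have i1 := hI1 y
      have i2 := hI2 y
      have i4 := h1N y
      have i5 := h2N y
      have i6 := h12 y
      simp only [Set.mem_union, Set.mem_ofPred_eq, Set.mem_empty_iff_false, Set.mem_sdiff,
        Set.mem_singleton_iff]
      refine ⟨?_, ?_, ?_, ?_⟩
      all_goals grind (splits := 20)
  · exfalso
    push Not at hex
    refine hC.sep x hC.xU (Or.inl rfl) {w | w ∈ U ∧ w ∈ N} (fun w hw => hw.1)
      (fun h => hxN h.2) (fun h => hxN h.2) ⟨q, hqU, hqN⟩
      ⟨p, hpU, fun h => hpN h.2, hp.2.ne, hp.2.ne⟩ ?_ ?_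
    · rintro u hu v hv huv ⟨_, huN⟩ hvZ
      exfalso
      rcases hout u hu v hv huv huN with h | h
      · exact hvZ ⟨hv, h⟩
      · exact hex u hu huN v huv h
    · rintro u hu v hv huv huZ ⟨_, hvN⟩
      rcases hin u hu v hv huv hvN with h | h
      · exact absurd ⟨hu, h⟩ huZ
      · exact Or.inl h

end climb
end Digraph'

namespace Digraph'

section climb2
variable {V : Type} [PartialOrder V]

/-- The `i`-th stream of a labelling above level `τ`. -/
def Str (x τ : V) (f : V → Fin 3) (i : Fin 3) : Set V := {z | τ ≤ z ∧ ¬ x ≤ z ∧ f z = i}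

/-- The climbing state. -/
structure St (D : Digraph' V) (U : Set V) (x : V) (b : Fin 3 → V) (τ : V) (f : V → Fin 3) :
    Prop where
  le : τ ≤ x
  un : ∀ i, ¬ τ ≤ b i → ∀ w, w ∉ Str x τ f i
  st : ∀ i, τ ≤ b i → f (b i) = i
  reach : ∀ i, ∀ w ∈ Str x τ f i, w = b i ∨ Link D (Str x τ f i) (b i) w
  edge : ∀ u ∈ U, ∀ v ∈ U, D.Bk u v → τ ≤ v → ¬ x ≤ u → f u = f v

variable {D : Digraph' V} {U : Set V} {x τ : V} {b : Fin 3 → V} {f : V → Fin 3}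

theorem St.out (hS : D.St U x b τ f) (hC : D.Ctx U x) {i : Fin 3} {u v : V} (hu : u ∈ U)
    (hv : v ∈ U) (huv : D.Bk u v) (hui : u ∈ Str x τ f i) : v ∈ Str x τ f i ∨ v < τ := by
  obtain ⟨h1, h2, h3⟩ := hui
  by_cases h : τ ≤ v
  · left
    exact ⟨h, fun h4 => h2 (h4.trans huv.2.le), by rw [← h3, hS.edge u hu v hv huv h h2]⟩
  · right
    rcases hC.chain τ v u h1 huv.2.le with h4 | h4
    · exact absurd h4 h
    · exact lt_of_le_of_ne h4 (fun e => h e.ge)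

theorem St.inn (hS : D.St U x b τ f) (hC : D.Ctx U x) {i : Fin 3} {u v : V} (hu : u ∈ U)
    (hv : v ∈ U) (huv : D.Bk u v) (hvi : v ∈ Str x τ f i) : u ∈ Str x τ f i ∨ u = x := by
  obtain ⟨h1, h2, h3⟩ := hvi
  by_cases h : x ≤ u
  · exact Or.inr (hC.xmax u hu h)
  · exact Or.inl ⟨h1.trans huv.2.le, h, by rw [← h3, hS.edge u hu v hv huv h1 h]⟩

theorem St.root (hS : D.St U x b τ f) (hb : ∀ i, D.Bk x (b i)) {i : Fin 3} (h : τ ≤ b i) :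
    b i ∈ Str x τ f i := ⟨h, not_le_of_gt (hb i).2, hS.st i h⟩

theorem St.started (hS : D.St U x b τ f) {i : Fin 3} {u : V} (h : u ∈ Str x τ f i) : τ ≤ b i := by
  by_contra hc
  exact hS.un i hc u h

theorem St.hit (hS : D.St U x b τ f) {i : Fin 3} {u h : V}
    (hu : u ∈ Str x τ f i) (huh : D.Bk u h) : Link D (Str x τ f i) (b i) h := by
  rcases hS.reach i u hu with rfl | h1
  · exact Link.one huh.1
  · exact h1.trans hu (Link.one huh.1)

/-- two streams hit `h` and there is a disjoint third path. -/
theorem St.tt4_two (hS : D.St U x b τ f) (hC : D.Ctx U x) (hb : ∀ i, D.Bk x (b i))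
    {j k : Fin 3} (hjk : j ≠ k) {u u' h : V} (hh : h < τ)
    (hu : u ∈ Str x τ f j) (huh : D.Bk u h) (hu' : u' ∈ Str x τ f k) (huh' : D.Bk u' h)
    {C : Set V} (hl : Link D C x h)
    (hCd : ∀ y ∈ C, y ≠ x ∧ y ≠ h ∧ y ∉ Str x τ f j ∧ y ∉ Str x τ f k) :
    D.ContainsSubdivision TT4 := by
  have e1 := (hS.hit hu huh).avoid
  have e2 := (hS.hit hu' huh').avoid
  have sj := hS.started hu
  have sk := hS.started hu'
  have rj := hS.root hb sj
  have rk := hS.root hb sk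
  have hbb : b j ≠ b k := fun e => hjk (by rw [← rj.2.2, ← rk.2.2, e])
  have key : ∀ y, y ∈ Str x τ f j → y ∉ Str x τ f k := by
    intro y h1 h2
    exact hjk (h1.2.2.symm.trans h2.2.2)
  have key2 : ∀ i y, y ∈ Str x τ f i → y ≠ x ∧ y ≠ h := by
    intro i y hy
    exact ⟨fun e => hy.2.1 e.ge, fun e => not_le_of_gt hh (e ▸ hy.1)⟩
  refine tt4_conn_or (s := x) (t := h) (v1 := b j) (v2 := b k) ∅ _ ∅ _ C (Link.one (hb j).1) e1
    (Link.one (hb k).1) e2 hl (hh.trans_le hS.le).ne' ?_ ?_ hbb ?_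
    (hC.conn (hb j).2 (hb k).2 hbb (hh.trans_le sj) (hh.trans_le sk))
  · intro y hy
    have i1 := key2 j y
    have i2 := key2 k y
    have i3 := hCd y
    have i4 := key2 j _ rj
    have i5 := key2 k _ rk
    simp only [Set.mem_empty_iff_false, Set.mem_sdiff, Set.mem_singleton_iff]
    refine ⟨?_, ?_, ?_, ?_, ?_, ?_, ?_⟩
    all_goals grind (splits := 20)
  · intro y hy
    have i1 := key y
    have i3 := hCd y
    simp only [Set.mem_empty_iff_false, Set.mem_sdiff, Set.mem_singleton_iff]
    refine ⟨?_, ?_, ?_, ?_, ?_⟩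
    all_goals grind (splits := 20)
  · intro y
    have i1 := key y
    have i3 := hCd y
    simp only [Set.mem_empty_iff_false, Set.mem_sdiff, Set.mem_singleton_iff]
    refine ⟨?_, ?_, ?_, ?_⟩
    all_goals grind (splits := 20)

/-- stream `j` hits `h`, stream `k` does not. -/
theorem St.tt4_D (hS : D.St U x b τ f) (hC : D.Ctx U x) (hbU : ∀ i, b i ∈ U)
    (hb : ∀ i, D.Bk x (b i))
    {j k : Fin 3} (hjk : j ≠ k) {u h : V} (hh : h < τ)
    (hmax : ∀ u ∈ U, ∀ v ∈ U, D.Bk u v → τ ≤ u → ¬ x ≤ u → v < τ → v ≤ h)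
    (hu : u ∈ Str x τ f j) (huh : D.Bk u h) (hk : τ ≤ b k)
    (hnot : ∀ w ∈ U, w ∈ Str x τ f k → ¬ D.Bk w h)
    {C : Set V} (hl : Link D C x h)
    (hCd : ∀ y ∈ C, h < y ∧ ¬ x ≤ y ∧ y ∉ Str x τ f j ∧ y ∉ Str x τ f k) :
    D.ContainsSubdivision TT4 := by
  have e1 := (hS.hit hu huh).avoid
  have sj := hS.started hu
  have rj := hS.root hb sj
  have rk := hS.root hb hk
  have key : ∀ y, y ∈ Str x τ f j → y ∉ Str x τ f k := by
    intro y h1 h2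
    exact hjk (h1.2.2.symm.trans h2.2.2)
  refine hC.tt4_D (p := b j) (q := b k) (N := Str x τ f k) (hbU j) (hbU k) (hb j) (hb k)
    (hh.trans_le sj) hl e1 ?_ ?_ ?_ ?_ ?_ ?_ rk (hS.reach k) ?_ ?_
  · intro y hy
    obtain ⟨h1, h2, h3, h4⟩ := hCd y hy
    exact ⟨h1, h2, fun e => h3 (e ▸ rj)⟩
  · intro y hy
    exact ⟨hh.trans_le hy.1.1, hy.1.2.1, hy.2⟩
  · intro y hy
    exact ⟨hh.trans_le hy.1, hy.2.1, fun e => key _ rj (e ▸ hy)⟩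
  · intro y hy h'
    exact (hCd y hy).2.2.1 h'.1
  · intro y hy h'
    exact (hCd y hy).2.2.2 h'
  · intro y hy h'
    exact key y hy.1 h'
  · intro u hu v hv huv hui
    rcases hS.out hC hu hv huv hui with h1 | h1
    · exact Or.inl h1
    · right
      refine lt_of_le_of_ne (hmax u hu v hv huv hui.1 hui.2.1 h1) ?_
      rintro rfl
      exact hnot u hu hui huv
  · intro u hu v hv huv hvi
    exact hS.inn hC hu hv huv hvi

/-- Extending the state. -/
theorem St.extend (hS : D.St U x b τ f) (hC : D.Ctx U x) (hb : ∀ i, D.Bk x (b i))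
    {j : Fin 3} {h : V} (hh : h < τ)
    (hmax : ∀ u ∈ U, ∀ v ∈ U, D.Bk u v → τ ≤ u → ¬ x ≤ u → v < τ → v ≤ h)
    (hmaxb : ∀ i, b i < τ → b i ≤ h)
    (hroot : ∀ i, b i = h → i = j)
    (hj : b j = h ∨ ∃ u ∈ Str x τ f j, D.Bk u h)
    (honly : ∀ i, i ≠ j → ∀ w ∈ U, w ∈ Str x τ f i → ¬ D.Bk w h) :
    ∃ f', D.St U x b h f' := by
  classical
  have hjb : h ≤ b j := by
    rcases hj with e | ⟨u, hu, _⟩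
    · exact e.ge
    · exact hh.le.trans (hS.started hu)
  obtain ⟨f', hf1, hf2⟩ : ∃ f' : V → Fin 3, (∀ w, τ ≤ w → f' w = f w) ∧
      (∀ w, ¬ τ ≤ w → f' w = j) :=
    ⟨fun w => if τ ≤ w then f w else j, fun w hw => if_pos hw, fun w hw => if_neg hw⟩
  have hsub : ∀ i, Str x τ f i ⊆ Str x h f' i := by
    intro i w hw
    exact ⟨hh.le.trans hw.1, hw.2.1, by rw [hf1 w hw.1, hw.2.2]⟩
  have hst : ∀ i, h ≤ b i → f' (b i) = i := by
    intro i hi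
    by_cases h1 : τ ≤ b i
    · rw [hf1 _ h1, hS.st i h1]
    · rw [hf2 _ h1]
      rcases hC.chain τ (b i) x hS.le (hb i).2.le with h2 | h2
      · exact absurd h2 h1
      · have h3 := hmaxb i (lt_of_le_of_ne h2 (fun e => h1 e.ge))
        exact (hroot i (le_antisymm h3 hi)).symm
  have hhx : ¬ x ≤ h := not_le_of_gt (hh.trans_le hS.le)
  have hhS : h ∈ Str x h f' j := ⟨le_rfl, hhx, hf2 h (not_le_of_gt hh)⟩
  refine ⟨f', hh.le.trans hS.le, ?_, hst, ?_, ?_⟩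
  · intro i hi w hw
    by_cases h1 : τ ≤ w
    · exact hS.un i (fun h2 => hi (hh.le.trans h2)) w ⟨h1, hw.2.1, by rw [← hf1 w h1, hw.2.2]⟩
    · have h2 : i = j := by rw [← hw.2.2, hf2 w h1]
      exact hi (h2 ▸ hjb)
  · intro i w hw
    by_cases h1 : τ ≤ w
    · rcases hS.reach i w ⟨h1, hw.2.1, by rw [← hf1 w h1, hw.2.2]⟩ with h2 | h2
      · exact Or.inl h2
      · exact Or.inr (h2.mono (hsub i))
    · have h2 : i = j := by rw [← hw.2.2, hf2 w h1]
      subst h2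
      have r1 : h = b i ∨ Link D (Str x h f' i) (b i) h := by
        rcases hj with e | ⟨u, hu, huh⟩
        · exact Or.inl e.symm
        · exact Or.inr ((hS.hit hu huh).mono (hsub i))
      rcases (hw.1 : h ≤ w).eq_or_lt with h3 | h3
      · exact h3 ▸ r1
      · have r2 : Link D (Str x h f' i) h w := (hC.path h w h3).mono (by
          intro z hz
          exact ⟨hz.1.le, fun h4 => hw.2.1 (h4.trans hz.2.le),
            hf2 z (fun h4 => h1 (h4.trans hz.2.le))⟩)
        right
        rcases r1 with e | r1
        · rw [← e]
          exact r2
        · exact r1.trans hhS r2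
  · intro u hu v hv huv hhv hxu
    by_cases h1 : τ ≤ v
    · rw [hf1 v h1, hf1 u (h1.trans huv.2.le)]
      exact hS.edge u hu v hv huv h1 hxu
    · rw [hf2 v h1]
      by_cases h2 : τ ≤ u
      · rw [hf1 u h2]
        by_contra hne
        rcases hC.chain τ v u h2 huv.2.le with h3 | h3
        · exact h1 h3
        · have h4 := hmax u hu v hv huv h2 hxu (lt_of_le_of_ne h3 (fun e => h1 e.ge))
          have h5 : v = h := le_antisymm h4 hhv
          subst h5
          exact honly (f u) hne u hu ⟨h2, hxu, rfl⟩ huv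
      · exact hf2 u h2

/-- Fact 1: stream `j` hits the unstarted root `b i = h` and the third root is above. -/
theorem St.tt4_fact (hS : D.St U x b τ f) (hC : D.Ctx U x) (hbU : ∀ i, b i ∈ U)
    (hb : ∀ i, D.Bk x (b i)) {i j k : Fin 3} {u h : V} (hh : h < τ) (hi : b i = h)
    (hk : b k < h)
    (hmax : ∀ u ∈ U, ∀ v ∈ U, D.Bk u v → τ ≤ u → ¬ x ≤ u → v < τ → v ≤ h)
    (hu : u ∈ Str x τ f j) (huh : D.Bk u h) :
    D.ContainsSubdivision TT4 := by
  have sj := hS.started hu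
  have rj := hS.root hb sj
  have key2 : ∀ y, y ∈ Str x τ f j → y ≠ x ∧ h < y := by
    intro y hy
    exact ⟨fun e => hy.2.1 e.ge, hh.trans_le hy.1⟩
  have hxh : D.Bk x h := hi ▸ hb i
  have hhx := hxh.2
  by_cases hex : ∃ w ∈ U, w ∈ Str x τ f j ∧ ∃ a, D.Bk w a ∧ a < h
  · obtain ⟨w, _, hw, a, hwa, hah⟩ := hex
    obtain ⟨m, ham, hbm, hmb⟩ : ∃ m, a ≤ m ∧ b k ≤ m ∧ m < h := by
      rcases hC.chain a (b k) h hah.le hk.le with h | h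
      · exact ⟨b k, h, le_rfl, hk⟩
      · exact ⟨a, le_rfl, h, hah⟩
    have e1 := (hS.hit hu huh).avoid
    have e2 : Link D {y | y ≠ x ∧ y ≠ h} (b j) m := by
      have e3 : Link D {y | y ≠ x ∧ y ≠ h} w m := (hC.suf hwa.1 ham).mono (by
        intro y hy
        exact ⟨((hy.2.trans hmb).trans hhx).ne, (hy.2.trans hmb).ne⟩)
      rcases hS.reach j w hw with e | e
      · rw [← e]
        exact e3
      · refine (e.mono ?_).trans ?_ e3
        · intro y hy
          exact ⟨(key2 y hy).1, (key2 y hy).2.ne'⟩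
        · exact ⟨(key2 w hw).1, (key2 w hw).2.ne'⟩
    have hmj : m < b j := hmb.trans (key2 _ rj).2
    have hjx := (hb j).2
    refine tt4_conn (s := x) (t := h) (v1 := b j) (v2 := m) ∅ _ {v | b k ≤ v ∧ v < m}
      (Set.Ioo m h) ∅ (Link.one (hb j).1) e1 (hC.suf (hb k).1 hbm) (hC.path m h hmb)
      (Link.one hxh.1) hhx.ne' ?_ ?_ hmj.ne' ?_ e2
    · intro y hy
      have i1 := key2 y
      have i2 := key2 _ rj
      simp only [Set.mem_empty_iff_false, Set.mem_sdiff, Set.mem_singleton_iff, Set.mem_ofPred_eq,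
        Set.mem_Ioo]
      refine ⟨?_, ?_, ?_, ?_, ?_, ?_, ?_⟩
      all_goals grind (splits := 20)
    · intro y hy
      have i1 := key2 y
      simp only [Set.mem_empty_iff_false, Set.mem_sdiff, Set.mem_singleton_iff, Set.mem_ofPred_eq,
        Set.mem_Ioo]
      refine ⟨?_, ?_, ?_, ?_, ?_⟩
      all_goals grind (splits := 20)
    · intro y
      have i1 := key2 y
      simp only [Set.mem_empty_iff_false, Set.mem_sdiff, Set.mem_singleton_iff, Set.mem_ofPred_eq,
        Set.mem_Ioo]
      refine ⟨?_, ?_, ?_, ?_⟩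
      all_goals grind (splits := 20)
  · exfalso
    push Not at hex
    refine hC.sep h (hi ▸ hbU i) (Or.inr hxh) {w | w ∈ U ∧ w ∈ Str x τ f j} (fun w hw => hw.1)
      (fun h => (key2 _ h.2).1 rfl) (fun h => lt_irrefl _ (key2 _ h.2).2) ⟨b j, hbU j, rj⟩
      ⟨b k, hbU k, fun h => lt_asymm hk (key2 _ h.2).2, (hb k).2.ne, hk.ne⟩ ?_ ?_
    · rintro u hu v hv huv ⟨_, huN⟩ hvZ
      rcases hS.out hC hu hv huv huN with h1 | h1
      · exact absurd ⟨hv, h1⟩ hvZ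
      · right
        have h2 := hmax u hu v hv huv huN.1 huN.2.1 h1
        by_contra hne
        exact hex u hu huN v huv (lt_of_le_of_ne h2 hne)
    · rintro u hu v hv huv huZ ⟨_, hvN⟩
      rcases hS.inn hC hu hv huv hvN with h1 | h1
      · exact absurd ⟨hu, h1⟩ huZ
      · exact Or.inl h1

end climb2
end Digraph'

namespace Digraph'

theorem third : ∀ i j : Fin 3, i ≠ j → ∃ k, k ≠ i ∧ k ≠ j ∧ ∀ l, l = i ∨ l = j ∨ l = k := by
  decide

section climb3
variable {V : Type} [PartialOrder V] {D : Digraph' V} {U : Set V} {x : V} {b : Fin 3 → V}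

theorem Ctx.contains_TT4 [Finite V] (hC : D.Ctx U x) (hbi : Function.Injective b)
    (hbU : ∀ i, b i ∈ U) (hb : ∀ i, D.Bk x (b i)) : D.ContainsSubdivision TT4 := by
  classical
  have h0 : D.St U x b x (fun _ => 0) := by
    refine ⟨le_rfl, ?_, ?_, ?_, ?_⟩
    · exact fun i _ w hw => hw.2.1 hw.1
    · exact fun i hi => absurd (hb i).2 (not_lt_of_ge hi)
    · exact fun i w hw => absurd hw.1 hw.2.1
    · exact fun _ _ _ _ _ _ _ => rfl
  obtain ⟨τ, ⟨f, hS⟩, hτ⟩ := (wellFounded_lt (α := V)).has_min {τ | ∃ f, D.St U x b τ f} ⟨x, _, h0⟩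
  have hτ' : ∀ h, h < τ → (∃ f', D.St U x b h f') → False := fun h h1 h2 => hτ h h2 h1
  by_cases hH : {h | h ∈ U ∧ h < τ ∧ ((∃ u ∈ U, τ ≤ u ∧ ¬ x ≤ u ∧ D.Bk u h) ∨
    ∃ i, b i = h)}.Nonempty
  swap
  · exfalso
    rw [Set.not_nonempty_iff_eq_empty, Set.eq_empty_iff_forall_notMem] at hH
    have hst : ∀ i, τ ≤ b i := by
      intro i
      rcases hC.chain τ (b i) x hS.le (hb i).2.le with h | h
      · exact h
      · by_contra hc
        exact hH (b i) ⟨hbU i, lt_of_le_of_ne h (fun e => hc e.ge), Or.inr ⟨i, rfl⟩⟩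
    have hx0 : x ∉ {w | w ∈ U ∧ w ∈ Str x τ f 0} := fun h => h.2.2.1 le_rfl
    refine hC.sep x hC.xU (Or.inl rfl) {w | w ∈ U ∧ w ∈ Str x τ f 0} (fun w hw => hw.1)
      hx0 hx0 ⟨b 0, hbU 0, hS.root hb (hst 0)⟩ ⟨b 1, hbU 1, ?_, (hb 1).2.ne, (hb 1).2.ne⟩ ?_ ?_
    · intro h
      have h1 := h.2.2.2
      rw [hS.st 1 (hst 1)] at h1
      exact absurd h1 (by decide)
    · rintro u hu v hv huv ⟨_, huN⟩ hvZ
      rcases hS.out hC hu hv huv huN with h1 | h1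
      · exact absurd ⟨hv, h1⟩ hvZ
      · exact absurd ⟨hv, h1, Or.inl ⟨u, hu, huN.1, huN.2.1, huv⟩⟩ (hH v)
    · rintro u hu v hv huv huZ ⟨_, hvN⟩
      rcases hS.inn hC hu hv huv hvN with h1 | h1
      · exact absurd ⟨hu, h1⟩ huZ
      · exact Or.inl h1
  obtain ⟨h, ⟨hhU, hh, hhc⟩, hhm⟩ := (Set.toFinite _).exists_maximal hH
  have hmax0 : ∀ v, v ∈ U → v < τ → ((∃ u ∈ U, τ ≤ u ∧ ¬ x ≤ u ∧ D.Bk u v) ∨ ∃ i, b i = v) →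
      v ≤ h := by
    intro v h1 h2 h3
    rcases hC.chain v h τ h2.le hh.le with h4 | h4
    · exact h4
    · exact hhm ⟨h1, h2, h3⟩ h4
  have hmax : ∀ u ∈ U, ∀ v ∈ U, D.Bk u v → τ ≤ u → ¬ x ≤ u → v < τ → v ≤ h :=
    fun u hu v hv huv h1 h2 h3 => hmax0 v hv h3 (Or.inl ⟨u, hu, h1, h2, huv⟩)
  have hmaxb : ∀ i, b i < τ → b i ≤ h := fun i hi => hmax0 _ (hbU i) hi (Or.inr ⟨i, rfl⟩)
  have hcmp : ∀ i, τ ≤ b i ∨ b i ≤ h := by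
    intro i
    rcases hC.chain τ (b i) x hS.le (hb i).2.le with h1 | h1
    · exact Or.inl h1
    · by_cases h2 : τ ≤ b i
      · exact Or.inl h2
      · exact Or.inr (hmaxb i (lt_of_le_of_ne h1 (fun e => h2 e.ge)))
  have hhx : h < x := hh.trans_le hS.le
  have hstr : ∀ i y, y ∈ Str x τ f i → h < y ∧ ¬ x ≤ y := fun i y hy =>
    ⟨hh.trans_le hy.1, hy.2.1⟩
  have hdisj : ∀ i j, i ≠ j → ∀ y, y ∈ Str x τ f i → y ∉ Str x τ f j :=
    fun i j hij y h1 h2 => hij (h1.2.2.symm.trans h2.2.2)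
  by_cases hroot : ∃ i, b i = h
  · obtain ⟨i, hi⟩ := hroot
    have hli : Link D ∅ x h := Link.one (hi ▸ (hb i).1)
    by_cases hT : ∃ j, ∃ u ∈ U, u ∈ Str x τ f j ∧ D.Bk u h
    · obtain ⟨j, u, hu, huj, huh⟩ := hT
      have hij : i ≠ j := by
        rintro rfl
        have := hS.started huj
        rw [hi] at this
        exact not_le_of_gt hh this
      obtain ⟨k, hki, hkj, -⟩ := third i j hij
      rcases hcmp k with hk | hk
      · by_cases hkT : ∃ u ∈ U, u ∈ Str x τ f k ∧ D.Bk u h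
        · obtain ⟨u', hu', huk', huh'⟩ := hkT
          exact hS.tt4_two hC hb hkj.symm hh huj huh huk' huh' hli (by simp)
        · push Not at hkT
          exact hS.tt4_D hC hbU hb hkj.symm hh hmax huj huh hk hkT hli (by simp)
      · have hk' : b k < h := lt_of_le_of_ne hk (fun e => hki (hbi (e.trans hi.symm)))
        exact hS.tt4_fact hC hbU hb hh hi hk' hmax huj huh
    · exfalso
      push Not at hT
      refine hτ' h hh (hS.extend hC hb (j := i) hh hmax hmaxb
        (fun l hl => hbi (hl.trans hi.symm)) (Or.inl hi) (fun l _ => hT l))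
  · rcases hhc with ⟨u, hu, hτu, hxu, huh⟩ | hc
    swap
    · exact absurd hc hroot
    push Not at hroot
    obtain ⟨j, huj⟩ : ∃ j, u ∈ Str x τ f j := ⟨f u, hτu, hxu, rfl⟩
    by_cases hT : ∃ k, k ≠ j ∧ ∃ w ∈ U, w ∈ Str x τ f k ∧ D.Bk w h
    · obtain ⟨k, hkj, w, hw, hwk, hwh⟩ := hT
      obtain ⟨i, hij, hik, -⟩ := third j k hkj.symm
      rcases hcmp i with hi | hi
      · by_cases hiT : ∃ u ∈ U, u ∈ Str x τ f i ∧ D.Bk u h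
        · obtain ⟨u', hu', hui', huh'⟩ := hiT
          refine hS.tt4_two hC hb hkj.symm hh huj huh hwk hwh
            (Link.cons (hb i).1 (hS.root hb hi) (hS.hit hui' huh')) ?_
          intro y hy
          exact ⟨fun e => (hstr i y hy).2 e.ge, (hstr i y hy).1.ne', hdisj i j hij y hy,
            hdisj i k hik y hy⟩
        · push Not at hiT
          refine hS.tt4_D hC hbU hb hik.symm hh hmax hwk hwh hi hiT
            (Link.cons (hb j).1 (hS.root hb (hS.started huj)) (hS.hit huj huh)) ?_
          intro y hy
          exact ⟨(hstr j y hy).1, (hstr j y hy).2, hdisj j k hkj.symm y hy,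
            hdisj j i hij.symm y hy⟩
      · refine hS.tt4_two hC hb hkj.symm hh huj huh hwk hwh (hC.suf (hb i).1 hi) ?_
        intro y hy
        exact ⟨(hy.2.trans hhx).ne, hy.2.ne, fun h' => lt_asymm hy.2 (hstr _ y h').1,
          fun h' => lt_asymm hy.2 (hstr _ y h').1⟩
    · exfalso
      push Not at hT
      exact hτ' h hh (hS.extend hC hb (j := j) hh hmax hmaxb
        (fun l hl => absurd hl (hroot l)) (Or.inr ⟨u, huj, huh⟩) hT)

end climb3

theorem contains_three {n : ℕ} (D : Digraph' (Fin n)) (hD : D.Loopless)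
    (h : 4 ≤ D.dichromaticNumber) : D.ContainsSubdivision TT4 ∧ D.ContainsSubdivision S4 ∧
      D.ContainsSubdivision Wp := by
  obtain ⟨P, f, chain, path, hf⟩ := exists_dfs_order D
  have hnc : ¬ @Col (Fin n) P D Set.univ := by
    intro hc
    have := @dichromatic_le_of_col (Fin n) P D hD f hf hc
    omega
  obtain ⟨U, x, b, hC, hbi, hbU, hb⟩ := @exists_ctx (Fin n) P _ D chain path hnc
  obtain ⟨i, j, k, hij, hjk⟩ := @exists_sorted (Fin n) P D U x hC b hbi hb
  exact ⟨@Ctx.contains_TT4 (Fin n) P D U x b _ hC hbi hbU hb,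
    @Ctx.contains_S4 (Fin n) P D U x _ hC _ _ _ (hbU i) (hbU j) (hbU k) (hb i) (hb j) (hb k) hij hjk,
    @Ctx.contains_Wp (Fin n) P D U x hC _ _ _ (hbU i) (hbU j) (hbU k) (hb i) (hb j) (hb k) hij hjk⟩

theorem dichromatic_rev {V : Type} (D : Digraph' V) :
    D.rev.dichromaticNumber = D.dichromaticNumber := by
  unfold dichromaticNumber
  congr 1
  ext k
  constructor
  · rintro ⟨c, hc⟩
    exact ⟨c, fun i => acyclicOn_rev (hc i)⟩
  · rintro ⟨c, hc⟩
    exact ⟨c, fun i => acyclicOn_rev (D := D.rev) (hc i)⟩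

theorem contains_Wm {n : ℕ} (D : Digraph' (Fin n)) (hD : D.Loopless)
    (h : 4 ≤ D.dichromaticNumber) : D.ContainsSubdivision Wp.rev := by
  apply ContainsSubdivision.of_rev
  exact (contains_three D.rev hD (by rwa [dichromatic_rev])).2.2

/-- The complete digraph on three vertices. -/
def K3 : Digraph' (Fin 3) := ⟨fun a b => a ≠ b⟩

theorem K3_dichromatic : 3 ≤ K3.dichromaticNumber := by
  refine le_csInf ⟨3, id, ?_⟩ ?_
  · intro i v hv
    have : ∀ w, Relation.TransGen (fun x y => x ∈ {v : Fin 3 | id v = i} ∧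
        y ∈ {v : Fin 3 | id v = i} ∧ K3.Adj x y) v w → False := by
      intro w hw
      induction hw with
      | single h => exact h.2.2 (h.1.trans h.2.1.symm)
      | tail _ h _ => exact h.2.2 (h.1.trans h.2.1.symm)
    exact this v hv
  · rintro k ⟨c, hc⟩
    have hinj : Function.Injective c := by
      intro a b hab
      by_contra hne
      refine hc (c a) a ?_
      exact Relation.TransGen.tail (Relation.TransGen.single ⟨rfl, hab.symm, hne⟩)
        ⟨hab.symm, rfl, fun e => hne e.symm⟩
    simpa using Fintype.card_le_of_injective c hinj

/-- bit masks of the four tournaments on four vertices -/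
def mask (m a b : ℕ) : Bool :=
  Nat.testBit (match m with | 0 => 2254 | 1 => 14658 | 2 => 10318 | _ => 21392) (4 * a + b)

/-- check that `(p, q, r, s)` maps the tournament with the given bits to tournament `m` -/
def chk (m p q r s : ℕ) (t0 t1 t2 t3 t4 t5 : Bool) : Bool :=
  (bif t0 then mask m p q else mask m q p) && (bif t1 then mask m p r else mask m r p) &&
  (bif t2 then mask m p s else mask m s p) && (bif t3 then mask m q r else mask m r q) &&
  (bif t4 then mask m q s else mask m s q) && (bif t5 then mask m r s else mask m s r)

theorem classify : ∀ t0 t1 t2 t3 t4 t5 : Bool, ∃ m p q r s : Fin 4,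
    chk m p q r s t0 t1 t2 t3 t4 t5 = true := by
  decide

/-- the four tournaments on four vertices -/
def stdT (m : Fin 4) : Digraph' (Fin 4) := ⟨fun a b => mask m a b = true⟩

theorem mask_loop : ∀ m a : Fin 4, mask m a a = false := by decide

theorem stdT_hom {n : ℕ} {D : Digraph' (Fin n)} (h1 : D.ContainsSubdivision TT4)
    (h2 : D.ContainsSubdivision S4) (h3 : D.ContainsSubdivision Wp)
    (h4 : D.ContainsSubdivision Wp.rev) (m : Fin 4) : D.ContainsSubdivision (stdT m) := by
  fin_cases m
  · refine h1.of_hom id Function.injective_id ?_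
    unfold stdT TT4 six
    decide
  · refine h2.of_hom id Function.injective_id ?_
    unfold stdT S4 six
    decide
  · refine h3.of_hom id Function.injective_id ?_
    unfold stdT Wp six
    decide
  · refine h4.of_hom id Function.injective_id ?_
    unfold stdT Wp rev six
    decide

theorem exists_stdT (K : Digraph' (Fin 4)) (hK : IsOrientationOf K (⊤ : SimpleGraph (Fin 4))) :
    ∃ (m : Fin 4) (e : Fin 4 → Fin 4), Function.Injective e ∧
      ∀ a b, K.Adj a b → (stdT m).Adj (e a) (e b) := by
  classical
  obtain ⟨hl, ho⟩ := hK
  obtain ⟨m, p, q, r, s, h⟩ := classify (decide (K.Adj 0 1)) (decide (K.Adj 0 2))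
    (decide (K.Adj 0 3)) (decide (K.Adj 1 2)) (decide (K.Adj 1 3)) (decide (K.Adj 2 3))
  have hasym : ∀ a b, K.Adj a b → ¬ K.Adj b a := fun a b h1 h2 => (ho a b (hl a b h1)).2 ⟨h1, h2⟩
  have hirr : ∀ a, ¬ K.Adj a a := fun a h1 => hasym a a h1 h1
  have htot : ∀ a b, a ≠ b → K.Adj a b ∨ K.Adj b a := fun a b h1 => (ho a b h1).1
  simp only [chk, Bool.and_eq_true] at h
  obtain ⟨⟨⟨⟨⟨g0, g1⟩, g2⟩, g3⟩, g4⟩, g5⟩ := h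
  have step : ∀ (a b : Fin 4) (c d : Fin 4),
      (bif decide (K.Adj a b) then mask m c d else mask m d c) = true →
      (K.Adj a b → mask m c d = true) ∧ (K.Adj b a → mask m d c = true) := by
    intro a b c d h
    refine ⟨fun h1 => by simpa [h1] using h, fun h1 => by simpa [hasym b a h1] using h⟩
  have hom : ∀ a b, K.Adj a b → (stdT m).Adj (![p, q, r, s] a) (![p, q, r, s] b) := by
    intro a b hab
    fin_cases a <;> fin_cases b <;> first
      | exact absurd hab (hirr _)
      | exact (step _ _ _ _ g0).1 hab
      | exact (step _ _ _ _ g0).2 hab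
      | exact (step _ _ _ _ g1).1 hab
      | exact (step _ _ _ _ g1).2 hab
      | exact (step _ _ _ _ g2).1 hab
      | exact (step _ _ _ _ g2).2 hab
      | exact (step _ _ _ _ g3).1 hab
      | exact (step _ _ _ _ g3).2 hab
      | exact (step _ _ _ _ g4).1 hab
      | exact (step _ _ _ _ g4).2 hab
      | exact (step _ _ _ _ g5).1 hab
      | exact (step _ _ _ _ g5).2 hab
  refine ⟨m, ![p, q, r, s], ?_, hom⟩
  intro a b hab
  by_contra hne
  have hm : ∀ c : Fin 4, ¬ (stdT m).Adj c c := fun c hc => by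
    have h1 : mask m c c = true := hc
    rw [mask_loop] at h1
    exact absurd h1 (by decide)
  rcases htot a b hne with h | h
  · have := hom a b h
    rw [hab] at this
    exact hm _ this
  · have := hom b a h
    rw [hab] at this
    exact hm _ this

end Digraph'

/-- For every tournament `K` on `4` vertices (orientation of
the complete graph `K₄`), `mader(K) = 4`. -/
theorem tournament4_mader (K : Digraph' (Fin 4))
    (hK : IsOrientationOf K (⊤ : SimpleGraph (Fin 4))) :
    Digraph'.mader K = 4 := by
  have h4 : Digraph'.MaderBound K 4 := by
    intro n D hD h
    obtain ⟨m, e, he, hom⟩ := Digraph'.exists_stdT K hK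
    obtain ⟨c1, c2, c3⟩ := Digraph'.contains_three D hD h
    exact (Digraph'.stdT_hom c1 c2 c3 (Digraph'.contains_Wm D hD h) m).of_hom e he hom
  refine le_antisymm (Nat.sInf_le ⟨by norm_num, h4⟩) ?_
  refine le_csInf ⟨4, by norm_num, h4⟩ ?_
  rintro k ⟨_, hk⟩
  by_contra hlt
  have hk3 : k ≤ 3 := by omega
  obtain ⟨β, _, hβ, _⟩ := hk 3 Digraph'.K3 (fun v h => h rfl)
    (hk3.trans Digraph'.K3_dichromatic)
  have := Fintype.card_le_of_injective β hβ
  simp at this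
end

section
/- Every digraph D with dichromatic number χ⃗(D) ≥ 4 contains a subdivision of the transitive tournament K⃗₄ of order 4; consequently mader_χ⃗(K⃗₄) = 4. -/
/-- The transitive tournament on `4` vertices. -/
def K4trans : Digraph' (Fin 4) := ⟨fun i j => i < j⟩


namespace K4

open Classical

/-- `Ch R u l v`: the list `u :: l ++ [v]` is a directed walk. -/
def Ch {V : Type} (R : V → V → Prop) : V → List V → V → Prop
  | u, [], v => R u v
  | u, x :: l, v => R u x ∧ Ch R x l v

section basics
variable {V : Type} {R R' : V → V → Prop}

@[simp] theorem ch_nil {u v : V} : Ch R u [] v ↔ R u v := Iff.rfl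
@[simp] theorem ch_cons {u v x : V} {l : List V} : Ch R u (x :: l) v ↔ R u x ∧ Ch R x l v := Iff.rfl

theorem ch_append {u v x : V} {l l' : List V} :
    Ch R u (l ++ x :: l') v ↔ Ch R u l x ∧ Ch R x l' v := by
  induction l generalizing u with
  | nil => simp
  | cons a l ih => simp [ih, and_assoc]

theorem ch_mono (h : ∀ a b, R a b → R' a b) {u v : V} {l : List V} (hc : Ch R u l v) :
    Ch R' u l v := by
  induction l generalizing u with
  | nil => exact h _ _ hc
  | cons a l ih => exact ⟨h _ _ hc.1, ih hc.2⟩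

theorem ch_swap {u v : V} {l : List V} (hc : Ch R u l v) :
    Ch (fun a b => R b a) v l.reverse u := by
  induction l generalizing u with
  | nil => exact hc
  | cons a l ih =>
    rw [List.reverse_cons]
    exact ch_append.2 ⟨ih hc.2, hc.1⟩

theorem ch_isChain {u v : V} {l : List V} (hc : Ch R u l v) :
    (u :: l ++ [v]).IsChain R := by
  induction l generalizing u with
  | nil => simpa using hc
  | cons a l ih =>
    have := ih hc.2
    simp only [List.cons_append] at this ⊢
    exact List.IsChain.cons_cons hc.1 this

theorem ch_map {W : Type} {S : W → W → Prop} (f : V → W) (h : ∀ a b, R a b → S (f a) (f b))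
    {u v : V} {l : List V} (hc : Ch R u l v) : Ch S (f u) (l.map f) (f v) := by
  induction l generalizing u with
  | nil => exact h _ _ hc
  | cons a l ih => exact ⟨h _ _ hc.1, ih hc.2⟩

/-- Any walk can be shortened to a path. -/
theorem ch_nodup {u v : V} {l : List V} (hc : Ch R u l v) :
    ∃ l', Ch R u l' v ∧ l'.Nodup ∧ u ∉ l' ∧ v ∉ l' ∧ ∀ x ∈ l', x ∈ l := by
  induction l generalizing u with
  | nil => exact ⟨[], hc, by simp⟩
  | cons x l ih =>
    obtain ⟨l', h1, h2, h3, h4, h5⟩ := ih hc.2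
    by_cases hxv : x = v
    · subst hxv
      exact ⟨[], hc.1, by simp⟩
    by_cases hu : u ∈ x :: l'
    · obtain ⟨a, b, hab⟩ := List.append_of_mem hu
      have hch : Ch R u (x :: l') v := ⟨hc.1, h1⟩
      rw [hab] at hch
      have hn : (x :: l').Nodup := List.nodup_cons.2 ⟨h3, h2⟩
      have hsub : ∀ z ∈ b, z ∈ x :: l' := by
        intro z hz; rw [hab]; simp [hz]
      rw [hab] at hn
      refine ⟨b, (ch_append.1 hch).2, ?_, ?_, ?_, ?_⟩
      · grind
      · grind
      · intro hv; have := hsub v hv; grind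
      · intro z hz; have := hsub z hz; grind
    · refine ⟨x :: l', ⟨hc.1, h1⟩, ?_, hu, ?_, ?_⟩ <;> grind

/-- Walk from `u` to `v` with all internal vertices in `S`. -/
def Via (R : V → V → Prop) (S : V → Prop) (u v : V) : Prop :=
  ∃ l, Ch R u l v ∧ ∀ x ∈ l, S x

theorem via_single {S : V → Prop} {u v : V} (h : R u v) : Via R S u v := ⟨[], h, by simp⟩

theorem via_tail {S : V → Prop} {u v w : V} (h : Via R S u v) (hv : S v) (h' : R v w) :
    Via R S u w := by
  obtain ⟨l, h1, h2⟩ := h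
  exact ⟨l ++ [v], ch_append.2 ⟨h1, h'⟩, by grind⟩

theorem via_path {S : V → Prop} {u v : V} (h : Via R S u v) :
    ∃ l, Ch R u l v ∧ l.Nodup ∧ u ∉ l ∧ v ∉ l ∧ ∀ x ∈ l, S x := by
  obtain ⟨l, h1, h2⟩ := h
  obtain ⟨l', a, b, c, d, e⟩ := ch_nodup h1
  exact ⟨l', a, b, c, d, fun x hx => h2 x (e x hx)⟩

/-- reachability through vertices satisfying `S` (all vertices after the first one). -/
def Rch (R : V → V → Prop) (S : V → Prop) (u v : V) : Prop :=
  Relation.ReflTransGen (fun a b => R a b ∧ S b) u v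

/-- last exit from a set `F` -/
theorem last_exit {S F : V → Prop} {u v : V} (h : Rch R S u v) (hu : F u) :
    F v ∨ ∃ y, F y ∧ Via R (fun z => S z ∧ ¬ F z) y v := by
  induction h with
  | refl => exact Or.inl hu
  | tail h1 h2 ih =>
    rename_i b c
    by_cases hc : F c
    · exact Or.inl hc
    right
    by_cases hb : F b
    · exact ⟨b, hb, via_single h2.1⟩
    rcases ih with ih | ⟨y, hy, hv⟩
    · exact absurd ih hb
    refine ⟨y, hy, via_tail hv ⟨?_, hb⟩ h2.1⟩
    rcases Relation.ReflTransGen.cases_tail h1 with h | ⟨_, _, h⟩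
    · subst h; exact absurd hu hb
    · exact h.2

theorem rch_of_ch {S : V → Prop} {u v x : V} {l : List V} (h : Ch R u l v)
    (hS : ∀ z ∈ l, S z) (hx : x ∈ l) : Rch R S u x := by
  induction l generalizing u with
  | nil => simp at hx
  | cons a l ih =>
    have h0 : Rch R S u a := Relation.ReflTransGen.single ⟨h.1, hS a (by simp)⟩
    rcases List.mem_cons.1 hx with rfl | hx
    · exact h0
    · exact h0.trans (ih h.2 (fun z hz => hS z (by simp [hz])) hx)

/-- A subdivision of the transitive tournament with source `s` and sink `t`. -/
def TT (R : V → V → Prop) (s t : V) : Prop :=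
  ∃ v2 v3, ∃ l12 l13 l14 l23 l24 l34 : List V,
    Ch R s l12 v2 ∧ Ch R s l13 v3 ∧ Ch R s l14 t ∧ Ch R v2 l23 v3 ∧ Ch R v2 l24 t ∧
    Ch R v3 l34 t ∧ (s :: v2 :: v3 :: t :: (l12 ++ l13 ++ l14 ++ l23 ++ l24 ++ l34)).Nodup

theorem TT.mono (h : ∀ a b, R a b → R' a b) {s t : V} (ht : TT R s t) : TT R' s t := by
  obtain ⟨v2, v3, l12, l13, l14, l23, l24, l34, h1, h2, h3, h4, h5, h6, h7⟩ := ht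
  exact ⟨v2, v3, l12, l13, l14, l23, l24, l34, ch_mono h h1, ch_mono h h2, ch_mono h h3,
    ch_mono h h4, ch_mono h h5, ch_mono h h6, h7⟩

theorem TT.map {W : Type} {S : W → W → Prop} (f : V → W) (hf : Function.Injective f)
    (h : ∀ a b, R a b → S (f a) (f b)) {s t : V} (ht : TT R s t) : TT S (f s) (f t) := by
  obtain ⟨v2, v3, l12, l13, l14, l23, l24, l34, h1, h2, h3, h4, h5, h6, h7⟩ := ht
  refine ⟨f v2, f v3, _, _, _, _, _, _, ch_map f h h1, ch_map f h h2, ch_map f h h3,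
    ch_map f h h4, ch_map f h h5, ch_map f h h6, ?_⟩
  have := h7.map hf
  simpa using this

theorem TT.swap {s t : V} (ht : TT R s t) : TT (fun a b => R b a) t s := by
  obtain ⟨v2, v3, l12, l13, l14, l23, l24, l34, h1, h2, h3, h4, h5, h6, h7⟩ := ht
  refine ⟨v3, v2, _, _, _, _, _, _, ch_swap h6, ch_swap h5, ch_swap h3,
    ch_swap h4, ch_swap h2, ch_swap h1, ?_⟩
  refine (List.Perm.nodup_iff ?_).1 h7
  rw [List.perm_iff_count]
  intro a
  simp only [List.count_cons, List.count_append, List.count_reverse]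
  omega

/-- Three internally disjoint paths. -/
structure Theta (R : V → V → Prop) (u w : V) (l1 l2 l3 : List V) : Prop where
  c1 : Ch R u l1 w
  c2 : Ch R u l2 w
  c3 : Ch R u l3 w
  nd : (u :: w :: (l1 ++ l2 ++ l3)).Nodup

theorem Theta.s12 {u w : V} {l1 l2 l3 : List V} (h : Theta R u w l1 l2 l3) :
    Theta R u w l2 l1 l3 := by
  refine ⟨h.c2, h.c1, h.c3, (List.Perm.nodup_iff ?_).1 h.nd⟩
  rw [List.perm_iff_count]; intro a
  simp only [List.count_cons, List.count_append]; omega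

theorem Theta.s23 {u w : V} {l1 l2 l3 : List V} (h : Theta R u w l1 l2 l3) :
    Theta R u w l1 l3 l2 := by
  refine ⟨h.c1, h.c3, h.c2, (List.Perm.nodup_iff ?_).1 h.nd⟩
  rw [List.perm_iff_count]; intro a
  simp only [List.count_cons, List.count_append]; omega

theorem Theta.cross {u w x y : V} {l1 l2 l3 : List V} (h : Theta R u w l1 l2 l3)
    (hx : x ∈ l1) (hy : y ∈ l2)
    (hv : Via R (fun z => z ≠ u ∧ z ≠ w ∧ z ∉ l1 ∧ z ∉ l2 ∧ z ∉ l3) x y) : TT R u w := by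
  obtain ⟨a1, b1, rfl⟩ := List.append_of_mem hx
  obtain ⟨a2, b2, rfl⟩ := List.append_of_mem hy
  obtain ⟨q, q1, q2, q3, q4, q5⟩ := via_path hv
  obtain ⟨c1, c2, c3, nd⟩ := h
  refine ⟨x, y, a1, a2, l3, q, b1, b2, (ch_append.1 c1).1, (ch_append.1 c2).1, c3, q1,
    (ch_append.1 c1).2, (ch_append.1 c2).2, ?_⟩
  have h1 : (q ++ (u :: w :: (a1 ++ x :: b1 ++ (a2 ++ y :: b2) ++ l3))).Nodup := by
    rw [List.nodup_append]
    refine ⟨q2, nd, ?_⟩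
    intro a ha b hb
    have := q5 a ha
    grind
  refine (List.Perm.nodup_iff ?_).1 h1
  rw [List.perm_iff_count]; intro a
  simp only [List.count_cons, List.count_append]; omega

/-- If the first path reaches the second one, avoiding the ends, we get a subdivision. -/
theorem Theta.reach {u w x y : V} {l1 l2 l3 : List V} (h : Theta R u w l1 l2 l3)
    (hx : x ∈ l1) (hy : y ∈ l2)
    (hv : Rch R (fun z => z ≠ u ∧ z ≠ w) x y) : TT R u w := by
  have key : ∀ z, Rch R (fun z => z ≠ u ∧ z ≠ w) x z → TT R u w ∨ z ∈ l1 ∨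
      (z ∉ l1 ∧ z ∉ l2 ∧ z ∉ l3 ∧
       ∃ x' ∈ l1, Via R (fun z => z ≠ u ∧ z ≠ w ∧ z ∉ l1 ∧ z ∉ l2 ∧ z ∉ l3) x' z) := by
    intro z hz
    induction hz with
    | refl => exact Or.inr (Or.inl hx)
    | tail h1 h2 ih =>
      rename_i b c
      rcases ih with ih | ih
      · exact Or.inl ih
      have : ∃ x' ∈ l1, Via R (fun z => z ≠ u ∧ z ≠ w ∧ z ∉ l1 ∧ z ∉ l2 ∧ z ∉ l3) x' c := by
        rcases ih with ih | ⟨n1, n2, n3, x', hx', hv'⟩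
        · exact ⟨b, ih, via_single h2.1⟩
        · refine ⟨x', hx', via_tail hv' ⟨?_, ?_, n1, n2, n3⟩ h2.1⟩
          all_goals
            rcases Relation.ReflTransGen.cases_tail h1 with h0 | ⟨_, _, h0⟩
            · subst h0; exact absurd hx n1
            · first | exact h0.2.1 | exact h0.2.2
      obtain ⟨x', hx', hv'⟩ := this
      by_cases c1 : c ∈ l1
      · exact Or.inr (Or.inl c1)
      by_cases c2 : c ∈ l2
      · exact Or.inl (h.cross hx' c2 hv')
      by_cases c3 : c ∈ l3
      · refine Or.inl (h.s23.cross hx' c3 ?_)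
        obtain ⟨l, p1, p2⟩ := hv'
        exact ⟨l, p1, by grind⟩
      exact Or.inr (Or.inr ⟨c1, c2, c3, x', hx', hv'⟩)
  have nd := h.nd
  rcases key y hv with h' | h' | h'
  · exact h'
  · exfalso; grind
  · exact absurd hy h'.2.1

/-- merging two of the paths before the sink -/
theorem Theta.merge {u w x y m : V} {l1 l2 l3 : List V} (h : Theta R u w l1 l2 l3)
    (hx : x ∈ l1) (hy : y ∈ l2) (hm : R m w)
    (hv : Rch R (fun z => z ≠ u ∧ z ≠ w) x m)
    (hv' : Rch R (fun z => z ≠ u ∧ z ≠ w) y m) : TT R u w := by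
  by_cases hr2 : ∃ z ∈ l2, Rch R (fun z => z ≠ u ∧ z ≠ w) x z
  · obtain ⟨z, hz, hz'⟩ := hr2
    exact h.reach hx hz hz'
  by_cases hr3 : ∃ z ∈ l3, Rch R (fun z => z ≠ u ∧ z ≠ w) x z
  · obtain ⟨z, hz, hz'⟩ := hr3
    exact h.s23.reach hx hz hz'
  push Not at hr2 hr3
  have nd := h.nd
  -- new first path
  have hvia : Via R (fun z => z ≠ u ∧ z ≠ w ∧ z ∉ l2 ∧ z ∉ l3) u m ∧ m ≠ u ∧ m ≠ w := by
    have : ∀ z, Rch R (fun z => z ≠ u ∧ z ≠ w) x z →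
        Via R (fun z => z ≠ u ∧ z ≠ w ∧ z ∉ l2 ∧ z ∉ l3) u z ∧ z ≠ u ∧ z ≠ w := by
      intro z hz
      induction hz with
      | refl =>
        obtain ⟨a1, b1, rfl⟩ := List.append_of_mem hx
        refine ⟨⟨a1, (ch_append.1 h.c1).1, ?_⟩, ?_⟩ <;> grind
      | tail h1 h2 ih =>
        rename_i b c
        refine ⟨via_tail ih.1 ⟨ih.2.1, ih.2.2, ?_, ?_⟩ h2.1, h2.2⟩
        · intro hb; exact hr2 _ hb h1
        · intro hb; exact hr3 _ hb h1
    exact this m hv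
  obtain ⟨hvia, hmu, hmw⟩ := hvia
  obtain ⟨q, q1, q2, q3, q4, q5⟩ := via_path hvia
  have hth : Theta R u w l2 (q ++ [m]) l3 := by
    refine ⟨h.c2, ch_append.2 ⟨q1, hm⟩, h.c3, ?_⟩
    have hm2 : m ∉ l2 := fun hb => hr2 _ hb hv
    have hm3 : m ∉ l3 := fun hb => hr3 _ hb hv
    have h1 : ((q ++ [m]) ++ (u :: w :: (l2 ++ l3))).Nodup := by
      rw [List.nodup_append]
      refine ⟨by grind, by grind, ?_⟩
      intro a ha b hb
      rcases List.mem_append.1 ha with ha | ha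
      · have := q5 a ha; grind
      · grind
    refine (List.Perm.nodup_iff ?_).1 h1
    rw [List.perm_iff_count]; intro a
    simp only [List.count_cons, List.count_append]; omega
  exact hth.reach hy (by simp) hv'

end basics
end K4

namespace K4

open Classical

set_option linter.unusedSectionVars false

section menger
variable {V : Type} [Fintype V] {R : V → V → Prop}

/-- out-neighbourhood of a set -/
noncomputable def Nb (R : V → V → Prop) (A : Finset V) : Finset V :=
  Finset.univ.filter (fun v => v ∉ A ∧ ∃ a ∈ A, R a v)

theorem mem_Nb {A : Finset V} {v : V} : v ∈ Nb R A ↔ v ∉ A ∧ ∃ a ∈ A, R a v := by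
  simp [Nb]

/-- the matching relation -/
def MR (R : V → V → Prop) (u w : V) : Fin 3 ⊕ V → V ⊕ Fin 3 → Prop
  | Sum.inl _, Sum.inl v => R u v ∧ v ≠ u ∧ v ≠ w
  | Sum.inl i, Sum.inr j => i = 0 ∧ j = 0 ∧ R u w
  | Sum.inr v, Sum.inl v' => v' = v ∨ (v ≠ u ∧ v ≠ w ∧ R v v' ∧ v' ≠ u ∧ v' ≠ w)
  | Sum.inr v, Sum.inr _ => v ≠ u ∧ v ≠ w ∧ R v w

/-- local connectivity three -/
def H3 (R : V → V → Prop) (u w : V) : Prop :=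
  u ≠ w ∧ ∀ A : Finset V, u ∈ A → w ∉ A → (∀ a ∈ A, a ≠ u → ¬ R a w) → 3 ≤ (Nb R A).card

theorem hall_cond {u w : V} (h : H3 R u w) (s : Finset (Fin 3 ⊕ V)) :
    s.card ≤ (Finset.univ.filter (fun b => ∃ a ∈ s, MR R u w a b)).card := by
  obtain ⟨huw, h⟩ := h
  have hs : s.card = s.toLeft.card + s.toRight.card := (Finset.card_toLeft_add_card_toRight).symm
  have hJ3 : s.toLeft.card ≤ 3 := by
    simpa using Finset.card_le_univ s.toLeft
  have hF : ∀ v ∈ s.toRight, Sum.inl v ∈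
      (Finset.univ.filter (fun b => ∃ a ∈ s, MR R u w a b)) := by
    intro v hv
    simp only [Finset.mem_filter, Finset.mem_univ, true_and]
    exact ⟨Sum.inr v, Finset.mem_toRight.1 hv, Or.inl rfl⟩
  -- generic lower bound
  have lb : ∀ (T : Finset V) (U : Finset (Fin 3)),
      (∀ v ∈ T, Sum.inl v ∈ (Finset.univ.filter (fun b => ∃ a ∈ s, MR R u w a b))) →
      (∀ v ∈ U, Sum.inr v ∈ (Finset.univ.filter (fun b => ∃ a ∈ s, MR R u w a b))) →
      T.card + U.card ≤ (Finset.univ.filter (fun b => ∃ a ∈ s, MR R u w a b)).card := by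
    intro T U hT hU
    rw [← Finset.card_disjSum]
    apply Finset.card_le_card
    intro b hb
    rcases Finset.mem_disjSum.1 hb with ⟨v, hv, rfl⟩ | ⟨v, hv, rfl⟩
    · exact hT v hv
    · exact hU v hv
  by_cases hJ : s.toLeft = ∅
  · have := lb s.toRight ∅ hF (by simp)
    rw [hJ] at hs
    simp only [Finset.card_empty] at hs this
    omega
  by_cases hv : ∃ v ∈ s.toRight, v ≠ u ∧ v ≠ w ∧ R v w
  · obtain ⟨v, hv, hv'⟩ := hv
    have := lb s.toRight Finset.univ hF (by
      intro j _
      simp only [Finset.mem_filter, Finset.mem_univ, true_and]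
      exact ⟨Sum.inr v, Finset.mem_toRight.1 hv, hv'⟩)
    simp only [Finset.card_univ, Fintype.card_fin] at this
    omega
  push Not at hv
  obtain ⟨i, hi⟩ := Finset.nonempty_iff_ne_empty.2 hJ
  set F := s.toRight with hFdef
  set A := insert u (F.erase w) with hA
  have h3 := h A (by simp [hA]) (by simp [hA, huw.symm]) (by
    intro a ha hau hR
    simp [hA, hau] at ha
    exact hv a ha.2 hau ha.1 hR)
  have hT : ∀ v ∈ F ∪ (Nb R A).erase w,
      Sum.inl v ∈ (Finset.univ.filter (fun b => ∃ a ∈ s, MR R u w a b)) := by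
    intro v hv
    rcases Finset.mem_union.1 hv with hv | hv
    · exact hF v hv
    obtain ⟨hvw, hv⟩ := Finset.mem_erase.1 hv
    obtain ⟨hvA, a, ha, hR⟩ := mem_Nb.1 hv
    have hvu : v ≠ u := by rintro rfl; exact hvA (by simp [hA])
    simp only [Finset.mem_filter, Finset.mem_univ, true_and]
    by_cases hau : a = u
    · subst hau
      exact ⟨Sum.inl i, Finset.mem_toLeft.1 hi, hR, hvu, hvw⟩
    · simp [hA, hau] at ha
      exact ⟨Sum.inr a, Finset.mem_toRight.1 ha.2, Or.inr ⟨hau, ha.1, hR, hvu, hvw⟩⟩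
  have hdis : Disjoint F ((Nb R A).erase w) := by
    rw [Finset.disjoint_left]
    intro v hvF hv
    obtain ⟨hvw, hv⟩ := Finset.mem_erase.1 hv
    exact (mem_Nb.1 hv).1 (by simp [hA, hvw, hvF])
  have hTc := Finset.card_union_of_disjoint hdis
  by_cases hRuw : R u w
  · have h2 : (Nb R A).card ≤ ((Nb R A).erase w).card + 1 := by
      have := Finset.pred_card_le_card_erase (s := Nb R A) (a := w)
      omega
    by_cases h0 : (0 : Fin 3) ∈ s.toLeft
    · have := lb _ {0} hT (by
        intro j hj
        simp only [Finset.mem_filter, Finset.mem_univ, true_and]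
        exact ⟨Sum.inl 0, Finset.mem_toLeft.1 h0, rfl, by simpa using hj, hRuw⟩)
      simp only [Finset.card_singleton] at this
      omega
    · have h4 : s.toLeft.card ≤ 2 := by
        have : s.toLeft ⊆ Finset.univ.erase (0 : Fin 3) := by
          intro j hj
          simp only [Finset.mem_erase, Finset.mem_univ, and_true]
          rintro rfl; exact h0 hj
        simpa using Finset.card_le_card this
      have := lb _ ∅ hT (by simp)
      simp only [Finset.card_empty] at this
      omega
  · have hw : w ∉ Nb R A := by
      intro hw
      obtain ⟨_, a, ha, hR⟩ := mem_Nb.1 hw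
      by_cases hau : a = u
      · subst hau; exact hRuw hR
      · simp [hA, hau] at ha
        exact hv a ha.2 hau ha.1 hR
    rw [Finset.erase_eq_of_notMem hw] at hTc hT
    have := lb _ ∅ hT (by simp)
    simp only [Finset.card_empty] at this
    omega

/-- vertices on the path number `i` traced by the matching. -/
inductive Trace (φ : Fin 3 ⊕ V → V ⊕ Fin 3) (i : Fin 3) : V → Prop
  | base {x : V} (h : φ (Sum.inl i) = Sum.inl x) : Trace φ i x
  | step {x y : V} (hx : Trace φ i x) (h : φ (Sum.inr x) = Sum.inl y) : Trace φ i y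

theorem trace_disj {φ : Fin 3 ⊕ V → V ⊕ Fin 3} (hφ : Function.Injective φ) {i j : Fin 3} {x : V}
    (h : Trace φ i x) (h' : Trace φ j x) : i = j := by
  induction h with
  | base h =>
    cases h' with
    | base h' => exact Sum.inl.inj (hφ (h.trans h'.symm))
    | step hx h' => exact absurd (hφ (h.trans h'.symm)) (by simp)
  | step hx h ih =>
    cases h' with
    | base h' => exact absurd (hφ (h.trans h'.symm)) (by simp)
    | step hx h' =>
      have := Sum.inr.inj (hφ (h.trans h'.symm))
      subst this
      exact ih hx

theorem trace_ne {u w : V} {φ : Fin 3 ⊕ V → V ⊕ Fin 3} (hφ : Function.Injective φ)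
    (hM : ∀ x, MR R u w x (φ x)) {i : Fin 3} {x : V}
    (h : Trace φ i x) : φ (Sum.inr x) ≠ Sum.inl x ∧ x ≠ u ∧ x ≠ w := by
  induction h with
  | base h =>
    refine ⟨fun h' => absurd (hφ (h.trans h'.symm)) (by simp), ?_⟩
    have := hM (Sum.inl i)
    rw [h] at this
    exact this.2
  | step hx h ih =>
    rename_i x y
    constructor
    · intro h'
      have := Sum.inr.inj (hφ (h.trans h'.symm))
      subst this
      exact ih.1 h
    · have := hM (Sum.inr x)
      rw [h] at this
      rcases this with this | this
      · subst this; exact absurd h ih.1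
      · exact this.2.2.2

theorem trace_path {u w : V} {φ : Fin 3 ⊕ V → V ⊕ Fin 3} (hφ : Function.Injective φ)
    (hM : ∀ x, MR R u w x (φ x)) (i : Fin 3) :
    ∃ l, Ch R u l w ∧ l.Nodup ∧ (∀ x ∈ l, Trace φ i x) ∧ (i ≠ 0 → l ≠ []) := by
  cases hi : φ (Sum.inl i) with
  | inr j =>
    have := hM (Sum.inl i)
    rw [hi] at this
    exact ⟨[], this.2.2, by simp, by simp, fun h => absurd this.1 h⟩
  | inl x1 =>
    have hx1 : Trace φ i x1 := Trace.base hi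
    have hux1 : R u x1 := by
      have := hM (Sum.inl i)
      rw [hi] at this
      exact this.1
    have hex : ∃ x, Trace φ i x ∧ ∃ j, φ (Sum.inr x) = Sum.inr j := by
      by_contra hne
      have hall : ∀ x : {x // Trace φ i x}, ∃ y : {x // Trace φ i x},
          φ (Sum.inr x.1) = Sum.inl y.1 := by
        rintro ⟨x, hx⟩
        cases hxx : φ (Sum.inr x) with
        | inl y => exact ⟨⟨y, Trace.step hx hxx⟩, rfl⟩
        | inr j => exact absurd ⟨x, hx, j, hxx⟩ hne
      choose g hg using hall
      have hgi : Function.Injective g := by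
        intro a b hab
        have := hg a
        rw [hab, ← hg b] at this
        exact Subtype.ext (Sum.inr.inj (hφ this))
      obtain ⟨y, hy⟩ := (Finite.surjective_of_injective hgi) ⟨x1, hx1⟩
      have := hg y
      rw [hy] at this
      exact absurd (hφ (this.trans hi.symm)) (by simp)
    have hvia : ∀ x, Trace φ i x → x = x1 ∨ Via R (Trace φ i) x1 x := by
      intro x hx
      induction hx with
      | base h => exact Or.inl (Sum.inl.inj (h.symm.trans hi))
      | step hx h ih =>
        rename_i x y
        right
        have hR : R x y := by
          have h1 := hM (Sum.inr x)
          rw [h] at h1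
          rcases h1 with h1 | h1
          · subst h1; exact absurd h (trace_ne hφ hM hx).1
          · exact h1.2.2.1
        rcases ih with rfl | ih
        · exact via_single hR
        · exact via_tail ih hx hR
    obtain ⟨x, hx, j, hj⟩ := hex
    have hR : R x w := by
      have h1 := hM (Sum.inr x)
      rw [hj] at h1
      exact h1.2.2
    have hv : Via R (Trace φ i) x1 w := by
      rcases hvia x hx with rfl | h
      · exact via_single hR
      · exact via_tail h hx hR
    obtain ⟨l, q1, q2, q3, q4, q5⟩ := via_path hv
    refine ⟨x1 :: l, ⟨hux1, q1⟩, List.nodup_cons.2 ⟨q3, q2⟩, ?_, by simp⟩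
    intro z hz
    rcases List.mem_cons.1 hz with rfl | hz
    · exact hx1
    · exact q5 z hz

theorem menger3 {u w : V} (h : H3 R u w) :
    ∃ l1 l2 l3, Theta R u w l1 l2 l3 ∧ l1 ≠ [] ∧ l2 ≠ [] := by
  obtain ⟨φ, hφ, hM⟩ := (Fintype.all_card_le_filter_rel_iff_exists_injective (MR R u w)).1
    (hall_cond h)
  obtain ⟨l1, a1, b1, c1, d1⟩ := trace_path hφ hM 1
  obtain ⟨l2, a2, b2, c2, d2⟩ := trace_path hφ hM 2
  obtain ⟨l0, a0, b0, c0, d0⟩ := trace_path hφ hM 0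
  refine ⟨l1, l2, l0, ⟨a1, a2, a0, ?_⟩, d1 (by decide), d2 (by decide)⟩
  have hne := h.1
  have hn : ∀ i x, Trace φ i x → x ≠ u ∧ x ≠ w := fun i x hx => (trace_ne hφ hM hx).2
  have hd : ∀ i j x, i ≠ j → Trace φ i x → ¬ Trace φ j x :=
    fun i j x hij h1 h2 => hij (trace_disj hφ h1 h2)
  have e12 : ∀ x ∈ l1, x ∉ l2 := fun x h1 h2 => hd 1 2 x (by decide) (c1 x h1) (c2 x h2)
  have e10 : ∀ x ∈ l1, x ∉ l0 := fun x h1 h2 => hd 1 0 x (by decide) (c1 x h1) (c0 x h2)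
  have e20 : ∀ x ∈ l2, x ∉ l0 := fun x h1 h2 => hd 2 0 x (by decide) (c2 x h1) (c0 x h2)
  have n1 : ∀ x ∈ l1, x ≠ u ∧ x ≠ w := fun x hx => hn _ x (c1 x hx)
  have n2 : ∀ x ∈ l2, x ≠ u ∧ x ≠ w := fun x hx => hn _ x (c2 x hx)
  have n0 : ∀ x ∈ l0, x ≠ u ∧ x ≠ w := fun x hx => hn _ x (c0 x hx)
  clear hn hd c1 c2 c0 d1 d2 d0 hM hφ h
  grind

end menger
end K4

namespace K4

open Classical

set_option linter.unusedSectionVars false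

section structural
variable {V : Type} [Fintype V] {R : V → V → Prop}

/-- all arcs leaving `A` end in `x` or `y` -/
def Cl (R : V → V → Prop) (A : Finset V) (x y : V) : Prop :=
  ∀ a ∈ A, ∀ b, R a b → b ∈ A ∨ b = x ∨ b = y

theorem cl_of_card {A : Finset V} (hA : A.Nonempty) (h : (Nb R A).card ≤ 2) :
    ∃ x y, Cl R A x y := by
  obtain ⟨a, ha⟩ := hA
  have key : ∃ x y, ∀ z ∈ Nb R A, z = x ∨ z = y := by
    have h3 : (Nb R A).card = 0 ∨ (Nb R A).card = 1 ∨ (Nb R A).card = 2 := by omega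
    rcases h3 with h3 | h3 | h3
    · rw [Finset.card_eq_zero] at h3
      exact ⟨a, a, by simp [h3]⟩
    · obtain ⟨x, hx⟩ := Finset.card_eq_one.1 h3
      exact ⟨x, x, by simp [hx]⟩
    · obtain ⟨x, y, _, hx⟩ := Finset.card_eq_two.1 h3
      exact ⟨x, y, by simp [hx]⟩
  obtain ⟨x, y, hxy⟩ := key
  refine ⟨x, y, fun a ha b hb => ?_⟩
  by_cases hbA : b ∈ A
  · exact Or.inl hbA
  · exact Or.inr (hxy b (mem_Nb.2 ⟨hbA, a, ha, hb⟩))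

theorem h3_of_cl {u w : V} (huw : u ≠ w)
    (h : ∀ A : Finset V, u ∈ A → w ∉ A → (∀ a ∈ A, a ≠ u → ¬ R a w) → ∀ x y, ¬ Cl R A x y) :
    H3 R u w := by
  refine ⟨huw, fun A hu hw ha => ?_⟩
  by_contra hc
  obtain ⟨x, y, hxy⟩ := cl_of_card (R := R) ⟨u, hu⟩ (by omega)
  exact h A hu hw ha x y hxy

/-- the one-separation hypothesis -/
def NoSep (R : V → V → Prop) : Prop :=
  ∀ A : Finset V, A.Nonempty → ∀ y, (∀ a ∈ A, ∀ b, R a b → b ∈ A ∨ b = y) → ∀ z, z ∈ A ∨ z = y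

theorem noSep_swap (h1 : NoSep R) (h2 : ∀ v x y, ¬ Cl (fun a b => R b a) {v} x y) :
    NoSep (fun a b => R b a) := by
  intro A hA y hy z
  by_contra hz
  push Not at hz
  by_cases hyA : y ∈ A
  · have := h1 (Finset.univ.filter (fun a => a ∉ A)) ⟨z, by simp [hz.1]⟩ y (by
      intro a ha b hb
      left
      simp only [Finset.mem_filter, Finset.mem_univ, true_and] at ha ⊢
      intro hbA
      rcases hy b hbA a hb with h | h
      · exact ha h
      · subst h; exact ha hyA)
    apply h2 y y y
    intro a ha b hb
    rw [Finset.mem_singleton] at ha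
    subst ha
    have hbA : b ∈ A := by
      rcases hy a hyA b hb with h | h
      · exact h
      · subst h; exact hyA
    rcases this b with h | h
    · simp at h; exact absurd hbA h
    · exact Or.inr (Or.inl h)
  · have := h1 (Finset.univ.filter (fun a => a ∉ A ∧ a ≠ y)) ⟨z, by simp [hz.1, hz.2]⟩ y (by
      intro a ha b hb
      by_cases hby : b = y
      · exact Or.inr hby
      left
      simp only [Finset.mem_filter, Finset.mem_univ, true_and] at ha ⊢
      refine ⟨?_, hby⟩
      intro hbA
      rcases hy b hbA a hb with h | h
      · exact ha.1 h
      · exact ha.2 h)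
    obtain ⟨a, ha⟩ := hA
    rcases this a with h | h
    · simp at h; exact h.1 ha
    · subst h; exact hyA ha

theorem rch_mono {S S' : V → Prop} (h : ∀ z, S z → S' z) {x y : V} (hr : Rch R S x y) :
    Rch R S' x y := Relation.ReflTransGen.mono (fun _ _ hab => ⟨hab.1, h _ hab.2⟩) _ _ hr

theorem rch_prop {S : V → Prop} {x y : V} (hr : Rch R S x y) (hx : S x) : S y := by
  rcases Relation.ReflTransGen.cases_tail hr with h | ⟨_, _, h⟩
  · subst h; exact hx
  · exact h.2

theorem theta_heads {u w : V} {l1 l2 l3 : List V} (h : Theta R u w l1 l2 l3) (h1 : l1 ≠ []) :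
    ∃ x ∈ l1, R u x ∧ x ≠ u ∧ x ≠ w := by
  have c1 := h.c1
  have nd := h.nd
  cases l1 with
  | nil => exact absurd rfl h1
  | cons a l => exact ⟨a, by simp, c1.1, by grind, by grind⟩

/-- reach set -/
noncomputable def RS (R : V → V → Prop) (S : V → Prop) (h : V) : Finset V :=
  Finset.univ.filter (fun z => Rch R S h z)

theorem mem_RS {S : V → Prop} {h z : V} : z ∈ RS R S h ↔ Rch R S h z := by simp [RS]

theorem cl_RS (u w h : V) : Cl R (RS R (fun z => z ≠ u ∧ z ≠ w) h) u w := by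
  intro a ha b hb
  by_cases h1 : b = u
  · exact Or.inr (Or.inl h1)
  by_cases h2 : b = w
  · exact Or.inr (Or.inr h2)
  exact Or.inl (mem_RS.2 ((mem_RS.1 ha).tail ⟨hb, h1, h2⟩))

theorem exit_of_rch {S : V → Prop} {A : Finset V} {x y : V} (hr : Rch R S x y) (hx : x ∈ A)
    (hy : y ∉ A) : ∃ a ∈ A, ∃ s, s ∉ A ∧ S s ∧ R a s := by
  induction hr with
  | refl => exact absurd hx hy
  | tail h1 h2 ih =>
    rename_i b c
    by_cases hb : b ∈ A
    · exact ⟨b, hb, c, hy, h2.2, h2.1⟩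
    · exact ih hb

variable {B : Finset V} {p q : V}

theorem struct_claim (h1r : NoSep (fun a b => R b a))
    (h2i : ∀ v x y, ¬ Cl (fun a b => R b a) {v} x y)
    (hmin : ∀ A : Finset V, A.Nonempty → A.card < B.card →
      ∀ x y, ¬ Cl R A x y ∧ ¬ Cl (fun a b => R b a) A x y)
    (hp : p ∉ B) (hq : q ∉ B) (hB : Cl R B p q) {m v b : V}
    (hmp : Rch R (fun z => z ∉ B) p m) (hmq : Rch R (fun z => z ∉ B) q m)
    (hv : v ∈ B) (hb : b ∈ B) (hvb : v ≠ b) (hmb : R m b) : TT R v b := by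
  have hmB : m ∉ B := rch_prop (S := fun z => z ∉ B) hmp hp
  have hH : H3 R v b := by
    apply h3_of_cl hvb
    intro A hvA hbA hadj x y hcl
    have hmA : m ∉ A := by
      intro hmA
      exact hadj m hmA (by rintro rfl; exact hmB hv) hmb
    have hABlt : (A ∩ B).card < B.card := by
      apply Finset.card_lt_card
      refine ⟨Finset.inter_subset_right, fun h => ?_⟩
      exact hbA (Finset.mem_inter.1 (h hb)).1
    have hABne : (A ∩ B).Nonempty := ⟨v, by simp [hvA, hv]⟩
    have hAB := fun x y => (hmin (A ∩ B) hABne hABlt x y).1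
    have hpq : p ∈ A ∨ q ∈ A := by
      by_contra hc
      push Not at hc
      apply hAB x y
      intro a ha c hR
      rw [Finset.mem_inter] at ha
      rcases hcl a ha.1 c hR with h | h
      · rcases hB a ha.2 c hR with h' | h' | h'
        · left; simp [h, h']
        · subst h'; exact absurd h hc.1
        · subst h'; exact absurd h hc.2
      · exact Or.inr h
    have hex : ∃ a ∈ A, ∃ s, s ∉ A ∧ s ∉ B ∧ R a s := by
      rcases hpq with h | h
      · exact exit_of_rch hmp h hmA
      · exact exit_of_rch hmq h hmA
    obtain ⟨a, haA, s, hsA, hsB, has⟩ := hex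
    have hxy : ∃ y', Cl R A s y' := by
      rcases hcl a haA s has with h | h | h
      · exact absurd h hsA
      · subst h; exact ⟨y, hcl⟩
      · subst h; exact ⟨x, fun a ha b hb => by have := hcl a ha b hb; tauto⟩
    clear hcl has haA
    obtain ⟨y, hcl⟩ := hxy
    have hyB : y ∈ B := by
      by_contra hyB
      apply hAB p q
      intro a ha c hR
      rw [Finset.mem_inter] at ha
      rcases hB a ha.2 c hR with h' | h'
      · rcases hcl a ha.1 c hR with h | h | h
        · left; simp [h, h']
        · subst h; exact absurd h' hsB
        · subst h; exact absurd h' hyB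
      · exact Or.inr h'
    have hpA : p ∈ A ∨ p = s := by
      by_contra hc
      push Not at hc
      apply hAB q y
      intro a ha c hR
      rw [Finset.mem_inter] at ha
      rcases hcl a ha.1 c hR with h | h | h
      · rcases hB a ha.2 c hR with h' | h' | h'
        · left; simp [h, h']
        · subst h'; exact absurd h hc.1
        · exact Or.inr (Or.inl h')
      · rcases hB a ha.2 c hR with h' | h' | h'
        · subst h; exact absurd h' hsB
        · exact absurd (h'.symm.trans h) hc.2
        · exact Or.inr (Or.inl h')
      · exact Or.inr (Or.inr h)
    have hqA : q ∈ A ∨ q = s := by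
      by_contra hc
      push Not at hc
      apply hAB p y
      intro a ha c hR
      rw [Finset.mem_inter] at ha
      rcases hcl a ha.1 c hR with h | h | h
      · rcases hB a ha.2 c hR with h' | h' | h'
        · left; simp [h, h']
        · exact Or.inr (Or.inl h')
        · subst h'; exact absurd h hc.1
      · rcases hB a ha.2 c hR with h' | h' | h'
        · subst h; exact absurd h' hsB
        · exact Or.inr (Or.inl h')
        · exact absurd (h'.symm.trans h) hc.2
      · exact Or.inr (Or.inr h)
    have hZ2 : ∀ z, z ∉ B → z ∉ A → z = s := by
      intro z hzB hzA
      by_contra hzs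
      have := h1r (Finset.univ.filter (fun z => z ∉ B ∧ z ∉ A ∧ z ≠ s))
        ⟨z, by simp [hzB, hzA, hzs]⟩ s (by
        intro z hz a hR
        simp only [Finset.mem_filter, Finset.mem_univ, true_and] at hz ⊢
        by_contra hc
        push Not at hc
        by_cases haA : a ∈ A
        · rcases hcl a haA z hR with h | h | h
          · exact hz.2.1 h
          · exact hz.2.2 h
          · subst h; exact hz.1 hyB
        by_cases haB : a ∈ B
        · rcases hB a haB z hR with h | h | h
          · exact hz.1 h
          · subst h; rcases hpA with h | h
            · exact hz.2.1 h
            · exact hz.2.2 h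
          · subst h; rcases hqA with h | h
            · exact hz.2.1 h
            · exact hz.2.2 h
        exact hc.2 (hc.1 haB haA))
      rcases this v with h | h
      · simp at h; exact h.1 hv
      · subst h; exact hsB hv
    have hB2 : ∀ z, z ∈ B → z ∉ A → z = y := by
      intro z hzB hzA
      by_contra hzy
      refine (hmin (Finset.univ.filter (fun z => z ∈ B ∧ z ∉ A ∧ z ≠ y))
        ⟨z, by simp [hzB, hzA, hzy]⟩ ?_ y s).2 ?_
      · apply Finset.card_lt_card
        refine ⟨fun z hz => by simp at hz; exact hz.1, fun h => ?_⟩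
        have := h hv
        simp at this
        exact this.2.1 hvA
      · intro z hz a hR
        simp only [Finset.mem_filter, Finset.mem_univ, true_and] at hz ⊢
        by_cases haA : a ∈ A
        · exfalso
          rcases hcl a haA z hR with h | h | h
          · exact hz.2.1 h
          · subst h; exact hsB hz.1
          · exact hz.2.2 h
        by_cases haB : a ∈ B
        · by_cases hay : a = y
          · exact Or.inr (Or.inl hay)
          · exact Or.inl ⟨haB, haA, hay⟩
        · exact Or.inr (Or.inr (hZ2 a haB haA))
    have hby := hB2 b hb hbA
    apply h2i b v s
    intro b' hb' a hR
    rw [Finset.mem_singleton] at hb'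
    subst hb'
    by_cases haA : a ∈ A
    · right; left
      by_contra hav
      exact hadj a haA hav hR
    by_cases haB : a ∈ B
    · left; simp [hB2 a haB haA, hby]
    · right; right; exact hZ2 a haB haA
  obtain ⟨l1, l2, l3, hT, hl1, hl2⟩ := menger3 hH
  have hhead : ∀ h, R v h → h ≠ v → h ≠ b → Rch R (fun z => z ≠ v ∧ z ≠ b) h m := by
    intro h hvh hhv hhb
    set T := RS R (fun z => z ≠ v ∧ z ≠ b) h with hT
    have hhT : h ∈ T := mem_RS.2 Relation.ReflTransGen.refl
    have hmono : ∀ e, Rch R (fun z => z ∉ B) e m → Rch R (fun z => z ≠ v ∧ z ≠ b) e m := by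
      intro e he
      refine rch_mono ?_ he
      intro z hz
      exact ⟨by rintro rfl; exact hz hv, by rintro rfl; exact hz hb⟩
    by_cases hpT : p ∈ T
    · exact (mem_RS.1 hpT).trans (hmono p hmp)
    by_cases hqT : q ∈ T
    · exact (mem_RS.1 hqT).trans (hmono q hmq)
    exfalso
    have hTB : ∀ z, Rch R (fun z => z ≠ v ∧ z ≠ b) h z → z ∈ B ∧ z ≠ v := by
      intro z hz
      induction hz with
      | refl =>
        refine ⟨?_, hhv⟩
        rcases hB v hv h hvh with h' | h' | h'
        · exact h'
        · subst h'; exact absurd hhT hpT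
        · subst h'; exact absurd hhT hqT
      | tail k1 k2 ih =>
        rename_i c d
        refine ⟨?_, k2.2.1⟩
        have hd : d ∈ T := mem_RS.2 (k1.tail k2)
        rcases hB c ih.1 d k2.1 with h' | h' | h'
        · exact h'
        · subst h'; exact absurd hd hpT
        · subst h'; exact absurd hd hqT
    refine (hmin T ⟨h, hhT⟩ ?_ v b).1 (cl_RS v b h)
    apply Finset.card_lt_card
    refine ⟨fun z hz => (hTB z (mem_RS.1 hz)).1, fun hh => ?_⟩
    exact (hTB v (mem_RS.1 (hh hv))).2 rfl
  obtain ⟨x, hx, hx1, hx2, hx3⟩ := theta_heads hT hl1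
  obtain ⟨y, hy, hy1, hy2, hy3⟩ := theta_heads hT.s12 hl2
  exact hT.merge hx hy hmb (hhead x hx1 hx2 hx3) (hhead y hy1 hy2 hy3)

theorem struct_side (h1r : NoSep (fun a b => R b a)) {B : Finset V} (hBne : B.Nonempty) {p q : V}
    (hp : p ∉ B) (hB : Cl R B p q)
    (hM : ∀ z, ¬ (Rch R (fun z => z ∉ B) p z ∧ Rch R (fun z => z ∉ B) q z))
    (hcov : ∀ z, z ∈ B ∨ Rch R (fun z => z ∉ B) p z ∨ Rch R (fun z => z ∉ B) q z) :
    ∀ z, Rch R (fun z => z ∉ B) p z → z = p := by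
  intro z hz
  by_contra hzp
  have := h1r ((RS R (fun z => z ∉ B) p).erase p) ⟨z, by simp [hzp, mem_RS, hz]⟩ p (by
    intro z hz a hR
    by_cases hap : a = p
    · exact Or.inr hap
    left
    rw [Finset.mem_erase, mem_RS] at hz ⊢
    refine ⟨hap, ?_⟩
    have hzB : z ∉ B := rch_prop (S := fun z => z ∉ B) hz.2 hp
    rcases hcov a with h | h | h
    · exfalso
      rcases hB a h z hR with h' | h' | h'
      · exact hzB h'
      · exact hz.1 h'
      · subst h'; exact hM z ⟨hz.2, Relation.ReflTransGen.refl⟩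
    · exact h
    · exact absurd ⟨hz.2, h.tail ⟨hR, hzB⟩⟩ (hM z))
  obtain ⟨b, hb⟩ := hBne
  rcases this b with h | h
  · rw [Finset.mem_erase, mem_RS] at h
    exact rch_prop (S := fun z => z ∉ B) h.2 hp hb
  · subst h; exact hp hb

theorem struct_small (h2i : ∀ v x y, ¬ Cl (fun a b => R b a) {v} x y)
    (hmin : ∀ A : Finset V, A.Nonempty → A.card < B.card →
      ∀ x y, ¬ Cl R A x y ∧ ¬ Cl (fun a b => R b a) A x y)
    (hcov : Fintype.card V ≤ B.card + 2) {u w : V} (huw : u ≠ w) : TT R u w := by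
  have hbig : ∀ A : Finset V, A.Nonempty → ∀ x y, Cl R A x y → B.card ≤ A.card := by
    intro A hA x y h
    by_contra hc
    exact (hmin A hA (by omega) x y).1 h
  have hH : H3 R u w := by
    apply h3_of_cl huw
    intro A hu hw hadj x y hcl
    have h1 := hbig A ⟨u, hu⟩ x y hcl
    have h2 : Aᶜ.card ≤ 2 := by rw [Finset.card_compl]; omega
    have hwc : w ∈ Aᶜ := by simpa using hw
    have h3 : (Aᶜ.erase w).card ≤ 1 := by rw [Finset.card_erase_of_mem hwc]; omega
    have : ∃ y', ∀ z ∈ Aᶜ.erase w, z = y' := by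
      rcases Finset.eq_empty_or_nonempty (Aᶜ.erase w) with h | ⟨y', hy'⟩
      · exact ⟨w, by simp [h]⟩
      · exact ⟨y', fun z hz => Finset.card_le_one.1 h3 z hz y' hy'⟩
    obtain ⟨y', hy'⟩ := this
    apply h2i w u y'
    intro w' hw' a hR
    rw [Finset.mem_singleton] at hw'
    subst hw'
    by_cases haA : a ∈ A
    · right; left
      by_contra hav
      exact hadj a haA hav hR
    by_cases haw : a = w'
    · left; simp [haw]
    · right; right; exact hy' a (by simp [haA, haw])
  obtain ⟨l1, l2, l3, hT, hl1, hl2⟩ := menger3 hH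
  obtain ⟨x, hx, hx1, hx2, hx3⟩ := theta_heads hT hl1
  obtain ⟨y, hy, hy1, hy2, hy3⟩ := theta_heads hT.s12 hl2
  refine hT.reach hx hy ?_
  by_contra hc
  have hxT : x ∈ RS R (fun z => z ≠ u ∧ z ≠ w) x := mem_RS.2 Relation.ReflTransGen.refl
  have h1 := hbig _ ⟨x, hxT⟩ u w (cl_RS u w x)
  have hnot : ∀ z, z ∈ RS R (fun z => z ≠ u ∧ z ≠ w) x → z ≠ u ∧ z ≠ w := fun z hz =>
    rch_prop (S := fun z => z ≠ u ∧ z ≠ w) (mem_RS.1 hz) ⟨hx2, hx3⟩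
  have hyT : y ∉ RS R (fun z => z ≠ u ∧ z ≠ w) x := fun h => hc (mem_RS.1 h)
  have huT : u ∉ RS R (fun z => z ≠ u ∧ z ≠ w) x := fun h => (hnot u h).1 rfl
  have hwT : w ∉ RS R (fun z => z ≠ u ∧ z ≠ w) x := fun h => (hnot w h).2 rfl
  have h4 : (insert y (insert u (insert w (RS R (fun z => z ≠ u ∧ z ≠ w) x)))).card =
      (RS R (fun z => z ≠ u ∧ z ≠ w) x).card + 3 := by
    rw [Finset.card_insert_of_notMem, Finset.card_insert_of_notMem, Finset.card_insert_of_notMem]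
    · exact hwT
    · simp [huw, huT]
    · simp [hy2, hy3, hyT]
  have h5 := Finset.card_le_univ (insert y (insert u (insert w (RS R (fun z => z ≠ u ∧ z ≠ w) x))))
  omega

theorem struct_B (h1 : NoSep R) (h1r : NoSep (fun a b => R b a))
    (h2o : ∀ v x y, ¬ Cl R {v} x y)
    (h2i : ∀ v x y, ¬ Cl (fun a b => R b a) {v} x y)
    (hBne : B.Nonempty) {x y : V} (hB0 : Cl R B x y)
    (hmin : ∀ A : Finset V, A.Nonempty → A.card < B.card →
      ∀ x y, ¬ Cl R A x y ∧ ¬ Cl (fun a b => R b a) A x y) :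
    ∃ b b', b ≠ b' ∧ TT R b b' ∧ TT R b' b := by
  have hB2 : 2 ≤ B.card := by
    by_contra hc
    have h0 := Finset.card_pos.2 hBne
    obtain ⟨v, hv⟩ := Finset.card_eq_one.1 (show B.card = 1 by omega)
    exact h2o v x y (hv ▸ hB0)
  have hno1 : ∀ y, ¬ ∀ a ∈ B, ∀ b, R a b → b ∈ B ∨ b = y := by
    intro y hy
    have hcov := h1 B hBne y hy
    obtain ⟨v, hv⟩ := hBne
    have hc : (B.erase v).card = B.card - 1 := Finset.card_erase_of_mem hv
    refine (hmin (B.erase v) (Finset.card_pos.1 (by omega)) (by omega) v y).1 ?_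
    intro a ha b hb
    by_cases hbv : b = v
    · exact Or.inr (Or.inl hbv)
    rcases hcov b with h | h
    · left; simp [hbv, h]
    · exact Or.inr (Or.inr h)
  have hpq : ∃ p q, p ≠ q ∧ p ∉ B ∧ q ∉ B ∧ Cl R B p q := by
    by_cases hxB : x ∈ B
    · exact absurd (fun a ha b hb => by
        rcases hB0 a ha b hb with h | h | h
        · exact Or.inl h
        · subst h; exact Or.inl hxB
        · exact Or.inr h) (hno1 y)
    by_cases hyB : y ∈ B
    · exact absurd (fun a ha b hb => by
        rcases hB0 a ha b hb with h | h | h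
        · exact Or.inl h
        · exact Or.inr h
        · subst h; exact Or.inl hyB) (hno1 x)
    refine ⟨x, y, ?_, hxB, hyB, hB0⟩
    rintro rfl
    exact hno1 x (fun a ha b hb => by have := hB0 a ha b hb; tauto)
  clear hB0 x y
  obtain ⟨p, q, hpq, hp, hq, hB⟩ := hpq
  by_cases hM : ∃ z, Rch R (fun z => z ∉ B) p z ∧ Rch R (fun z => z ∉ B) q z
  · obtain ⟨z, hz⟩ := hM
    set M := Finset.univ.filter
      (fun z => Rch R (fun z => z ∉ B) p z ∧ Rch R (fun z => z ∉ B) q z) with hMdef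
    have hMm : ∀ z, z ∈ M ↔ Rch R (fun z => z ∉ B) p z ∧ Rch R (fun z => z ∉ B) q z := by
      intro z; simp [hMdef]
    have hMB : ∀ z ∈ M, z ∉ B := fun z hz => rch_prop (S := fun z => z ∉ B) ((hMm z).1 hz).1 hp
    have hout : ∀ m ∈ M, ∀ b, R m b → b ∈ M ∨ b ∈ B := by
      intro m hm b hb
      by_cases hbB : b ∈ B
      · exact Or.inr hbB
      · left
        rw [hMm] at hm ⊢
        exact ⟨hm.1.tail ⟨hb, hbB⟩, hm.2.tail ⟨hb, hbB⟩⟩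
    have hnone : ∀ y ∈ B, ¬ ∀ m ∈ M, ∀ b ∈ B, R m b → b = y := by
      intro y hy hc
      have hcov := h1 M ⟨z, (hMm z).2 hz⟩ y (by
        intro a ha b hb
        rcases hout a ha b hb with h | h
        · exact Or.inl h
        · exact Or.inr (hc a ha b h hb))
      have : B ⊆ {y} := by
        intro b hb
        rcases hcov b with h | h
        · exact absurd hb (hMB b h)
        · simp [h]
      have := Finset.card_le_card this
      simp at this
      omega
    obtain ⟨y0, hy0⟩ := hBne
    have e1 := hnone y0 hy0
    push Not at e1
    obtain ⟨m, hm, b, hb, hmb, _⟩ := e1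
    have e2 := hnone b hb
    push Not at e2
    obtain ⟨m', hm', b', hb', hmb', hne⟩ := e2
    rw [hMm] at hm hm'
    exact ⟨b, b', hne.symm,
      struct_claim h1r h2i hmin hp hq hB hm'.1 hm'.2 hb hb' hne.symm hmb',
      struct_claim h1r h2i hmin hp hq hB hm.1 hm.2 hb' hb hne hmb⟩
  · have hM' : ∀ z, ¬ (Rch R (fun z => z ∉ B) p z ∧ Rch R (fun z => z ∉ B) q z) :=
      fun z hz => hM ⟨z, hz⟩
    have hcov : ∀ z, z ∈ B ∨ Rch R (fun z => z ∉ B) p z ∨ Rch R (fun z => z ∉ B) q z := by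
      have := h1 (Finset.univ.filter (fun z => z ∈ B ∨ Rch R (fun z => z ∉ B) p z ∨
        Rch R (fun z => z ∉ B) q z)) ⟨p, Finset.mem_filter.2
          ⟨Finset.mem_univ _, Or.inr (Or.inl Relation.ReflTransGen.refl)⟩⟩ p (by
        intro a ha b hb
        left
        simp only [Finset.mem_filter, Finset.mem_univ, true_and] at ha ⊢
        by_cases hbB : b ∈ B
        · exact Or.inl hbB
        rcases ha with h | h | h
        · rcases hB a h b hb with h' | h' | h'
          · exact Or.inl h'
          · subst h'; exact Or.inr (Or.inl Relation.ReflTransGen.refl)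
          · subst h'; exact Or.inr (Or.inr Relation.ReflTransGen.refl)
        · exact Or.inr (Or.inl (h.tail ⟨hb, hbB⟩))
        · exact Or.inr (Or.inr (h.tail ⟨hb, hbB⟩)))
      intro z
      rcases this z with h | h
      · simpa using h
      · subst h; exact Or.inr (Or.inl Relation.ReflTransGen.refl)
    have hP := struct_side h1r hBne hp hB hM' hcov
    have hQ := struct_side h1r hBne hq (q := p) (fun a ha b hb => by
      have := hB a ha b hb; tauto) (fun z hz => hM' z hz.symm)
      (fun z => by have := hcov z; tauto)
    have hsub : (Finset.univ : Finset V) ⊆ insert p (insert q B) := by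
      intro z _
      rcases hcov z with h | h | h
      · simp [h]
      · simp [hP z h]
      · simp [hQ z h]
    have hcard : Fintype.card V ≤ B.card + 2 := by
      have := Finset.card_le_card hsub
      have h3 := Finset.card_insert_le p (insert q B)
      have h4 := Finset.card_insert_le q B
      rw [Finset.card_univ] at this
      omega
    exact ⟨p, q, hpq, struct_small h2i hmin hcard hpq, struct_small h2i hmin hcard hpq.symm⟩

theorem structural [Nonempty V] (h1 : NoSep R)
    (h2o : ∀ v x y, ¬ Cl R {v} x y)
    (h2i : ∀ v x y, ¬ Cl (fun a b => R b a) {v} x y) :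
    ∃ b b', b ≠ b' ∧ TT R b b' ∧ TT R b' b := by
  have h1r := noSep_swap h1 h2i
  obtain ⟨v⟩ := ‹Nonempty V›
  have hP : (Finset.univ.filter (fun A : Finset V => A.Nonempty ∧
      ∃ x y, Cl R A x y ∨ Cl (fun a b => R b a) A x y)).Nonempty := by
    refine ⟨Finset.univ.erase v, ?_⟩
    simp only [Finset.mem_filter, Finset.mem_univ, true_and]
    constructor
    · by_contra hc
      apply h2o v v v
      intro a ha b hb
      by_contra hbv
      push Not at hbv
      exact hc ⟨b, by simp [hbv.2]⟩
    · refine ⟨v, v, Or.inl ?_⟩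
      intro a ha b hb
      by_cases hbv : b = v
      · simp [hbv]
      · simp [hbv]
  obtain ⟨B, hB, hmin⟩ := Finset.exists_min_image _ Finset.card hP
  simp only [Finset.mem_filter, Finset.mem_univ, true_and] at hB hmin
  obtain ⟨hBne, x, y, hxy⟩ := hB
  rcases hxy with hxy | hxy
  · refine struct_B h1 h1r h2o h2i hBne hxy ?_
    intro A hA hlt x y
    constructor
    · intro h; have := hmin A ⟨hA, x, y, Or.inl h⟩; omega
    · intro h; have := hmin A ⟨hA, x, y, Or.inr h⟩; omega
  · obtain ⟨b, b', hne, t1, t2⟩ := struct_B (R := fun a b => R b a) h1r h1 h2i h2o hBne hxy (by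
      intro A hA hlt x y
      constructor
      · intro h; have := hmin A ⟨hA, x, y, Or.inr h⟩; omega
      · intro h; have := hmin A ⟨hA, x, y, Or.inl h⟩; omega)
    exact ⟨b, b', hne, t2.swap, t1.swap⟩

end structural
end K4

namespace K4

open Classical

section lift
variable {V : Type} {R R2 : V → V → Prop} {Z : V → Prop} {y : V}

theorem ch_avoid (k1 : ∀ a b, R2 a b → a ≠ y → R a b) {u v : V} {L : List V}
    (h : Ch R2 u L v) (hu : u ≠ y) (hL : y ∉ L) : Ch R u L v := by
  induction L generalizing u with
  | nil => exact k1 _ _ h hu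
  | cons x L ih =>
    exact ⟨k1 _ _ h.1 hu, ih h.2 (by grind) (by grind)⟩

theorem ch_notZ (k3 : ∀ a b, R2 a b → ¬ Z a ∧ ¬ Z b) {u v : V} {L : List V}
    (h : Ch R2 u L v) : ¬ Z u ∧ ¬ Z v ∧ ∀ x ∈ L, ¬ Z x := by
  induction L generalizing u with
  | nil => exact ⟨(k3 _ _ h).1, (k3 _ _ h).2, by simp⟩
  | cons x L ih =>
    obtain ⟨a, b, c⟩ := ih h.2
    refine ⟨(k3 _ _ h.1).1, b, ?_⟩
    intro z hz
    rcases List.mem_cons.1 hz with rfl | hz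
    · exact a
    · exact c z hz

theorem ch_insert (k1 : ∀ a b, R2 a b → a ≠ y → R a b) (k2 : ∀ b, R2 y b → Via R Z y b)
    {u v : V} {L : List V} (h : Ch R2 u L v) :
    ∃ I L' : List V, Ch R u L' v ∧ (∀ a, L'.count a = L.count a + I.count a) ∧ (∀ z ∈ I, Z z) ∧
      ∀ a, I.count a ≤ (u :: L).count y := by
  have base : ∀ u v, R2 u v → ∃ I, Ch R u I v ∧ (∀ z ∈ I, Z z) ∧
      ∀ a, I.count a ≤ [u].count y := by
    intro u v huv
    by_cases hu : u = y
    · subst hu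
      obtain ⟨l, q1, q2, q3, q4, q5⟩ := via_path (k2 _ huv)
      refine ⟨l, q1, q5, fun a => ?_⟩
      have := List.nodup_iff_count_le_one.1 q2 a
      simpa using this
    · exact ⟨[], k1 _ _ huv hu, by simp, by simp⟩
  induction L generalizing u with
  | nil =>
    obtain ⟨I, h1, h2, h3⟩ := base u v h
    exact ⟨I, I, h1, by simp, h2, h3⟩
  | cons x L ih =>
    obtain ⟨I, h1, h2, h3⟩ := base u x h.1
    obtain ⟨I', L', g1, g2, g3, g4⟩ := ih h.2
    refine ⟨I ++ I', I ++ x :: L', ch_append.2 ⟨h1, g1⟩, ?_, by grind, ?_⟩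
    · intro a
      have := g2 a
      simp only [List.count_append, List.count_cons]
      omega
    · intro a
      have e1 := h3 a
      have e2 := g4 a
      simp only [List.count_append, List.count_cons, List.count_nil] at e1 e2 ⊢
      omega

theorem ch_from (k1 : ∀ a b, R2 a b → a ≠ y → R a b) (k2 : ∀ b, R2 y b → Via R Z y b)
    {v : V} {L : List V} (h : Ch R2 y L v) (hL : y ∉ L) :
    ∃ I, Ch R y (I ++ L) v ∧ (∀ z ∈ I, Z z) ∧ I.Nodup := by
  cases L with
  | nil =>
    obtain ⟨l, q1, q2, q3, q4, q5⟩ := via_path (k2 _ h)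
    exact ⟨l, by simpa using q1, q5, q2⟩
  | cons x L =>
    obtain ⟨l, q1, q2, q3, q4, q5⟩ := via_path (k2 _ h.1)
    exact ⟨l, ch_append.2 ⟨q1, ch_avoid k1 h.2 (by grind) (by grind)⟩, q5, q2⟩

theorem list_last (z1 z2 : List V) : (∀ x ∈ z2, x ∉ z1) ∨
    ∃ a b c, z2 = a ++ b :: c ∧ b ∈ z1 ∧ ∀ x ∈ c, x ∉ z1 := by
  induction z2 with
  | nil => left; simp
  | cons x z2 ih =>
    rcases ih with ih | ⟨a, b, c, h1, h2, h3⟩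
    · by_cases hx : x ∈ z1
      · exact Or.inr ⟨[], x, z2, by simp, hx, ih⟩
      · left; grind
    · exact Or.inr ⟨x :: a, b, c, by simp [h1], h2, h3⟩

theorem TT.lift (k1 : ∀ a b, R2 a b → a ≠ y → R a b) (k2 : ∀ b, R2 y b → Via R Z y b)
    (k3 : ∀ a b, R2 a b → ¬ Z a ∧ ¬ Z b) {s t : V} (hs : s ≠ y) (h : TT R2 s t) : TT R s t := by
  obtain ⟨v2, v3, l12, l13, l14, l23, l24, l34, c12, c13, c14, c23, c24, c34, nd⟩ := h
  have z12 := ch_notZ k3 c12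
  have z13 := ch_notZ k3 c13
  have z14 := ch_notZ k3 c14
  have z23 := ch_notZ k3 c23
  have z24 := ch_notZ k3 c24
  have z34 := ch_notZ k3 c34
  have cz : ∀ (l : List V), (∀ x ∈ l, ¬ Z x) → ∀ a, Z a → l.count a = 0 := by
    intro l hl a ha
    exact List.count_eq_zero.2 (fun h => hl a h ha)
  have cI : ∀ (l : List V), (∀ x ∈ l, Z x) → ∀ a, ¬ Z a → l.count a = 0 := by
    intro l hl a ha
    exact List.count_eq_zero.2 (fun h => ha (hl a h))
  have hold : ∀ a, Z a →
      (s :: v2 :: v3 :: t :: (l12 ++ l13 ++ l14 ++ l23 ++ l24 ++ l34)).count a = 0 := by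
    apply cz
    intro x hx
    simp only [List.mem_cons, List.mem_append] at hx
    rcases hx with rfl | rfl | rfl | rfl | ((((hx | hx) | hx) | hx) | hx) | hx
    · exact z12.1
    · exact z12.2.1
    · exact z13.2.1
    · exact z14.2.1
    · exact z12.2.2 x hx
    · exact z13.2.2 x hx
    · exact z14.2.2 x hx
    · exact z23.2.2 x hx
    · exact z24.2.2 x hx
    · exact z34.2.2 x hx
  have nd' := List.nodup_iff_count_le_one.1 nd
  by_cases hy : v2 = y
  · subst hy
    have d12 := ch_avoid k1 c12 hs (by grind)
    have d13 := ch_avoid k1 c13 hs (by grind)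
    have d14 := ch_avoid k1 c14 hs (by grind)
    have d34 := ch_avoid k1 c34 (by grind) (by grind)
    obtain ⟨I1, f1, f2, f3⟩ := ch_from k1 k2 c23 (by grind)
    obtain ⟨I2, g1, g2, g3⟩ := ch_from k1 k2 c24 (by grind)
    have f3' := List.nodup_iff_count_le_one.1 f3
    have g3' := List.nodup_iff_count_le_one.1 g3
    rcases list_last I1 I2 with hd | ⟨a, b, c, e1, e2, e3⟩
    · refine ⟨v2, v3, l12, l13, l14, I1 ++ l23, I2 ++ l24, l34, d12, d13, d14, f1, g1, d34, ?_⟩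
      rw [List.nodup_iff_count_le_one]
      intro x
      have n1 := nd' x
      have n2 := f3' x
      have n3 := g3' x
      by_cases hx : Z x
      · have n4 := hold x hx
        have n5 : List.count x I1 = 0 ∨ List.count x I2 = 0 := by
          by_cases hx2 : x ∈ I2
          · left; exact List.count_eq_zero.2 (hd x hx2)
          · right; exact List.count_eq_zero.2 hx2
        simp only [List.count_cons, List.count_append] at n1 n4 ⊢
        omega
      · have n4 := cI I1 f2 x hx
        have n5 := cI I2 g2 x hx
        simp only [List.count_cons, List.count_append] at n1 ⊢
        omega
    · obtain ⟨pre, post, rfl⟩ := List.append_of_mem e2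
      subst e1
      rw [List.append_assoc, List.cons_append, ch_append] at f1 g1
      refine ⟨b, v3, l12 ++ v2 :: pre, l13, l14, post ++ l23, c ++ l24, l34,
        ch_append.2 ⟨d12, f1.1⟩, d13, d14, f1.2, g1.2, d34, ?_⟩
      rw [List.nodup_iff_count_le_one]
      intro x
      have n1 := nd' x
      have n2 := f3' x
      have n3 := g3' x
      by_cases hx : Z x
      · have n4 := hold x hx
        have n5 : List.count x (pre ++ b :: post) = 0 ∨ List.count x c = 0 := by
          by_cases hx2 : x ∈ c
          · left; exact List.count_eq_zero.2 (e3 x hx2)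
          · right; exact List.count_eq_zero.2 hx2
        simp only [List.count_cons, List.count_append] at n1 n2 n3 n4 n5 ⊢
        omega
      · have n4 := cI _ f2 x hx
        have n5 := cI _ g2 x hx
        simp only [List.count_cons, List.count_append] at n1 n4 n5 ⊢
        omega
  · obtain ⟨I12, m12, a12, b12, e12, f12⟩ := ch_insert k1 k2 c12
    obtain ⟨I13, m13, a13, b13, e13, f13⟩ := ch_insert k1 k2 c13
    obtain ⟨I14, m14, a14, b14, e14, f14⟩ := ch_insert k1 k2 c14
    obtain ⟨I23, m23, a23, b23, e23, f23⟩ := ch_insert k1 k2 c23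
    obtain ⟨I24, m24, a24, b24, e24, f24⟩ := ch_insert k1 k2 c24
    obtain ⟨I34, m34, a34, b34, e34, f34⟩ := ch_insert k1 k2 c34
    refine ⟨v2, v3, m12, m13, m14, m23, m24, m34, a12, a13, a14, a23, a24, a34, ?_⟩
    rw [List.nodup_iff_count_le_one]
    intro x
    have n1 := nd' x
    have ny := nd' y
    simp only [List.count_cons, List.count_append] at n1 ny ⊢
    rw [b12, b13, b14, b23, b24, b34]
    have hs' : (s == y) = false := by simpa using hs
    have hv' : (v2 == y) = false := by simpa using hy
    by_cases hx : Z x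
    · have n4 := hold x hx
      have p12 := f12 x
      have p13 := f13 x
      have p14 := f14 x
      have p23 := f23 x
      have p24 := f24 x
      have p34 := f34 x
      simp only [List.count_cons, List.count_append, hs', hv'] at n4 ny p12 p13 p14 p23 p24 p34
      simp only [Bool.false_eq_true, if_false] at ny p12 p13 p14 p23 p24
      omega
    · have q12 := cI _ e12 x hx
      have q13 := cI _ e13 x hx
      have q14 := cI _ e14 x hx
      have q23 := cI _ e23 x hx
      have q24 := cI _ e24 x hx
      have q34 := cI _ e34 x hx
      omega

end lift
end K4

namespace K4

open Classical

section coloring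
variable {V : Type}

/-- monochromatic arcs -/
def Mono (c : V → Fin 3) (R : V → V → Prop) (a b : V) : Prop := c a = c b ∧ R a b

def Good (c : V → Fin 3) (R : V → V → Prop) : Prop :=
  ∀ v, ¬ Relation.TransGen (Mono c R) v v

def Col3 (R : V → V → Prop) : Prop := ∃ c, Good c R

theorem Col3.mono {R R' : V → V → Prop} (h : ∀ a b, R' a b → R a b) (hc : Col3 R) : Col3 R' := by
  obtain ⟨c, hc⟩ := hc
  refine ⟨c, fun v hv => hc v ?_⟩
  exact Relation.TransGen.mono (fun a b hab => ⟨hab.1, h _ _ hab.2⟩) _ _ hv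

theorem Col3.swap {R : V → V → Prop} (hc : Col3 R) : Col3 (fun a b => R b a) := by
  obtain ⟨c, hc⟩ := hc
  refine ⟨c, fun v hv => hc v ?_⟩
  have : Relation.TransGen (Function.swap (Mono c R)) v v :=
    Relation.TransGen.mono (fun a b hab => ⟨hab.1.symm, hab.2⟩) _ _ hv
  exact Relation.transGen_swap.1 this

theorem col3_degree [Fintype V] {R : V → V → Prop} (hirr : ∀ a, ¬ R a a) {v x y : V}
    (hcol : Col3 (fun a b => R a b ∧ a ≠ v ∧ b ≠ v)) (hcl : Cl R {v} x y) : Col3 R := by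
  obtain ⟨c, hc⟩ := hcol
  obtain ⟨d, hdx, hdy⟩ : ∃ d : Fin 3, c x ≠ d ∧ c y ≠ d := by
    generalize c x = i
    generalize c y = j
    revert i j
    decide
  have hsrc : ∀ a b, Mono (Function.update c v d) R a b → a ≠ v := by
    rintro a b ⟨h1, h2⟩ rfl
    have hba : b ≠ a := by rintro rfl; exact hirr _ h2
    rw [Function.update_self, Function.update_of_ne hba] at h1
    rcases hcl a (by simp) b h2 with h | h | h
    · exact hba (by simpa using h)
    · subst h; exact hdx h1.symm
    · subst h; exact hdy h1.symm
  have hstep : ∀ a b, Mono (Function.update c v d) R a b → b ≠ v →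
      Mono c (fun a b => R a b ∧ a ≠ v ∧ b ≠ v) a b := by
    intro a b h hb
    have ha := hsrc a b h
    obtain ⟨h1, h2⟩ := h
    rw [Function.update_of_ne ha, Function.update_of_ne hb] at h1
    exact ⟨h1, h2, ha, hb⟩
  have key : ∀ a b, Relation.TransGen (Mono (Function.update c v d) R) a b → b ≠ v →
      Relation.TransGen (Mono c (fun a b => R a b ∧ a ≠ v ∧ b ≠ v)) a b := by
    intro a b h
    induction h with
    | single h => intro hb; exact Relation.TransGen.single (hstep _ _ h hb)
    | tail h1 h2 ih => intro hb; exact (ih (hsrc _ _ h2)).tail (hstep _ _ h2 hb)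
  refine ⟨Function.update c v d, fun u hu => hc u (key u u hu ?_)⟩
  obtain ⟨b, hb, _⟩ := Relation.TransGen.head'_iff.1 hu
  exact hsrc _ _ hb

/-- the relation on the small side of a separation -/
def Rel2 (R : V → V → Prop) (A Z : Finset V) (y : V) (a b : V) : Prop :=
  (a ∈ A ∧ (b ∈ A ∨ b = y) ∧ R a b) ∨ (a = y ∧ b ∈ A ∧ Via R (fun z => z ∈ Z) y b)

/-- one-separation -/
structure Sep (W : Finset V) (R : V → V → Prop) (A Z : Finset V) (y : V) : Prop where
  cov : ∀ a, a ∈ W ↔ a ∈ A ∨ a = y ∨ a ∈ Z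
  yA : y ∉ A
  yZ : y ∉ Z
  AZ : ∀ a ∈ A, a ∉ Z
  neA : A.Nonempty
  neZ : Z.Nonempty
  out : ∀ a ∈ A, ∀ b, R a b → b ∈ A ∨ b = y

theorem sep_col {W : Finset V} {R : V → V → Prop} {A Z : Finset V} {y : V}
    (hirr : ∀ a, ¬ R a a)
    (hsupp : ∀ a b, R a b → a ∈ W ∧ b ∈ W) (hS : Sep W R A Z y)
    (hc1 : Col3 (fun a b => R a b ∧ a ∉ A ∧ b ∉ A)) (hc2 : Col3 (Rel2 R A Z y)) : Col3 R := by
  obtain ⟨c1, hc1⟩ := hc1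
  obtain ⟨c2, hc2⟩ := hc2
  set σ := Equiv.swap (c1 y) (c2 y) with hσ
  set R1 : V → V → Prop := fun a b => R a b ∧ a ∉ A ∧ b ∉ A with hR1
  have hc1' : Good (fun v => σ (c1 v)) R1 := by
    intro v hv
    refine hc1 v (Relation.TransGen.mono (fun a b hab => ⟨?_, hab.2⟩) _ _ hv)
    exact σ.injective hab.1
  set c : V → Fin 3 := fun v => if v ∈ Z then σ (c1 v) else c2 v with hc
  have cZ : ∀ v ∈ Z, c v = σ (c1 v) := by intro v hv; simp [hc, hv]
  have cA : ∀ v ∈ A, c v = c2 v := by intro v hv; simp [hc, hS.AZ v hv]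
  have cy : c y = c2 y := by simp [hc, hS.yZ]
  have cy1 : c y = σ (c1 y) := by rw [cy, hσ, Equiv.swap_apply_left]
  have ZA : ∀ v ∈ Z, v ∉ A := fun v hv hv' => hS.AZ v hv' hv
  -- arc types
  have tA : ∀ a b, a ∈ A → Mono c R a b → (b ∈ A ∨ b = y) ∧ Mono c2 (Rel2 R A Z y) a b := by
    intro a b ha h
    have hb := hS.out a ha b h.2
    refine ⟨hb, ?_, Or.inl ⟨ha, hb, h.2⟩⟩
    have := h.1
    rw [cA a ha] at this
    rcases hb with hb | rfl
    · rw [cA b hb] at this; exact this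
    · rw [cy] at this; exact this
  have tR1 : ∀ a b, (a = y ∨ a ∈ Z) → (b = y ∨ b ∈ Z) → Mono c R a b →
      Mono (fun v => σ (c1 v)) R1 a b := by
    intro a b ha hb h
    have e : ∀ a, (a = y ∨ a ∈ Z) → c a = σ (c1 a) ∧ a ∉ A := by
      rintro a (rfl | ha)
      · exact ⟨cy1, hS.yA⟩
      · exact ⟨cZ a ha, ZA a ha⟩
    refine ⟨?_, h.2, (e a ha).2, (e b hb).2⟩
    have := h.1
    rw [(e a ha).1, (e b hb).1] at this
    exact this
  have tb : ∀ a b, Mono c R a b → b ∈ A ∨ b = y ∨ b ∈ Z := fun a b h =>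
    (hS.cov b).1 (hsupp _ _ h.2).2
  have ta : ∀ a b, Mono c R a b → a ∈ A ∨ a = y ∨ a ∈ Z := fun a b h =>
    (hS.cov a).1 (hsupp _ _ h.2).1
  have t2 : ∀ b ∈ A, c b = c y → Via R (fun z => z ∈ Z) y b → Mono c2 (Rel2 R A Z y) y b := by
    intro b hb h1 h2
    refine ⟨?_, Or.inr ⟨rfl, hb, h2⟩⟩
    rw [← cy, ← cA b hb]; exact h1.symm
  have claim1 : ∀ v, Relation.TransGen (Mono c R) y v →
      (v ∈ A ∧ Relation.TransGen (Mono c2 (Rel2 R A Z y)) y v) ∨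
      (v ∈ Z ∧ Relation.TransGen (Mono (fun v => σ (c1 v)) R1) y v ∧
        Via R (fun z => z ∈ Z) y v ∧ c v = c y) := by
    intro v hv
    induction hv with
    | single h =>
      rename_i b
      rcases tb _ _ h with hb | hb | hb
      · exact Or.inl ⟨hb, .single (t2 b hb h.1.symm (via_single h.2))⟩
      · subst hb; exact absurd h.2 (hirr _)
      · exact Or.inr ⟨hb, .single (tR1 _ _ (Or.inl rfl) (Or.inr hb) h), via_single h.2, h.1.symm⟩
    | tail h1 h ih =>
      rename_i v b
      rcases ih with ⟨hv, ih⟩ | ⟨hv, ih, via, hcv⟩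
      · obtain ⟨hb, h2⟩ := tA _ _ hv h
        rcases hb with hb | hb
        · exact Or.inl ⟨hb, ih.tail h2⟩
        · subst hb; exact absurd (ih.tail h2) (hc2 _)
      · rcases tb _ _ h with hb | hb | hb
        · have hvia := via_tail via hv h.2
          exact Or.inl ⟨hb, .single (t2 b hb (h.1.symm.trans hcv) hvia)⟩
        · subst hb
          exact absurd (ih.tail (tR1 _ _ (Or.inr hv) (Or.inl rfl) h)) (hc1' _)
        · exact Or.inr ⟨hb, ih.tail (tR1 _ _ (Or.inr hv) (Or.inr hb) h),
            via_tail via hv h.2, h.1.symm.trans hcv⟩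
  have hyy : ¬ Relation.TransGen (Mono c R) y y := by
    intro h
    rcases claim1 y h with h | h
    · exact hS.yA h.1
    · exact hS.yZ h.1
  refine ⟨c, fun u hu => ?_⟩
  obtain ⟨b0, hb0, _⟩ := Relation.TransGen.head'_iff.1 hu
  rcases ta _ _ hb0 with huA | rfl | huZ
  · have claim2 : ∀ v, Relation.TransGen (Mono c R) u v →
        (v ∈ A ∧ Relation.TransGen (Mono c2 (Rel2 R A Z y)) u v) ∨
        (Relation.ReflTransGen (Mono c R) y v ∧ Relation.TransGen (Mono c R) u y) := by
      intro v hv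
      induction hv with
      | single h =>
        obtain ⟨hb, h2⟩ := tA _ _ huA h
        rcases hb with hb | rfl
        · exact Or.inl ⟨hb, .single h2⟩
        · exact Or.inr ⟨.refl, .single h⟩
      | tail h1 h ih =>
        rcases ih with ⟨hv, ih⟩ | ⟨ih1, ih2⟩
        · obtain ⟨hb, h2⟩ := tA _ _ hv h
          rcases hb with hb | rfl
          · exact Or.inl ⟨hb, ih.tail h2⟩
          · exact Or.inr ⟨.refl, h1.tail h⟩
        · exact Or.inr ⟨ih1.tail h, ih2⟩
    rcases claim2 u hu with h | h
    · exact hc2 u h.2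
    · exact hyy (Relation.TransGen.trans_right h.1 h.2)
  · exact hyy hu
  · have claim3 : ∀ v, Relation.TransGen (Mono c R) u v →
        v ∈ A ∨ (v ∈ Z ∧ Relation.TransGen (Mono (fun v => σ (c1 v)) R1) u v) ∨
        (Relation.ReflTransGen (Mono c R) y v ∧ Relation.TransGen (Mono c R) u y) := by
      intro v hv
      induction hv with
      | single h =>
        rcases tb _ _ h with hb | rfl | hb
        · exact Or.inl hb
        · exact Or.inr (Or.inr ⟨.refl, .single h⟩)
        · exact Or.inr (Or.inl ⟨hb, .single (tR1 _ _ (Or.inr huZ) (Or.inr hb) h)⟩)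
      | tail h1 h ih =>
        rcases ih with hv | ⟨hv, ih⟩ | ⟨ih1, ih2⟩
        · obtain ⟨hb, h2⟩ := tA _ _ hv h
          rcases hb with hb | rfl
          · exact Or.inl hb
          · exact Or.inr (Or.inr ⟨.refl, h1.tail h⟩)
        · rcases tb _ _ h with hb | rfl | hb
          · exact Or.inl hb
          · exact Or.inr (Or.inr ⟨.refl, h1.tail h⟩)
          · exact Or.inr (Or.inl ⟨hb, ih.tail (tR1 _ _ (Or.inr hv) (Or.inr hb) h)⟩)
        · exact Or.inr (Or.inr ⟨ih1.tail h, ih2⟩)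
    rcases claim3 u hu with h | h | h
    · exact ZA u huZ h
    · exact hc1' u h.2
    · exact hyy (Relation.TransGen.trans_right h.1 h.2)

end coloring

section mainproof
variable {V : Type} [Fintype V]

/-- the induction statement -/
def PW (W : Finset V) : Prop :=
  ∀ R : V → V → Prop, (∀ a, ¬ R a a) → (∀ a b, R a b → a ∈ W ∧ b ∈ W) → ¬ Col3 R →
    ∀ x, ∃ s t, s ≠ x ∧ TT R s t

theorem sep_step {W : Finset V} {R : V → V → Prop} {A Z : Finset V} {y : V}
    (ih : ∀ W' : Finset V, W'.card < W.card → PW W')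
    (hirr : ∀ a, ¬ R a a)
    (hsupp : ∀ a b, R a b → a ∈ W ∧ b ∈ W) (hS : Sep W R A Z y) (hcol : ¬ Col3 R)
    (hcrit : ∀ v ∈ W, Col3 (fun a b => R a b ∧ a ≠ v ∧ b ≠ v)) :
    ∃ s t, s ∈ A ∧ (t ∈ A ∨ t = y) ∧ TT R s t := by
  have hc1 : Col3 (fun a b => R a b ∧ a ∉ A ∧ b ∉ A) := by
    obtain ⟨v, hv⟩ := hS.neA
    refine (hcrit v ((hS.cov v).2 (Or.inl hv))).mono ?_
    rintro a b ⟨h1, h2, h3⟩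
    exact ⟨h1, by rintro rfl; exact h2 hv, by rintro rfl; exact h3 hv⟩
  have hc2 : ¬ Col3 (Rel2 R A Z y) := fun h => hcol (sep_col hirr hsupp hS hc1 h)
  have hsupp2 : ∀ a b, Rel2 R A Z y a b → a ∈ insert y A ∧ b ∈ insert y A := by
    intro a b h
    rcases h with ⟨h1, h2 | h2, h3⟩ | ⟨h1, h2, h3⟩
    · simp [h1, h2]
    · simp [h1, h2]
    · simp [h1, h2]
  have hlt : (insert y A).card < W.card := by
    apply Finset.card_lt_card
    constructor
    · intro a ha
      rw [hS.cov]
      rcases Finset.mem_insert.1 ha with h | h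
      · exact Or.inr (Or.inl h)
      · exact Or.inl h
    · intro h
      obtain ⟨z, hz⟩ := hS.neZ
      rcases Finset.mem_insert.1 (h ((hS.cov z).2 (Or.inr (Or.inr hz)))) with h | h
      · subst h; exact hS.yZ hz
      · exact hS.AZ z h hz
  obtain ⟨s, t, hsy, hT⟩ := ih _ hlt (Rel2 R A Z y) (by
    rintro a (⟨h1, h2, h3⟩ | ⟨h1, h2, h3⟩)
    · exact hirr a h3
    · subst h1; exact hS.yA h2) hsupp2 hc2 y
  have hst : s ∈ insert y A ∧ t ∈ insert y A := by
    obtain ⟨v2, v3, l12, l13, l14, l23, l24, l34, c12, c13, c14, c23, c24, c34, nd⟩ := hT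
    have := ch_notZ (Z := fun z => z ∉ insert y A) (fun a b h => by
      have := hsupp2 a b h
      exact ⟨not_not.2 this.1, not_not.2 this.2⟩) c14
    exact ⟨not_not.1 this.1, not_not.1 this.2.1⟩
  refine ⟨s, t, ?_, ?_, ?_⟩
  · simpa [hsy] using hst.1
  · have := hst.2
    rw [Finset.mem_insert] at this
    exact this.symm
  · refine hT.lift (y := y) (Z := fun z => z ∈ Z) ?_ ?_ ?_ hsy
    · rintro a b (⟨h1, h2, h3⟩ | ⟨h1, h2, h3⟩) hay
      · exact h3
      · exact absurd h1 hay
    · rintro b (⟨h1, h2, h3⟩ | ⟨h1, h2, h3⟩)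
      · exact absurd h1 hS.yA
      · exact h3
    · have e : ∀ a, a ∈ insert y A → a ∉ Z := by
        intro a ha
        rcases Finset.mem_insert.1 ha with rfl | h
        · exact hS.yZ
        · exact hS.AZ a h
      intro a b h
      exact ⟨e a (hsupp2 a b h).1, e b (hsupp2 a b h).2⟩

theorem Sep.swap {W : Finset V} {R : V → V → Prop} {A Z : Finset V} {y : V}
    (hsupp : ∀ a b, R a b → a ∈ W ∧ b ∈ W) (hS : Sep W R A Z y) :
    Sep W (fun a b => R b a) Z A y := by
  refine ⟨fun a => ?_, hS.yZ, hS.yA, fun a ha ha' => hS.AZ a ha' ha, hS.neZ, hS.neA, ?_⟩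
  · rw [hS.cov a]; tauto
  · intro z hz b hb
    rcases (hS.cov b).1 (hsupp _ _ hb).1 with h | h | h
    · rcases hS.out b h z hb with h' | h'
      · exact absurd hz (hS.AZ z h')
      · subst h'; exact absurd hz hS.yZ
    · exact Or.inr h
    · exact Or.inl h

theorem main_step (W : Finset V) (ih : ∀ W' : Finset V, W'.card < W.card → PW W') : PW W := by
  intro R hirr hsupp hcol x
  by_cases hcrit : ∀ v ∈ W, Col3 (fun a b => R a b ∧ a ≠ v ∧ b ≠ v)
  swap
  · push Not at hcrit
    obtain ⟨v, hv, hcv⟩ := hcrit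
    obtain ⟨s, t, h1, h2⟩ := ih (W.erase v) (Finset.card_erase_lt_of_mem hv) _
      (fun a h => hirr a h.1) (fun a b h => by
        have := hsupp a b h.1
        simp [this, h.2]) hcv x
    exact ⟨s, t, h1, h2.mono (fun a b h => h.1)⟩
  have hcols : ¬ Col3 (fun a b => R b a) := fun h => hcol h.swap
  have hcrits : ∀ v ∈ W, Col3 (fun a b => R b a ∧ a ≠ v ∧ b ≠ v) := by
    intro v hv
    refine (hcrit v hv).swap.mono ?_
    rintro a b ⟨h1, h2, h3⟩
    exact ⟨h1, h3, h2⟩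
  by_cases hsep : ∃ A Z y, Sep W R A Z y
  · obtain ⟨A, Z, y, hS⟩ := hsep
    by_cases hx : x ∈ A
    · obtain ⟨s, t, h1, h2, h3⟩ := sep_step (R := fun a b => R b a) ih hirr
        (fun a b h => (hsupp b a h).symm) (hS.swap hsupp) hcols hcrits
      refine ⟨t, s, ?_, h3.swap⟩
      rintro rfl
      rcases h2 with h2 | h2
      · exact hS.AZ _ hx h2
      · subst h2; exact hS.yA hx
    · obtain ⟨s, t, h1, h2, h3⟩ := sep_step ih hirr hsupp hS hcol hcrit
      exact ⟨s, t, by rintro rfl; exact hx h1, h3⟩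
  have hdo : ∀ v ∈ W, ∀ x y, ¬ Cl R {v} x y := fun v hv x y h =>
    hcol (col3_degree hirr (hcrit v hv) h)
  have hdi : ∀ v ∈ W, ∀ x y, ¬ Cl (fun a b => R b a) {v} x y := fun v hv x y h =>
    hcols (col3_degree hirr (hcrits v hv) h)
  have hne : Nonempty {v // v ∈ W} := by
    by_contra hc
    apply hcol
    refine ⟨fun _ => 0, fun v hv => ?_⟩
    obtain ⟨b, hb, _⟩ := Relation.TransGen.head'_iff.1 hv
    exact hc ⟨⟨v, (hsupp _ _ hb.2).1⟩⟩
  have hdo' : ∀ (v x y : {v // v ∈ W}), ¬ Cl (fun a b : {v // v ∈ W} => R a.1 b.1) {v} x y := by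
    intro v x y h
    apply hdo v.1 v.2 x.1 y.1
    intro a ha b hb
    rw [Finset.mem_singleton] at ha
    subst ha
    rcases h v (by simp) ⟨b, (hsupp _ _ hb).2⟩ hb with h | h | h
    · left; rw [Finset.mem_singleton] at h ⊢; exact congrArg Subtype.val h
    · right; left; exact congrArg Subtype.val h
    · right; right; exact congrArg Subtype.val h
  have hdi' : ∀ (v x y : {v // v ∈ W}), ¬ Cl (fun a b : {v // v ∈ W} => R b.1 a.1) {v} x y := by
    intro v x y h
    apply hdi v.1 v.2 x.1 y.1
    intro a ha b hb
    rw [Finset.mem_singleton] at ha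
    subst ha
    rcases h v (by simp) ⟨b, (hsupp _ _ hb).1⟩ hb with h | h | h
    · left; rw [Finset.mem_singleton] at h ⊢; exact congrArg Subtype.val h
    · right; left; exact congrArg Subtype.val h
    · right; right; exact congrArg Subtype.val h
  have hgen : ∀ (A : Finset {v // v ∈ W}) (y z : {v // v ∈ W}), A.Nonempty → y ∉ A → z ∉ A →
      z ≠ y → (∀ a ∈ A, ∀ b : {v // v ∈ W}, R a.1 b.1 → b ∈ A ∨ b = y) → False := by
    intro A y z hA hy hz hzy hcl
    apply hsep
    have mA : ∀ a : {v // v ∈ W}, a.1 ∈ A.image Subtype.val ↔ a ∈ A := by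
      intro a; simp
    refine ⟨A.image Subtype.val, W.filter (fun a => a ∉ A.image Subtype.val ∧ a ≠ y.1), y.1, ?_⟩
    refine ⟨?_, ?_, ?_, ?_, ?_, ?_, ?_⟩
    · intro a
      constructor
      · intro ha
        by_cases h1 : a ∈ A.image Subtype.val
        · exact Or.inl h1
        by_cases h2 : a = y.1
        · exact Or.inr (Or.inl h2)
        · exact Or.inr (Or.inr (Finset.mem_filter.2 ⟨ha, h1, h2⟩))
      · rintro (h | h | h)
        · obtain ⟨b, _, rfl⟩ := Finset.mem_image.1 h
          exact b.2
        · rw [h]; exact y.2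
        · exact (Finset.mem_filter.1 h).1
    · rw [mA]; exact hy
    · intro h; exact (Finset.mem_filter.1 h).2.2 rfl
    · intro a ha h; exact (Finset.mem_filter.1 h).2.1 ha
    · exact hA.image _
    · refine ⟨z.1, Finset.mem_filter.2 ⟨z.2, ?_, ?_⟩⟩
      · rw [mA]; exact hz
      · intro h; exact hzy (Subtype.ext h)
    · intro a ha b hb
      obtain ⟨a', ha', rfl⟩ := Finset.mem_image.1 ha
      rcases hcl a' ha' ⟨b, (hsupp _ _ hb).2⟩ hb with h | h
      · left; exact (mA ⟨b, (hsupp _ _ hb).2⟩).2 h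
      · right; exact congrArg Subtype.val h
  have hns : NoSep (fun a b : {v // v ∈ W} => R a.1 b.1) := by
    intro A hA y hcl z
    by_contra hc
    push Not at hc
    by_cases hy : y ∈ A
    · have hcl' : ∀ a ∈ A, ∀ b : {v // v ∈ W}, R a.1 b.1 → b ∈ A := by
        intro a ha b hb
        rcases hcl a ha b hb with h | h
        · exact h
        · subst h; exact hy
      by_cases hz' : ∃ z', z' ∉ A ∧ z' ≠ z
      · obtain ⟨z', h1, h2⟩ := hz'
        exact hgen A z z' hA hc.1 h1 h2 (fun a ha b hb => Or.inl (hcl' a ha b hb))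
      · push Not at hz'
        apply hdi' z z z
        intro a ha b hb
        rw [Finset.mem_singleton] at ha
        subst ha
        by_cases hbA : b ∈ A
        · exact absurd (hcl' b hbA a hb) hc.1
        · exact Or.inr (Or.inl (hz' b hbA))
    · exact hgen A y z hA hy hc.1 hc.2 hcl
  obtain ⟨b, b', hbb, t1, t2⟩ := structural hns hdo' hdi'
  have T1 : TT R b.1 b'.1 := t1.map Subtype.val Subtype.val_injective (fun a b h => h)
  have T2 : TT R b'.1 b.1 := t2.map Subtype.val Subtype.val_injective (fun a b h => h)
  by_cases hbx : b.1 = x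
  · refine ⟨b'.1, b.1, ?_, T2⟩
    rintro h
    exact hbb (Subtype.ext (hbx.trans h.symm))
  · exact ⟨b.1, b'.1, hbx, T1⟩

theorem main_all (n : ℕ) : ∀ W : Finset V, W.card = n → PW W := by
  induction n using Nat.strong_induction_on with
  | _ n ih =>
    intro W hW
    apply main_step
    intro W' hW'
    exact ih W'.card (by omega) W' rfl

theorem exists_TT {R : V → V → Prop} (hirr : ∀ a, ¬ R a a) (hcol : ¬ Col3 R) :
    ∃ s t, TT R s t := by
  have hne : Nonempty V := by
    by_contra hc
    exact hcol ⟨fun _ => 0, fun v => absurd ⟨v⟩ hc⟩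
  obtain ⟨x⟩ := hne
  obtain ⟨s, t, _, h⟩ := main_all _ Finset.univ rfl R hirr (fun a b _ => by simp) hcol x
  exact ⟨s, t, h⟩

end mainproof
end K4

namespace K4

open Classical

section final

theorem TT.subdivision {V : Type} {D : Digraph' V} {s t : V} (h : TT D.Adj s t) :
    D.ContainsSubdivision K4trans := by
  obtain ⟨v2, v3, l12, l13, l14, l23, l24, l34, c12, c13, c14, c23, c24, c34, nd⟩ := h
  let P : Fin 4 → Fin 4 → List V :=
    ![![[], l12, l13, l14], ![[], [], l23, l24], ![[], [], [], l34], ![[], [], [], []]]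
  have hlt : ∀ a b : Fin 4, K4trans.Adj a b → (a = 0 ∧ b = 1) ∨ (a = 0 ∧ b = 2) ∨
      (a = 0 ∧ b = 3) ∨ (a = 1 ∧ b = 2) ∨ (a = 1 ∧ b = 3) ∨ (a = 2 ∧ b = 3) := by
    intro a b hab
    have hab' : a < b := hab
    clear hab nd c12 c13 c14 c23 c24 c34 P
    fin_cases a <;> fin_cases b <;> simp_all
  have hβ : ∀ x, x ∈ Set.range (![s, v2, v3, t] : Fin 4 → V) →
      x = s ∨ x = v2 ∨ x = v3 ∨ x = t := by
    rintro x ⟨i, rfl⟩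
    fin_cases i <;> simp
  refine ⟨![s, v2, v3, t], fun a b _ => P a b, ?_, ?_, ?_, ?_⟩
  · intro i j hij
    fin_cases i <;> fin_cases j <;> simp at hij ⊢ <;> grind
  · intro a b hab
    rcases hlt a b hab with ⟨rfl, rfl⟩ | ⟨rfl, rfl⟩ | ⟨rfl, rfl⟩ | ⟨rfl, rfl⟩ | ⟨rfl, rfl⟩ |
      ⟨rfl, rfl⟩
    · exact ⟨ch_isChain c12, (by
        rw [List.nodup_iff_count_le_one]; intro x
        have n1 := List.nodup_iff_count_le_one.1 nd x
        simp only [List.count_cons, List.count_append, List.count_nil, List.cons_append] at n1 ⊢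
        omega : (s :: l12 ++ [v2]).Nodup)⟩
    · exact ⟨ch_isChain c13, (by
        rw [List.nodup_iff_count_le_one]; intro x
        have n1 := List.nodup_iff_count_le_one.1 nd x
        simp only [List.count_cons, List.count_append, List.count_nil, List.cons_append] at n1 ⊢
        omega : (s :: l13 ++ [v3]).Nodup)⟩
    · exact ⟨ch_isChain c14, (by
        rw [List.nodup_iff_count_le_one]; intro x
        have n1 := List.nodup_iff_count_le_one.1 nd x
        simp only [List.count_cons, List.count_append, List.count_nil, List.cons_append] at n1 ⊢
        omega : (s :: l14 ++ [t]).Nodup)⟩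
    · exact ⟨ch_isChain c23, (by
        rw [List.nodup_iff_count_le_one]; intro x
        have n1 := List.nodup_iff_count_le_one.1 nd x
        simp only [List.count_cons, List.count_append, List.count_nil, List.cons_append] at n1 ⊢
        omega : (v2 :: l23 ++ [v3]).Nodup)⟩
    · exact ⟨ch_isChain c24, (by
        rw [List.nodup_iff_count_le_one]; intro x
        have n1 := List.nodup_iff_count_le_one.1 nd x
        simp only [List.count_cons, List.count_append, List.count_nil, List.cons_append] at n1 ⊢
        omega : (v2 :: l24 ++ [t]).Nodup)⟩
    · exact ⟨ch_isChain c34, (by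
        rw [List.nodup_iff_count_le_one]; intro x
        have n1 := List.nodup_iff_count_le_one.1 nd x
        simp only [List.count_cons, List.count_append, List.count_nil, List.cons_append] at n1 ⊢
        omega : (v3 :: l34 ++ [t]).Nodup)⟩
  · intro a b hab x hx hx'
    have hxx := hβ x hx'
    have n1 := List.nodup_iff_count_le_one.1 nd x
    simp only [List.count_cons, List.count_append, List.count_nil] at n1
    have n2 : 1 ≤ (if (s == x) = true then 1 else 0) + (if (v2 == x) = true then 1 else 0) +
        (if (v3 == x) = true then 1 else 0) + (if (t == x) = true then 1 else 0) := by
      clear n1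
      rcases hxx with rfl | rfl | rfl | rfl <;> simp <;> omega
    rcases hlt a b hab with ⟨rfl, rfl⟩ | ⟨rfl, rfl⟩ | ⟨rfl, rfl⟩ | ⟨rfl, rfl⟩ | ⟨rfl, rfl⟩ |
      ⟨rfl, rfl⟩
    · change x ∈ l12 at hx; have p1 := List.count_pos_iff.2 hx; omega
    · change x ∈ l13 at hx; have p1 := List.count_pos_iff.2 hx; omega
    · change x ∈ l14 at hx; have p1 := List.count_pos_iff.2 hx; omega
    · change x ∈ l23 at hx; have p1 := List.count_pos_iff.2 hx; omega
    · change x ∈ l24 at hx; have p1 := List.count_pos_iff.2 hx; omega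
    · change x ∈ l34 at hx; have p1 := List.count_pos_iff.2 hx; omega
  · intro a b hab a' b' hab' hne x hx hx'
    have e01 : P 0 1 = l12 := rfl
    have e02 : P 0 2 = l13 := rfl
    have e03 : P 0 3 = l14 := rfl
    have e12 : P 1 2 = l23 := rfl
    have e13 : P 1 3 = l24 := rfl
    have e23 : P 2 3 = l34 := rfl
    have h1 := hlt a b hab
    have h2 := hlt a' b' hab'
    change x ∈ P a b at hx
    change x ∈ P a' b' at hx'
    clear_value P
    clear hβ hlt hab hab' c12 c13 c14 c23 c24 c34
    have n1 := List.nodup_iff_count_le_one.1 nd x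
    simp only [List.count_cons, List.count_append] at n1
    have p1 := List.count_pos_iff.2 hx
    have p2 := List.count_pos_iff.2 hx'
    clear nd hx hx'
    rcases h1 with ⟨rfl, rfl⟩ | ⟨rfl, rfl⟩ | ⟨rfl, rfl⟩ | ⟨rfl, rfl⟩ | ⟨rfl, rfl⟩ | ⟨rfl, rfl⟩ <;>
    rcases h2 with ⟨rfl, rfl⟩ | ⟨rfl, rfl⟩ | ⟨rfl, rfl⟩ | ⟨rfl, rfl⟩ | ⟨rfl, rfl⟩ | ⟨rfl, rfl⟩ <;>
    first
    | exact hne rfl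
    | (simp only [e01, e02, e03, e12, e13, e23] at p1 p2; omega)

theorem not_col3 {V : Type} {D : Digraph' V} (h : 4 ≤ D.dichromaticNumber) : ¬ Col3 D.Adj := by
  rintro ⟨c, hc⟩
  have : D.dichromaticNumber ≤ 3 := by
    apply Nat.sInf_le
    refine ⟨c, fun i v hv => hc v ?_⟩
    refine Relation.TransGen.mono (fun a b hab => ⟨?_, hab.2.2⟩) _ _ hv
    exact hab.1.trans hab.2.1.symm
  omega

theorem bound4 : Digraph'.MaderBound K4trans 4 := by
  intro n D hD h
  obtain ⟨s, t, hT⟩ := exists_TT (R := D.Adj) hD (not_col3 h)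
  exact hT.subdivision

theorem lower {k : ℕ} (hk : Digraph'.MaderBound K4trans k) : 4 ≤ k := by
  by_contra hc
  have := hk 3 ⟨fun a b => a ≠ b⟩ (fun v h => h rfl) (by
    apply le_trans (show k ≤ 3 by omega)
    apply le_csInf
    · refine ⟨3, id, ?_⟩
      intro i v hv
      obtain ⟨b, hb, _⟩ := Relation.TransGen.head'_iff.1 hv
      exact hb.2.2 (hb.1.trans hb.2.1.symm)
    · rintro j ⟨c, hcol⟩
      by_contra hj
      have hni : ¬ Function.Injective c := by
        intro hi
        have := Fintype.card_le_of_injective c hi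
        simp at this
        omega
      rw [Function.Injective] at hni
      push Not at hni
      obtain ⟨a, b, hab, hne⟩ := hni
      apply hcol (c a) a
      exact (Relation.TransGen.single ⟨rfl, hab.symm, hne⟩).tail ⟨hab.symm, rfl, hne.symm⟩)
  obtain ⟨β, _, hβ, _⟩ := this
  have := Fintype.card_le_of_injective β hβ
  simp at this

end final
end K4

/-- Every digraph with dichromatic number at least `4`
contains a subdivision of the transitive tournament `K⃗₄`; consequently
`mader(K⃗₄) = 4`. -/
theorem mader_K4trans : Digraph'.MaderBound K4trans 4 ∧ Digraph'.mader K4trans = 4 := by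
  refine ⟨K4.bound4, le_antisymm (Nat.sInf_le ⟨by norm_num, K4.bound4⟩) ?_⟩
  exact le_csInf ⟨4, by norm_num, K4.bound4⟩ (fun k hk => K4.lower hk.2)
end
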